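/- arXiv:2206.09134 — 2 statements merged into one kernel-verified Lean document; each statement's English description precedes it below -/
import Mathlib

section
/- Let 𝕂 be a number field and assume the Generalized Riemann Hypothesis for ζ_𝕂. Then for every ε > 0, the function m_𝕂(x) = ∑_{m ≤ x} b_m/m satisfies m_𝕂(x) = O_ε(x^{−1/2+ε}) as x → ∞. -/
open Complex NumberField Filter Topology Finset

/-- A form of **Hadamard's three circles theorem**, with a crude but convenient bound. -/
theorem norm_le_of_three_circles {g : ℂ → ℂ} {c : ℂ} {r₁ r₂ r₃ R a b : ℝ}
    (hr₁ : 0 < r₁) (h₁₂ : r₁ < r₂) (h₂₃ : r₂ < r₃) (h₃ : r₃ < R) (ha1 : 1 ≤ a) (hb1 : 1 ≤ b)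
    (hg : DifferentiableOn ℂ g (Metric.ball c R))
    (ha : ∀ z, ‖z - c‖ ≤ r₁ → ‖g z‖ ≤ a) (hb : ∀ z, ‖z - c‖ ≤ r₃ → ‖g z‖ ≤ b)
    {z : ℂ} (hz : ‖z - c‖ ≤ r₂) :
    ‖g z‖ ≤ a * b ^ ((Real.log r₂ - Real.log r₁) / (Real.log r₃ - Real.log r₁)) := by
  have hl₁₂ : Real.log r₁ < Real.log r₂ := Real.log_lt_log hr₁ h₁₂
  have hl₂₃ : Real.log r₂ < Real.log r₃ := Real.log_lt_log (hr₁.trans h₁₂) h₂₃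
  have hl : Real.log r₁ < Real.log r₃ := hl₁₂.trans hl₂₃
  have hr₃ : 0 < r₃ := hr₁.trans (h₁₂.trans h₂₃)
  by_cases hz1 : ‖z - c‖ ≤ r₁
  · refine (ha z hz1).trans (le_mul_of_one_le_right (by linarith) ?_)
    exact Real.one_le_rpow hb1 (div_nonneg (by linarith) (by linarith))
  push Not at hz1
  have hzc : z - c ≠ 0 := fun h => by simp [h] at hz1; linarith
  set w := Complex.log (z - c) with hw
  have hwexp : Complex.exp w = z - c := Complex.exp_log hzc
  have hwre : w.re = Real.log ‖z - c‖ := Complex.log_re _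
  have hwre1 : Real.log r₁ ≤ w.re := hwre ▸ Real.log_le_log hr₁ hz1.le
  have hwre2 : w.re ≤ Real.log r₂ := hwre ▸ Real.log_le_log (hr₁.trans hz1) hz
  have hle : ∀ v : ℂ, v.re ≤ Real.log r₃ → ‖(c + Complex.exp v) - c‖ ≤ r₃ := by
    intro v hv
    rw [add_sub_cancel_left, Complex.norm_exp]
    exact (Real.exp_le_exp.mpr hv).trans_eq (Real.exp_log hr₃)
  have hdiff : ∀ v : ℂ, v.re ≤ Real.log r₃ →
      DifferentiableAt ℂ (fun v => g (c + Complex.exp v)) v := by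
    intro v hv
    have h1 : c + Complex.exp v ∈ Metric.ball c R := by
      rw [Metric.mem_ball, dist_eq_norm]
      exact (hle v hv).trans_lt h₃
    have h2 := hg.differentiableAt (Metric.isOpen_ball.mem_nhds h1)
    exact DifferentiableAt.comp v (f := fun v => c + Complex.exp v) h2 (by fun_prop)
  have key := Complex.HadamardThreeLines.norm_le_interp_of_mem_verticalClosedStrip' (f := fun v => g (c + Complex.exp v))
    (z := w) (a := a) (b := b) hl ⟨hwre1, hwre2.trans hl₂₃.le⟩ ?_ ?_ ?_ ?_
  · have hθ : (w.re - Real.log r₁) / (Real.log r₃ - Real.log r₁) ≤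
        (Real.log r₂ - Real.log r₁) / (Real.log r₃ - Real.log r₁) := by
      have : 0 < Real.log r₃ - Real.log r₁ := by linarith
      gcongr
    have hθ0 : 0 ≤ (w.re - Real.log r₁) / (Real.log r₃ - Real.log r₁) :=
      div_nonneg (by linarith) (by linarith)
    simp only [hwexp, add_sub_cancel] at key
    refine key.trans (mul_le_mul ?_ ?_ (by positivity) (by linarith))
    · exact (Real.rpow_le_rpow_of_exponent_le ha1 (by linarith)).trans_eq (Real.rpow_one a)
    · exact Real.rpow_le_rpow_of_exponent_le hb1 hθ
  · refine DifferentiableOn.diffContOnCl fun v hv => (hdiff v ?_).differentiableWithinAt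
    have := Complex.HadamardThreeLines.verticalStrip
    rw [Complex.HadamardThreeLines.verticalStrip, closure_preimage_re, closure_Ioo hl.ne] at hv
    exact hv.2
  · refine ⟨b, ?_⟩
    rintro _ ⟨v, hv, rfl⟩
    exact hb _ (hle v hv.2)
  · intro v hv
    refine ha _ ?_
    rw [add_sub_cancel_left, Complex.norm_exp, show v.re = _ from hv, Real.exp_log hr₁]
  · intro v hv
    exact hb _ (hle v (show v.re = _ from hv).le)

/-- A nonvanishing holomorphic function on a disc has a holomorphic logarithm with prescribed
value at the centre. -/
theorem exists_log_on_ball {f : ℂ → ℂ} {c : ℂ} {R : ℝ} (hR : 0 < R)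
    (hf : DifferentiableOn ℂ f (Metric.ball c R)) (hf0 : ∀ z ∈ Metric.ball c R, f z ≠ 0) :
    ∃ g : ℂ → ℂ, DifferentiableOn ℂ g (Metric.ball c R) ∧ g c = Complex.log (f c) ∧
      ∀ z ∈ Metric.ball c R, Complex.exp (g z) = f z := by
  have hd : DifferentiableOn ℂ (fun z => deriv f z / f z) (Metric.ball c R) :=
    (hf.deriv Metric.isOpen_ball).div hf hf0
  obtain ⟨g, hg⟩ := hd.isExactOn_ball.with_val_at c (Complex.log (f c))
  have hc : c ∈ Metric.ball c R := Metric.mem_ball_self hR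
  refine ⟨g, fun z hz => (hg.2 z hz).differentiableAt.differentiableWithinAt, hg.1, ?_⟩
  have hconst : ∀ z ∈ Metric.ball c R, HasDerivAt (fun z => Complex.exp (-g z) * f z) 0 z := by
    intro z hz
    have h1 := (hg.2 z hz).neg.cexp.mul
      (hf.differentiableAt (Metric.isOpen_ball.mem_nhds hz)).hasDerivAt
    refine h1.congr_deriv ?_
    have := hf0 z hz
    simp only [Pi.neg_apply]
    field_simp
    ring
  intro z hz
  have h2 := (convex_ball c R).isPreconnected
  have h3 : (fun z => Complex.exp (-g z) * f z) z = (fun z => Complex.exp (-g z) * f z) c := by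
    refine IsOpen.is_const_of_deriv_eq_zero (𝕜 := ℂ) (f := fun z => Complex.exp (-g z) * f z)
      Metric.isOpen_ball h2 ?_ ?_ hz hc
    · exact fun z hz => (hconst z hz).differentiableAt.differentiableWithinAt
    · exact fun z hz => (hconst z hz).deriv
  simp only [hg.1, Complex.exp_neg, Complex.exp_log (hf0 c hc), inv_mul_cancel₀ (hf0 c hc)] at h3
  have h4 := Complex.exp_ne_zero (g z)
  field_simp at h3
  exact h3.symm

/-- The Borel-Carathéodory theorem on a disc centred at `c`. -/
theorem borelCaratheodory_ball {f : ℂ → ℂ} {c : ℂ} {R r M : ℝ} (hM : 0 < M) (hr : 0 ≤ r)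
    (hrR : r < R) (hf : DifferentiableOn ℂ f (Metric.ball c R))
    (hf₁ : ∀ z ∈ Metric.ball c R, (f z).re ≤ M) {z : ℂ} (hz : ‖z - c‖ ≤ r) :
    ‖f z‖ ≤ (2 * M + 2 * ‖f c‖) * R / (R - r) := by
  have hR : 0 < R := hr.trans_lt hrR
  have hmem : ∀ w ∈ Metric.ball (0 : ℂ) R, c + w ∈ Metric.ball c R := by
    intro w hw
    simpa using hw
  have h := borelCaratheodory (f := fun w => f (c + w)) (R := R) (z := z - c) hM ?_ ?_ hR ?_
  · simp only [add_sub_cancel, add_zero] at h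
    refine h.trans ?_
    rw [← add_div]
    have h0 := norm_nonneg (f c)
    have : 0 < R - r := by linarith
    have h1 : 2 * M * ‖z - c‖ + ‖f c‖ * (R + ‖z - c‖) ≤ (2 * M + 2 * ‖f c‖) * R := by
      have h2 : ‖z - c‖ ≤ R := by linarith
      nlinarith
    exact div_le_div₀ (by positivity) h1 this (by linarith)
  · intro w hw
    have := hf.differentiableAt (Metric.isOpen_ball.mem_nhds (hmem w hw))
    exact (DifferentiableAt.comp w (f := fun w => c + w) this (by fun_prop)).differentiableWithinAt
  · exact fun w hw => hf₁ _ (hmem w hw)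
  · simpa using hz.trans_lt hrR

theorem norm_le_of_norm_one_sub_cpow_mul_le {G : ℂ → ℂ} (hG : Differentiable ℂ G) {q : ℝ}
    (hq : 1 < q) {C : ℝ} (hC : 0 ≤ C) {A : ℕ}
    (hgrowth : ∀ s : ℂ, 1 / 2 < s.re → s.re < 3 →
      ‖1 - (q : ℂ) ^ (1 - s)‖ * ‖G s‖ ≤ C * (1 + ‖s‖) ^ A) :
    ∃ C' : ℝ, 0 ≤ C' ∧ ∀ s : ℂ, 1 / 2 < s.re → s.re ≤ 5 / 4 → ‖G s‖ ≤ C' * (1 + ‖s‖) ^ A := by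
  have hq0 : 0 < q := by linarith
  set l := Real.log q with hl
  have hl0 : 0 < l := Real.log_pos hq
  set d := min 1 (min (q ^ (1 / 4 : ℝ) - 1) (1 - q ^ (-(1 / 4) : ℝ))) with hd
  have hd0 : 0 < d := by
    refine lt_min one_pos (lt_min ?_ ?_)
    · linarith [Real.one_lt_rpow hq (show (0 : ℝ) < 1 / 4 by norm_num)]
    · linarith [Real.rpow_lt_one_of_one_lt_of_neg hq (show (-(1 / 4) : ℝ) < 0 by norm_num)]
  have hnorm : ∀ s : ℂ, ‖(q : ℂ) ^ (1 - s)‖ = q ^ (1 - s.re) := by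
    intro s
    rw [Complex.norm_cpow_eq_rpow_re_of_pos hq0]
    simp
  have hdiv : ∀ s : ℂ, 1 / 2 < s.re → s.re < 3 → d ≤ ‖1 - (q : ℂ) ^ (1 - s)‖ →
      ‖G s‖ ≤ C / d * (1 + ‖s‖) ^ A := by
    intro s h1 h2 h3
    have h4 := hgrowth s h1 h2
    rw [div_mul_eq_mul_div, le_div_iff₀ hd0]
    refine le_trans ?_ h4
    rw [mul_comm]
    gcongr
  have hleft : ∀ s : ℂ, s.re ≤ 3 / 4 → d ≤ ‖1 - (q : ℂ) ^ (1 - s)‖ := by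
    intro s hs
    have h1 : q ^ (1 / 4 : ℝ) ≤ q ^ (1 - s.re) :=
      Real.rpow_le_rpow_of_exponent_le hq.le (by linarith)
    have h2 := norm_sub_norm_le ((q : ℂ) ^ (1 - s)) 1
    rw [norm_sub_rev, hnorm, norm_one] at h2
    have h3 : d ≤ q ^ (1 / 4 : ℝ) - 1 := (min_le_right _ _).trans (min_le_left _ _)
    linarith
  have hright : ∀ s : ℂ, 5 / 4 ≤ s.re → d ≤ ‖1 - (q : ℂ) ^ (1 - s)‖ := by
    intro s hs
    have h1 : q ^ (1 - s.re) ≤ q ^ (-(1 / 4) : ℝ) :=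
      Real.rpow_le_rpow_of_exponent_le hq.le (by linarith)
    have h2 := norm_sub_norm_le 1 ((q : ℂ) ^ (1 - s))
    rw [hnorm, norm_one] at h2
    have h3 : d ≤ 1 - q ^ (-(1 / 4) : ℝ) := (min_le_right _ _).trans (min_le_right _ _)
    linarith
  have hhor : ∀ (s : ℂ) (k : ℤ), s.im = (2 * k + 1) * Real.pi / l →
      d ≤ ‖1 - (q : ℂ) ^ (1 - s)‖ := by
    intro s k hs
    have h1 : (q : ℂ) ^ (1 - s) = -((q ^ (1 - s.re) : ℝ) : ℂ) := by
      have h0 : (1 - s) = ((1 - s.re : ℝ) : ℂ) + ((-s.im : ℝ) : ℂ) * I := by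
        apply Complex.ext <;> simp
      rw [h0, Complex.cpow_add _ _ (by exact_mod_cast hq0.ne'), ← Complex.ofReal_cpow hq0.le,
        Complex.cpow_def_of_ne_zero (by exact_mod_cast hq0.ne') (((-s.im : ℝ) : ℂ) * I),
        ← Complex.ofReal_log hq0.le, ← hl, hs]
      have h2 : (l : ℂ) * (((-((2 * k + 1) * Real.pi / l) : ℝ) : ℂ) * I) =
          Real.pi * I + (-k - 1 : ℤ) * (2 * Real.pi * I) := by
        have : (l : ℂ) ≠ 0 := by exact_mod_cast hl0.ne'
        push_cast
        field_simp
        ring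
      rw [h2, Complex.exp_periodic.int_mul, Complex.exp_pi_mul_I]
      ring
    rw [h1, sub_neg_eq_add]
    have h2 : (0 : ℝ) ≤ q ^ (1 - s.re) := by positivity
    rw [show (1 : ℂ) + ((q ^ (1 - s.re) : ℝ) : ℂ) = ((1 + q ^ (1 - s.re) : ℝ) : ℂ) by push_cast; rfl,
      Complex.norm_of_nonneg (by linarith)]
    have : d ≤ 1 := min_le_left _ _
    linarith
  set D := 1 / 2 + 2 * Real.pi / l with hD
  have hD0 : 0 ≤ D := by positivity
  have hCd : 0 ≤ C / d := by positivity
  refine ⟨C / d * (1 + D) ^ A, by positivity, fun s h1 h2 => ?_⟩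
  rcases le_or_gt s.re (3 / 4) with h3 | h3
  · refine (hdiv s h1 (by linarith) (hleft s h3)).trans ?_
    rw [mul_assoc]
    gcongr
    exact le_mul_of_one_le_left (by positivity) (one_le_pow₀ (by linarith))
  -- the rectangle around `s` with horizontal sides where `q ^ (1 - s)` is negative
  set k := ⌊(s.im * l / Real.pi - 1) / 2⌋ with hk
  have hpi := Real.pi_pos
  have hk1 : (2 * k + 1) * Real.pi / l ≤ s.im := by
    have := Int.floor_le ((s.im * l / Real.pi - 1) / 2)
    rw [div_le_iff₀ hl0, ← le_div_iff₀ hpi]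
    linarith
  have hk2 : s.im < (2 * (k + 1 : ℤ) + 1) * Real.pi / l := by
    have := Int.lt_floor_add_one ((s.im * l / Real.pi - 1) / 2)
    rw [lt_div_iff₀ hl0, ← div_lt_iff₀ hpi]
    push_cast
    linarith
  set t₁ := (2 * k + 1) * Real.pi / l with ht₁
  set t₂ := (2 * (k + 1 : ℤ) + 1) * Real.pi / l with ht₂
  have ht : t₂ = t₁ + 2 * Real.pi / l := by
    rw [ht₁, ht₂]; push_cast; ring
  have ht12 : t₁ ≠ t₂ := (hk1.trans_lt hk2).ne
  set U := Set.Ioo (3 / 4 : ℝ) (5 / 4) ×ℂ Set.Ioo t₁ t₂ with hU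
  have hcl : closure U = Set.Icc (3 / 4 : ℝ) (5 / 4) ×ℂ Set.Icc t₁ t₂ := by
    rw [hU, Complex.closure_reProdIm, closure_Ioo (by norm_num), closure_Ioo ht12]
  have hnear : ∀ z ∈ closure U, 1 + ‖z‖ ≤ (1 + D) * (1 + ‖s‖) := by
    intro z hz
    rw [hcl] at hz
    obtain ⟨⟨hz1, hz2⟩, hz3, hz4⟩ := hz
    change 3 / 4 ≤ z.re at hz1
    change z.re ≤ 5 / 4 at hz2
    change t₁ ≤ z.im at hz3
    change z.im ≤ t₂ at hz4
    have h5 : ‖z - s‖ ≤ D := by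
      refine (Complex.norm_le_abs_re_add_abs_im _).trans ?_
      simp only [Complex.sub_re, Complex.sub_im]
      refine add_le_add ?_ ?_
      · rw [abs_le]; constructor <;> linarith
      · rw [abs_le]; constructor <;> linarith
    have h6 : ‖z‖ ≤ ‖s‖ + ‖z - s‖ := norm_le_norm_add_norm_sub' z s
    nlinarith [norm_nonneg s, norm_nonneg z]
  have hUb : Bornology.IsBounded U := by
    rw [hU]
    exact (Metric.isBounded_Ioo _ _).reProdIm (Metric.isBounded_Ioo _ _)
  refine Complex.norm_le_of_forall_mem_frontier_norm_le hUb hG.diffContOnCl (fun z hz => ?_) ?_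
  · have hzcl : z ∈ closure U := frontier_subset_closure hz
    have hz' := hnear z hzcl
    rw [hcl] at hzcl
    obtain ⟨⟨hz1, hz2⟩, hz3, hz4⟩ := hzcl
    have hzd : d ≤ ‖1 - (q : ℂ) ^ (1 - z)‖ := by
      rw [hU, Complex.frontier_reProdIm, frontier_Ioo (hk1.trans_lt hk2),
        frontier_Ioo (by norm_num)] at hz
      rcases hz with ⟨_, hz⟩ | ⟨hz, _⟩
      · rcases hz with hz | hz
        · exact hhor z k hz
        · exact hhor z (k + 1) hz
      · rcases hz with hz | hz
        · exact hleft z (le_of_eq hz)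
        · exact hright z (ge_of_eq hz)
    change 3 / 4 ≤ z.re at hz1
    change z.re ≤ 5 / 4 at hz2
    refine (hdiv z (by linarith) (by linarith) hzd).trans ?_
    rw [mul_assoc, ← mul_pow]
    gcongr
  · rw [hcl]
    exact ⟨⟨h3.le, h2⟩, hk1, hk2.le⟩

theorem exists_mul_rpow_le_mul_add {θ a ε : ℝ} (hθ0 : 0 ≤ θ) (hθ : θ < 1) (ha : 0 < a)
    (hε : 0 < ε) : ∃ C : ℝ, ∀ x : ℝ, 0 < x → a * x ^ θ ≤ ε * x + C := by
  set x₀ := (a / ε) ^ (1 / (1 - θ)) with hx₀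
  have hx₀0 : 0 < x₀ := by positivity
  refine ⟨a * x₀ ^ θ, fun x hx => ?_⟩
  rcases le_total x x₀ with h | h
  · have h1 : x ^ θ ≤ x₀ ^ θ := Real.rpow_le_rpow hx.le h hθ0
    nlinarith [mul_pos hε hx]
  · have h1 : x ^ (θ - 1) ≤ x₀ ^ (θ - 1) :=
      Real.rpow_le_rpow_of_nonpos hx₀0 h (by linarith)
    have h2 : x₀ ^ (θ - 1) = ε / a := by
      rw [hx₀, ← Real.rpow_mul (by positivity), show 1 / (1 - θ) * (θ - 1) = -1 by
        have : 1 - θ ≠ 0 := by linarith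
        field_simp
        ring, Real.rpow_neg_one, inv_div]
    have h3 : x ^ θ = x ^ (θ - 1) * x := by
      rw [← Real.rpow_add_one hx.ne']; ring_nf
    rw [h2] at h1
    have h4 : a * x ^ θ ≤ ε * x := by
      rw [h3, ← mul_assoc]
      refine mul_le_mul_of_nonneg_right ?_ hx.le
      calc a * x ^ (θ - 1) ≤ a * (ε / a) := by gcongr
        _ = ε := by field_simp
    have : 0 ≤ a * x₀ ^ θ := by positivity
    linarith

set_option maxHeartbeats 2000000 in
/-- **Littlewood's bound**: a function `f` of finite order which is bounded together with `1 / f`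
in `re s ≥ 1 + δ` and has no zeros in `re s > 1/2` satisfies `1 / f = O(|t| ^ ε)` in
`re s ≥ 1/2 + η`. Here `f s = G s / (s - 1)`. -/
theorem exists_norm_sub_one_div_le {G : ℂ → ℂ} (hG : Differentiable ℂ G)
    (hG0 : ∀ s : ℂ, 1 / 2 < s.re → G s ≠ 0) {q : ℝ}
    (hq : 1 < q) {C : ℝ} (hC : 0 ≤ C) {A : ℕ}
    (hgrowth : ∀ s : ℂ, 1 / 2 < s.re → s.re < 3 →
      ‖1 - (q : ℂ) ^ (1 - s)‖ * ‖G s‖ ≤ C * (1 + ‖s‖) ^ A)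
    (hbd : ∀ δ : ℝ, 0 < δ → ∃ B : ℝ, ∀ s : ℂ, 1 + δ ≤ s.re →
      ‖G s / (s - 1)‖ ≤ B ∧ ‖(s - 1) / G s‖ ≤ B) {η ε : ℝ} (hη : 0 < η) (hε : 0 < ε) :
    ∃ C' : ℝ, ∀ s : ℂ, 1 / 2 + η ≤ s.re → s.re ≤ 2 →
      ‖(s - 1) / G s‖ ≤ C' * (1 + |s.im|) ^ ε := by
  wlog hη4 : η ≤ 1 / 4 generalizing η
  · obtain ⟨C', hC'⟩ := this (η := 1 / 4) (by norm_num) le_rfl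
    exact ⟨C', fun s hs => hC' s (by linarith)⟩
  obtain ⟨C₁, hC₁, hG1⟩ := norm_le_of_norm_one_sub_cpow_mul_le hG hq hC hgrowth
  obtain ⟨B₀, hB₀⟩ := hbd (1 / 8) (by norm_num)
  set B := max 1 B₀ with hB
  have hB1 : 1 ≤ B := le_max_left _ _
  have hBl : 0 ≤ Real.log B := Real.log_nonneg hB1
  have hBf : ∀ s : ℂ, 9 / 8 ≤ s.re → ‖G s / (s - 1)‖ ≤ B ∧ ‖(s - 1) / G s‖ ≤ B := by
    intro s hs
    obtain ⟨h1, h2⟩ := hB₀ s (by linarith)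
    exact ⟨h1.trans (le_max_right _ _), h2.trans (le_max_right _ _)⟩
  have hGall : ∀ s : ℂ, 1 / 2 < s.re → ‖G s‖ ≤ (C₁ + B) * (1 + ‖s‖) ^ (A + 1) := by
    intro s hs
    have h1 : (1 : ℝ) ≤ 1 + ‖s‖ := by linarith [norm_nonneg s]
    rcases le_or_gt s.re (5 / 4) with h | h
    · calc ‖G s‖ ≤ C₁ * (1 + ‖s‖) ^ A := hG1 s hs h
        _ ≤ (C₁ + B) * (1 + ‖s‖) ^ (A + 1) := by
          gcongr
          · linarith
          · omega
    · have h2 := (hBf s (by linarith)).1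
      have h3 : s - 1 ≠ 0 := by
        intro h0
        have := congrArg Complex.re h0
        simp at this
        linarith
      rw [norm_div, div_le_iff₀ (norm_pos_iff.mpr h3)] at h2
      calc ‖G s‖ ≤ B * ‖s - 1‖ := h2
        _ ≤ (C₁ + B) * (1 + ‖s‖) := by
          gcongr
          · linarith
          · rw [add_comm]
            exact (norm_sub_le s 1).trans (by simp)
        _ ≤ (C₁ + B) * (1 + ‖s‖) ^ (A + 1) := by
          gcongr
          exact le_self_pow₀ h1 (by omega)
  set B₁ := Real.log B + Real.pi with hB₁
  have hB₁0 : 0 ≤ B₁ := by positivity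
  set a := max 1 ((2 * (Real.log B + 1) + 2 * B₁) * (7 / 8) / (7 / 8 - 3 / 4)) with ha
  set M₀ := Real.log (2 * (C₁ + B) + 1) + (A + 1) with hM₀
  have hM₀0 : 0 < M₀ := by
    have : 0 ≤ Real.log (2 * (C₁ + B) + 1) := Real.log_nonneg (by linarith)
    positivity
  set K := max 1 ((2 * M₀ + 2 * B₁) * (3 / 2) / (3 / 2 - (3 / 2 - η / 2))) with hK
  set θ := (Real.log (3 / 2 - η) - Real.log (3 / 4)) /
    (Real.log (3 / 2 - η / 2) - Real.log (3 / 4)) with hθ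
  have hl1 : Real.log (3 / 4) < Real.log (3 / 2 - η) :=
    Real.log_lt_log (by norm_num) (by linarith)
  have hl2 : Real.log (3 / 2 - η) < Real.log (3 / 2 - η / 2) :=
    Real.log_lt_log (by linarith) (by linarith)
  have hθ0 : 0 ≤ θ := div_nonneg (by linarith) (by linarith)
  have hθ1 : θ < 1 := (div_lt_one (by linarith)).mpr (by linarith)
  have ha1 : 1 ≤ a := le_max_left _ _
  have hK1 : 1 ≤ K := le_max_left _ _
  obtain ⟨C₀, hC₀⟩ := exists_mul_rpow_le_mul_add hθ0 hθ1 (show 0 < a by linarith)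
    (show 0 < ε / K by positivity)
  -- the bound for large imaginary part
  have hlarge : ∀ s : ℂ, 1 / 2 + η ≤ s.re → s.re ≤ 2 → 2 ≤ |s.im| →
      ‖(s - 1) / G s‖ ≤ Real.exp C₀ * 5 ^ ε * (1 + |s.im|) ^ ε := by
    intro s hs1 hs2 hst
    set c : ℂ := 2 + s.im * I with hc
    have hcre : c.re = 2 := by simp [hc]
    have hcim : c.im = s.im := by simp [hc]
    have hball : ∀ z ∈ Metric.ball c (3 / 2), 1 / 2 < z.re ∧ 1 / 2 < ‖z - 1‖ ∧
        ‖z‖ ≤ 4 + |s.im| := by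
      intro z hz
      rw [Metric.mem_ball, dist_eq_norm] at hz
      have h1 := (Complex.abs_re_le_norm (z - c)).trans_lt hz
      have h2 := (Complex.abs_im_le_norm (z - c)).trans_lt hz
      rw [Complex.sub_re, hcre, abs_lt] at h1
      rw [Complex.sub_im, hcim] at h2
      refine ⟨by linarith, ?_, ?_⟩
      · have h3 := Complex.abs_im_le_norm (z - 1)
        rw [Complex.sub_im, Complex.one_im, sub_zero] at h3
        have h4 := abs_sub_abs_le_abs_sub s.im z.im
        rw [abs_sub_comm] at h4
        linarith
      · have h3 : ‖z‖ ≤ ‖c‖ + ‖z - c‖ := norm_le_norm_add_norm_sub' z c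
        have h4 : ‖c‖ ≤ 2 + |s.im| := by
          refine (norm_add_le _ _).trans ?_
          simp
        linarith
    set f : ℂ → ℂ := fun z => G z / (z - 1) with hf
    have hfd : DifferentiableOn ℂ f (Metric.ball c (3 / 2)) := by
      refine hG.differentiableOn.div (by fun_prop) fun z hz h0 => ?_
      have := (hball z hz).2.1
      rw [h0, norm_zero] at this
      linarith
    have hf0 : ∀ z ∈ Metric.ball c (3 / 2), f z ≠ 0 := by
      intro z hz
      refine div_ne_zero (hG0 z (hball z hz).1) fun h0 => ?_
      have := (hball z hz).2.1
      rw [h0, norm_zero] at this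
      linarith
    obtain ⟨g, hgd, hgc, hge⟩ := exists_log_on_ball (by norm_num) hfd hf0
    have hgre : ∀ z ∈ Metric.ball c (3 / 2), (g z).re = Real.log ‖f z‖ := by
      intro z hz
      rw [← hge z hz, Complex.norm_exp, Real.log_exp]
    have hfB : ∀ z : ℂ, 9 / 8 ≤ z.re → Real.log ‖f z‖ ≤ Real.log B := by
      intro z hz
      rcases (norm_nonneg (f z)).eq_or_lt' with h | h
      · rw [h, Real.log_zero]; exact hBl
      · exact Real.log_le_log h (hBf z hz).1
    have hgcn : ‖g c‖ ≤ B₁ := by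
      rw [hgc]
      refine (Complex.norm_le_abs_re_add_abs_im _).trans ?_
      rw [Complex.log_re, Complex.log_im]
      refine add_le_add ?_ (Complex.abs_arg_le_pi _)
      rw [abs_le]
      refine ⟨?_, hfB c (by rw [hcre]; norm_num)⟩
      have h1 := (hBf c (by rw [hcre]; norm_num)).2
      have h2 : ‖(c - 1) / G c‖ = ‖f c‖⁻¹ := by rw [hf, ← norm_inv, inv_div]
      have h3 : 0 < ‖f c‖ := norm_pos_iff.mpr (hf0 c (Metric.mem_ball_self (by norm_num)))
      have h4 := Real.log_le_log (by positivity) (h2 ▸ h1)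
      rw [Real.log_inv] at h4
      linarith
    set L := Real.log (5 + |s.im|) with hL
    have hL1 : 1 ≤ L := by
      rw [hL, Real.le_log_iff_exp_le (by positivity)]
      have := Real.exp_one_lt_d9
      linarith [abs_nonneg s.im]
    have hfM : ∀ z ∈ Metric.ball c (3 / 2), (g z).re ≤ M₀ * L := by
      intro z hz
      rw [hgre z hz]
      obtain ⟨h1, h2, h3⟩ := hball z hz
      have h4 : ‖f z‖ ≤ (2 * (C₁ + B) + 1) * (5 + |s.im|) ^ (A + 1) := by
        rw [hf]
        simp only [norm_div]
        rw [div_le_iff₀ (by linarith)]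
        calc ‖G z‖ ≤ (C₁ + B) * (1 + ‖z‖) ^ (A + 1) := hGall z h1
          _ ≤ (C₁ + B) * (5 + |s.im|) ^ (A + 1) := by
            gcongr ?_ * ?_ ^ _
            linarith
          _ ≤ (2 * (C₁ + B) + 1) * (5 + |s.im|) ^ (A + 1) * (1 / 2) := by
            have : 0 < (5 + |s.im|) ^ (A + 1) := by positivity
            nlinarith
          _ ≤ _ := by gcongr
      refine (Real.log_le_log (norm_pos_iff.mpr (hf0 z hz)) h4).trans ?_
      rw [Real.log_mul (by positivity) (by positivity), Real.log_pow, ← hL, hM₀, add_mul]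
      push_cast
      have : 0 ≤ Real.log (2 * (C₁ + B) + 1) := Real.log_nonneg (by linarith)
      nlinarith
    have hb1 : 1 ≤ K * L := by nlinarith
    have key := norm_le_of_three_circles (g := g) (c := c) (r₁ := 3 / 4) (r₂ := 3 / 2 - η)
      (r₃ := 3 / 2 - η / 2) (R := 3 / 2) (a := a) (b := K * L) (by norm_num) (by linarith)
      (by linarith) (by linarith) ha1 hb1 hgd ?_ ?_ (z := s) ?_
    · rw [← hθ] at key
      have hsball : s ∈ Metric.ball c (3 / 2) := by
        rw [Metric.mem_ball, dist_eq_norm]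
        have : s - c = ((s.re - 2 : ℝ) : ℂ) := by apply Complex.ext <;> simp [hc]
        rw [this, Complex.norm_real, Real.norm_eq_abs, abs_lt]
        constructor <;> linarith
      have h1 : ‖(s - 1) / G s‖ = Real.exp (-(g s).re) := by
        have : (s - 1) / G s = Complex.exp (-g s) := by
          rw [Complex.exp_neg, hge s hsball, hf, inv_div]
        rw [this, Complex.norm_exp, Complex.neg_re]
      have h2 := hC₀ (K * L) (by linarith)
      have h3 : -(g s).re ≤ ε * L + C₀ := by
        have h4 := (abs_le.mp (Complex.abs_re_le_norm (g s))).1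
        have h5 : ε / K * (K * L) = ε * L := by field_simp
        linarith
      have hbase : (0 : ℝ) < 5 + |s.im| := by positivity
      calc ‖(s - 1) / G s‖ = Real.exp (-(g s).re) := h1
        _ ≤ Real.exp (ε * L + C₀) := Real.exp_le_exp.mpr h3
        _ = Real.exp C₀ * (5 + |s.im|) ^ ε := by
          rw [Real.exp_add, Real.rpow_def_of_pos hbase, ← hL]; ring_nf
        _ ≤ Real.exp C₀ * (5 * (1 + |s.im|)) ^ ε := by
          gcongr
          linarith [abs_nonneg s.im]
        _ = _ := by rw [Real.mul_rpow (by norm_num) (by positivity)]; ring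
    · intro z hz
      refine (borelCaratheodory_ball (R := 7 / 8) (M := Real.log B + 1) (by linarith)
        (by norm_num) (by norm_num) (hgd.mono (Metric.ball_subset_ball (by norm_num))) ?_
        hz).trans ?_
      · intro w hw
        rw [hgre w (Metric.ball_subset_ball (by norm_num) hw)]
        have : 9 / 8 ≤ w.re := by
          rw [Metric.mem_ball, dist_eq_norm] at hw
          have h1 := (Complex.abs_re_le_norm (w - c)).trans_lt hw
          rw [Complex.sub_re, hcre, abs_lt] at h1
          linarith
        linarith [hfB w this]
      · refine le_trans ?_ (le_max_right _ _)
        have : (0 : ℝ) < 7 / 8 - 3 / 4 := by norm_num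
        gcongr
    · intro z hz
      refine (borelCaratheodory_ball (R := 3 / 2) (M := M₀ * L) (by positivity)
        (by linarith) (by linarith) hgd hfM hz).trans ?_
      have h0 : 0 < 3 / 2 - (3 / 2 - η / 2) := by linarith
      calc (2 * (M₀ * L) + 2 * ‖g c‖) * (3 / 2) / (3 / 2 - (3 / 2 - η / 2))
          ≤ (2 * (M₀ * L) + 2 * (B₁ * L)) * (3 / 2) / (3 / 2 - (3 / 2 - η / 2)) := by
            gcongr
            nlinarith
        _ = (2 * M₀ + 2 * B₁) * (3 / 2) / (3 / 2 - (3 / 2 - η / 2)) * L := by ring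
        _ ≤ K * L := by
          gcongr
          exact le_max_right _ _
    · have : s - c = ((s.re - 2 : ℝ) : ℂ) := by apply Complex.ext <;> simp [hc]
      rw [this, Complex.norm_real, Real.norm_eq_abs, abs_le]
      constructor <;> linarith
  -- the bound for small imaginary part
  have hcomp : IsCompact (Set.Icc (1 / 2 + η) 2 ×ℂ Set.Icc (-2 : ℝ) 2) :=
    isCompact_Icc.reProdIm isCompact_Icc
  obtain ⟨C₂, hC₂⟩ := hcomp.exists_bound_of_continuousOn
    (f := fun s => (s - 1) / G s) (by
      refine ContinuousOn.div (by fun_prop) hG.continuous.continuousOn fun s hs => hG0 s ?_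
      have : 1 / 2 + η ≤ s.re := hs.1.1
      linarith)
  refine ⟨max (Real.exp C₀ * 5 ^ ε) C₂, fun s hs1 hs2 => ?_⟩
  have hone : 1 ≤ (1 + |s.im|) ^ ε :=
    Real.one_le_rpow (by linarith [abs_nonneg s.im]) hε.le
  rcases le_total 2 |s.im| with h | h
  · refine (hlarge s hs1 hs2 h).trans ?_
    gcongr
    exact le_max_left _ _
  · have h1 := hC₂ s ⟨⟨hs1, hs2⟩, abs_le.mp h⟩
    have h2 : 0 ≤ C₂ := (norm_nonneg _).trans h1
    calc ‖(s - 1) / G s‖ ≤ C₂ := h1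
      _ ≤ max (Real.exp C₀ * 5 ^ ε) C₂ := le_max_right _ _
      _ ≤ _ := le_mul_of_one_le_right (h2.trans (le_max_right _ _)) hone

theorem hasMellin_max_one_sub {s : ℂ} (hs : 0 < s.re) :
    HasMellin (fun y : ℝ => ((max (1 - y) 0 : ℝ) : ℂ)) s (1 / (s * (s + 1))) := by
  have h1 := hasMellin_one_Ioc hs
  have h2 := hasMellin_cpow_Ioc 1 (s := s) (by simp; linarith)
  have h3 := hasMellin_sub h1.1 h2.1
  rw [h1.2, h2.2] at h3
  have hs0 : s ≠ 0 := by rintro rfl; simp at hs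
  have hs1 : s + 1 ≠ 0 := by
    intro h
    have := congrArg Complex.re h
    simp at this
    linarith
  have h4 : Set.EqOn (fun t : ℝ => (t : ℂ) ^ (s - 1) • (Set.indicator (Set.Ioc 0 1)
      (fun _ => (1 : ℂ)) t - Set.indicator (Set.Ioc 0 1) (fun t : ℝ => (t : ℂ) ^ (1 : ℂ)) t))
      (fun t : ℝ => (t : ℂ) ^ (s - 1) • ((max (1 - t) 0 : ℝ) : ℂ)) (Set.Ioi 0) := by
    intro t ht
    have ht' : 0 < t := ht
    simp only
    congr 1
    by_cases h : t ≤ 1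
    · have hm : t ∈ Set.Ioc (0 : ℝ) 1 := ⟨ht', h⟩
      rw [Set.indicator_of_mem hm, Set.indicator_of_mem hm, max_eq_left (by linarith)]
      simp
    · rw [Set.indicator_of_notMem (by simp [h]), Set.indicator_of_notMem (by simp [h]),
        max_eq_right (by linarith)]
      simp
  refine ⟨h3.1.congr_fun h4 measurableSet_Ioi, ?_⟩
  have h5 := h3.2
  rw [mellin] at h5 ⊢
  rw [← MeasureTheory.setIntegral_congr_fun measurableSet_Ioi h4, h5]
  field_simp
  ring

theorem integrable_of_norm_le_mul_rpow {f : ℝ → ℂ} (hf : Continuous f) {C r : ℝ} (hr : 1 < r)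
    (h : ∀ t, ‖f t‖ ≤ C * (1 + |t|) ^ (-r)) : MeasureTheory.Integrable f := by
  have h1 : MeasureTheory.Integrable (fun t : ℝ => C * (1 + ‖t‖) ^ (-r)) :=
    (integrable_one_add_norm (E := ℝ) (by simpa using hr)).const_mul C
  exact h1.mono' hf.aestronglyMeasurable (Eventually.of_forall h)

theorem continuous_inv_mul_add_one {c : ℝ} (hc : 0 < c) :
    Continuous fun t : ℝ => 1 / (((c : ℂ) + t * I) * ((c : ℂ) + t * I + 1)) := by
  refine Continuous.div (by fun_prop) (by fun_prop) fun t h => ?_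
  rcases mul_eq_zero.mp h with h | h <;>
  · have := congrArg Complex.re h
    simp at this
    linarith

theorem integrable_inv_mul_add_one {c : ℝ} (hc : 0 < c) :
    MeasureTheory.Integrable fun t : ℝ => 1 / (((c : ℂ) + t * I) * ((c : ℂ) + t * I + 1)) := by
  refine integrable_of_norm_le_mul_rpow (continuous_inv_mul_add_one hc)
    (C := (1 + c⁻¹) ^ 2) (r := 2) (by norm_num) fun t => ?_
  have h1 : ∀ a : ℝ, c ≤ a → (1 + |t|) ≤ (1 + c⁻¹) * ‖(a : ℂ) + t * I‖ := by
    intro a ha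
    have h2 := Complex.abs_re_le_norm ((a : ℂ) + t * I)
    have h3 := Complex.abs_im_le_norm ((a : ℂ) + t * I)
    simp at h2 h3
    have h4 := le_abs_self a
    have : 1 ≤ c⁻¹ * ‖(a : ℂ) + t * I‖ := by
      rw [inv_mul_eq_div, le_div_iff₀ hc]
      linarith
    linarith
  have h5 := h1 c le_rfl
  have h6 := h1 (c + 1) (by linarith)
  have h7 : ((c : ℂ) + t * I + 1) = ((c + 1 : ℝ) : ℂ) + t * I := by push_cast; ring
  rw [h7, norm_div, norm_mul, norm_one, Real.rpow_neg (by positivity)]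
  have h8 : 0 < ‖(c : ℂ) + t * I‖ := by
    have : 0 < (1 + c⁻¹) * ‖(c : ℂ) + t * I‖ := by
      have := abs_nonneg t
      linarith
    exact pos_of_mul_pos_right this (by positivity)
  have h9 : 0 < ‖((c + 1 : ℝ) : ℂ) + t * I‖ := by
    have : 0 < (1 + c⁻¹) * ‖((c + 1 : ℝ) : ℂ) + t * I‖ := by
      have := abs_nonneg t
      linarith
    exact pos_of_mul_pos_right this (by positivity)
  rw [← div_eq_mul_inv, div_le_div_iff₀ (by positivity) (by positivity)]
  calc 1 * (1 + |t|) ^ (2 : ℝ) = (1 + |t|) * (1 + |t|) := by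
        rw [one_mul, Real.rpow_two, sq]
    _ ≤ ((1 + c⁻¹) * ‖(c : ℂ) + t * I‖) * ((1 + c⁻¹) * ‖((c + 1 : ℝ) : ℂ) + t * I‖) := by
        gcongr
    _ = _ := by ring

theorem integral_cpow_div_mul_add_one {c y : ℝ} (hc : 0 < c) (hy : 0 < y) :
    1 / (2 * Real.pi) * ∫ t : ℝ, (y : ℂ) ^ (-((c : ℂ) + t * I)) *
      (1 / (((c : ℂ) + t * I) * ((c : ℂ) + t * I + 1))) = ((max (1 - y) 0 : ℝ) : ℂ) := by
  have hre : ∀ t : ℝ, 0 < ((c : ℂ) + t * I).re := fun t => by simpa using hc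
  have h := mellinInv_mellin_eq c (fun y : ℝ => ((max (1 - y) 0 : ℝ) : ℂ)) hy
    (hasMellin_max_one_sub (by simpa using hc)).1 ?_ ?_
  · rw [← h, mellinInv]
    simp_rw [(hasMellin_max_one_sub (hre _)).2, smul_eq_mul]
    rw [Complex.real_smul]
    push_cast
    rfl
  · rw [VerticalIntegrable]
    simp_rw [(hasMellin_max_one_sub (hre _)).2]
    exact integrable_inv_mul_add_one hc
  · fun_prop

theorem sum_div_mul_sub_eq_integral {G : ℂ → ℂ} {b : ℕ → ℝ}
    (hb : ∀ s : ℂ, 1 < s.re → HasSum (fun m : ℕ => (b m : ℂ) * (m : ℂ) ^ (-s)) ((s - 1) / G s))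
    {N : ℕ} (hN : 0 < N) :
    ((∑ m ∈ Finset.Icc 1 N, b m / m * (N - m) : ℝ) : ℂ) =
      1 / (2 * Real.pi) * ∫ t : ℝ, (N : ℂ) ^ (((3 / 2 : ℝ) : ℂ) + t * I) /
        ((((3 / 2 : ℝ) : ℂ) + t * I) * G (((3 / 2 : ℝ) : ℂ) + t * I)) := by
  set w : ℝ → ℂ := fun t => ((1 / 2 : ℝ) : ℂ) + t * I with hw
  have hwre : ∀ t, (w t).re = 1 / 2 := fun t => by simp [hw]
  have hw1 : ∀ t : ℝ, ((3 / 2 : ℝ) : ℂ) + t * I = w t + 1 := fun t => by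
    simp only [hw]; push_cast; ring
  have hw0 : ∀ t, w t ≠ 0 := fun t h => by
    have := hwre t
    rw [h] at this
    norm_num at this
  have hNC : (N : ℂ) ≠ 0 := by exact_mod_cast hN.ne'
  have hNR : (0 : ℝ) < N := by exact_mod_cast hN
  set k : ℝ → ℂ := fun t => 1 / (w t * (w t + 1)) with hk
  have hki : MeasureTheory.Integrable k := integrable_inv_mul_add_one (by norm_num)
  set F : ℕ → ℝ → ℂ := fun m t =>
    (N : ℂ) ^ (w t + 1) * ((b m : ℂ) * (m : ℂ) ^ (-(w t + 1)) * k t) with hF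
  have hnorm : ∀ m : ℕ, ∀ t, ‖F m t‖ =
      (N : ℝ) ^ (3 / 2 : ℝ) * ‖(b m : ℂ) * (m : ℂ) ^ (-((3 / 2 : ℝ) : ℂ))‖ * ‖k t‖ := by
    intro m t
    simp only [hF, norm_mul]
    rw [Complex.norm_natCast_cpow_of_pos hN]
    have h1 : ‖(m : ℂ) ^ (-(w t + 1))‖ = ‖(m : ℂ) ^ (-((3 / 2 : ℝ) : ℂ))‖ := by
      rcases Nat.eq_zero_or_pos m with rfl | hm
      · rw [Nat.cast_zero, zero_cpow, zero_cpow]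
        · rw [Ne, neg_eq_zero, ofReal_eq_zero]; norm_num
        · rw [← hw1]
          intro h
          have := congrArg Complex.re h
          simp at this
      · rw [Complex.norm_natCast_cpow_of_pos hm, Complex.norm_natCast_cpow_of_pos hm]
        congr 1
        simp only [neg_re, add_re, hwre, one_re, ofReal_re]
        norm_num
    rw [h1]
    have h2 : (w t + 1).re = 3 / 2 := by rw [add_re, hwre, one_re]; norm_num
    rw [h2]
    ring
  have hcont : ∀ m, Continuous (F m) := by
    intro m
    have hwc : Continuous w := by fun_prop
    have hkc : Continuous k := continuous_inv_mul_add_one (by norm_num)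
    refine Continuous.mul ?_ (Continuous.mul (continuous_const.mul ?_) hkc)
    · exact Continuous.const_cpow (by fun_prop) (Or.inl hNC)
    · rcases Nat.eq_zero_or_pos m with rfl | hm
      · have : (fun t => ((0 : ℕ) : ℂ) ^ (-(w t + 1))) = fun _ => 0 := by
          funext t
          rw [Nat.cast_zero, zero_cpow]
          rw [← hw1]
          intro h
          have := congrArg Complex.re h
          simp at this
        rw [this]
        exact continuous_const
      · exact Continuous.const_cpow (by fun_prop) (Or.inl (by exact_mod_cast hm.ne'))
  have hFi : ∀ m, MeasureTheory.Integrable (F m) := fun m =>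
    ((hki.norm.const_mul _).congr (Eventually.of_forall fun t => (hnorm m t).symm)).mono'
      (hcont m).aestronglyMeasurable (Eventually.of_forall fun t => le_rfl)
  have hsumm : Summable fun m => ∫ t, ‖F m t‖ := by
    simp_rw [hnorm, MeasureTheory.integral_const_mul]
    exact (((hb ((3 / 2 : ℝ) : ℂ) (by norm_num)).summable.norm).mul_left _).mul_right _
  have hmain := MeasureTheory.hasSum_integral_of_summable_integral_norm hFi hsumm
  have hright : ∫ t, ∑' m, F m t = ∫ t : ℝ, (N : ℂ) ^ (((3 / 2 : ℝ) : ℂ) + t * I) /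
        ((((3 / 2 : ℝ) : ℂ) + t * I) * G (((3 / 2 : ℝ) : ℂ) + t * I)) := by
    congr 1
    funext t
    have h1 := hb (w t + 1) (by rw [add_re, hwre, one_re]; norm_num)
    have h2 := ((h1.mul_right (k t)).mul_left ((N : ℂ) ^ (w t + 1))).tsum_eq
    rw [hw1]
    refine h2.trans ?_
    simp only [hk]
    have := hw0 t
    rw [add_sub_cancel_right]
    field_simp
  rw [hright] at hmain
  have hterm : ∀ m, 1 / (2 * Real.pi) * ∫ t, F m t =
      ((if m ∈ Finset.Icc 1 N then b m / m * (N - m) else 0 : ℝ) : ℂ) := by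
    intro m
    rcases Nat.eq_zero_or_pos m with rfl | hm
    · have : F 0 = fun _ => 0 := by
        funext t
        simp only [hF]
        rw [Nat.cast_zero, zero_cpow]
        · simp
        rw [← hw1]
        intro h
        have := congrArg Complex.re h
        simp at this
      simp [this]
    · have hmC : (m : ℂ) ≠ 0 := by exact_mod_cast hm.ne'
      have hmR : (0 : ℝ) < m := by exact_mod_cast hm
      have h1 := integral_cpow_div_mul_add_one (c := 1 / 2) (y := m / N) (by norm_num)
        (by positivity)
      have h2 : ∀ t, F m t = (b m / m * N : ℂ) *
          (((m / N : ℝ) : ℂ) ^ (-(w t)) * k t) := by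
        intro t
        simp only [hF]
        have h3 : ((m / N : ℝ) : ℂ) ^ (-(w t)) = (m : ℂ) ^ (-(w t)) * (N : ℂ) ^ (w t) := by
          rw [ofReal_div, div_eq_mul_inv, ← ofReal_inv,
            Complex.mul_cpow_ofReal_nonneg hmR.le (by positivity), ofReal_inv,
            Complex.inv_cpow, ofReal_natCast, ofReal_natCast, Complex.cpow_neg (N : ℂ), inv_inv]
          · rw [ofReal_natCast, Complex.natCast_arg]; exact Real.pi_pos.ne
        rw [h3, neg_add, Complex.cpow_add _ _ hmC, Complex.cpow_add _ _ hNC, cpow_one,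
          cpow_neg_one]
        field_simp
      simp_rw [h2]
      rw [MeasureTheory.integral_const_mul, mul_left_comm, h1]
      by_cases hmN : m ≤ N
      · rw [if_pos (by simp; omega), max_eq_left]
        · push_cast
          field_simp
        · rw [sub_nonneg, div_le_one hNR]
          exact_mod_cast hmN
      · rw [if_neg (by simp; omega), max_eq_right]
        · simp
        · rw [sub_nonpos, one_le_div hNR]
          exact_mod_cast (not_le.mp hmN).le
  have h3 := hmain.mul_left (1 / (2 * Real.pi) : ℂ)
  simp_rw [hterm] at h3
  have h4 : HasSum (fun m : ℕ => ((if m ∈ Finset.Icc 1 N then b m / m * (N - m) else 0 : ℝ) : ℂ))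
      ((∑ m ∈ Finset.Icc 1 N, b m / m * (N - m) : ℝ) : ℂ) := by
    rw [Complex.hasSum_ofReal]
    have := hasSum_sum_of_ne_finset_zero (s := Finset.Icc 1 N)
      (f := fun m : ℕ => if m ∈ Finset.Icc 1 N then b m / m * (N - m) else 0)
      (L := SummationFilter.unconditional ℕ) (fun m hm => if_neg hm)
    rwa [Finset.sum_congr rfl (fun m hm => if_pos hm)] at this
  exact h4.unique h3

/-- Moving the line of integration of a holomorphic function with enough decay. -/
theorem integral_vertical_line_eq {f : ℂ → ℂ} {a c C r : ℝ} (hac : a ≤ c) (hr : 1 < r)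
    (hf : ∀ z : ℂ, a ≤ z.re → z.re ≤ c → DifferentiableAt ℂ f z)
    (hbd : ∀ z : ℂ, a ≤ z.re → z.re ≤ c → ‖f z‖ ≤ C * (1 + |z.im|) ^ (-r)) :
    ∫ t : ℝ, f ((a : ℂ) + t * I) = ∫ t : ℝ, f ((c : ℂ) + t * I) := by
  have hC : 0 ≤ C := by
    have := (norm_nonneg _).trans (hbd a (by simp) (by simpa using hac))
    simpa using this
  have hintg : ∀ x : ℝ, a ≤ x → x ≤ c →
      MeasureTheory.Integrable fun t : ℝ => f ((x : ℂ) + t * I) := by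
    intro x hx1 hx2
    refine integrable_of_norm_le_mul_rpow ?_ (C := C) hr fun t => ?_
    · rw [continuous_iff_continuousAt]
      intro t
      exact (hf _ (by simpa using hx1) (by simpa using hx2)).continuousAt.comp
        (f := fun t : ℝ => (x : ℂ) + t * I) (by fun_prop)
    · simpa using hbd ((x : ℂ) + t * I) (by simpa using hx1) (by simpa using hx2)
  have h0 : ∀ T : ℝ, (∫ x : ℝ in a..c, f (x + (-T : ℝ) * I)) - (∫ x : ℝ in a..c, f (x + T * I)) +
      I • (∫ y : ℝ in (-T)..T, f (c + y * I)) - I • (∫ y : ℝ in (-T)..T, f (a + y * I)) = 0 := by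
    intro T
    have := integral_boundary_rect_eq_zero_of_differentiableOn f (a + (-T : ℝ) * I) (c + T * I) ?_
    · simpa using this
    · intro z hz
      have h1 : z.re ∈ Set.uIcc a c := by simpa using hz.1
      rw [Set.uIcc_of_le hac] at h1
      exact (hf z h1.1 h1.2).differentiableWithinAt
  have hdecay : Tendsto (fun T : ℝ => C * (1 + |T|) ^ (-r) * (c - a)) atTop (𝓝 0) := by
    have h1 : Tendsto (fun T : ℝ => (1 + |T|) ^ (-r)) atTop (𝓝 0) :=
      (tendsto_rpow_neg_atTop (by linarith)).comp
        (tendsto_atTop_add_const_left _ _ tendsto_abs_atTop_atTop)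
    simpa using (h1.const_mul C).mul_const (c - a)
  have hhor : ∀ T : ℝ, ‖∫ x : ℝ in a..c, f (x + T * I)‖ ≤ C * (1 + |T|) ^ (-r) * (c - a) := by
    intro T
    have := intervalIntegral.norm_integral_le_of_norm_le_const (a := a) (b := c)
      (f := fun x : ℝ => f (x + T * I)) (C := C * (1 + |T|) ^ (-r)) ?_
    · rwa [abs_of_nonneg (sub_nonneg.mpr hac)] at this
    · intro x hx
      rw [Set.uIoc_of_le hac] at hx
      simpa using hbd ((x : ℂ) + T * I) (by simpa using hx.1.le) (by simpa using hx.2)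
  have ht1 : Tendsto (fun T : ℝ => ∫ x : ℝ in a..c, f (x + T * I)) atTop (𝓝 0) :=
    squeeze_zero_norm hhor hdecay
  have ht2 : Tendsto (fun T : ℝ => ∫ x : ℝ in a..c, f (x + (-T : ℝ) * I)) atTop (𝓝 0) :=
    squeeze_zero_norm (fun T => by simpa using hhor (-T)) hdecay
  have ht3 : ∀ x : ℝ, a ≤ x → x ≤ c → Tendsto (fun T : ℝ => ∫ y : ℝ in (-T)..T, f (x + y * I))
      atTop (𝓝 (∫ t : ℝ, f ((x : ℂ) + t * I))) := fun x h1 h2 =>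
    MeasureTheory.intervalIntegral_tendsto_integral (hintg x h1 h2) tendsto_neg_atTop_atBot tendsto_id
  have hlim := (((ht2.sub ht1).add ((ht3 c hac le_rfl).const_smul I)).sub
    ((ht3 a le_rfl hac).const_smul I))
  have h1 := tendsto_nhds_unique hlim (by simp_rw [h0]; exact tendsto_const_nhds)
  have h2 : I * ((∫ t : ℝ, f ((c : ℂ) + t * I)) - ∫ t : ℝ, f ((a : ℂ) + t * I)) = 0 := by
    rw [← h1]; simp [mul_sub]
  have h3 := (mul_eq_zero.mp h2).resolve_left I_ne_zero
  exact (sub_eq_zero.mp h3).symm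

theorem norm_add_one_cpow_sub_cpow_le {N : ℕ} (hN : 0 < N) {w : ℂ} (hw1 : w.re ≤ 1) :
    ‖((N + 1 : ℕ) : ℂ) ^ w - (N : ℂ) ^ w‖ ≤ ‖w‖ * (N : ℝ) ^ (w.re - 1) := by
  have hNR : (0 : ℝ) < N := by exact_mod_cast hN
  by_cases hw : w = 0
  · simp [hw]
  have h := norm_image_sub_le_of_norm_deriv_le_segment_01' (E := ℂ)
    (f := fun t : ℝ => ((N + t : ℝ) : ℂ) ^ w) (C := ‖w‖ * (N : ℝ) ^ (w.re - 1))
    (f' := fun t : ℝ => w * ((N + t : ℝ) : ℂ) ^ (w - 1)) ?_ ?_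
  · simpa using h
  · intro t ht
    have hp : (0 : ℝ) < N + t := by linarith [ht.1]
    have h2 := hasDerivAt_ofReal_cpow_const (x := (N + t : ℝ)) hp.ne' hw
    have h4 := h2.scomp t ((hasDerivAt_id t).const_add (N : ℝ))
    simp only [one_smul] at h4
    exact h4.hasDerivWithinAt
  · intro t ht
    have hp : (0 : ℝ) < N + t := by linarith [ht.1]
    rw [norm_mul, Complex.norm_cpow_eq_rpow_re_of_pos hp]
    simp only [sub_re, one_re]
    gcongr ?_ * ?_
    exact Real.rpow_le_rpow_of_nonpos hNR (by linarith [ht.1]) (by linarith)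

theorem norm_add_one_cpow_sub_cpow_le_rpow {N : ℕ} (hN : 0 < N) {w : ℂ} {θ : ℝ} (hθ0 : 0 ≤ θ)
    (hθ1 : θ ≤ 1) (hw0 : 0 ≤ w.re) (hw1 : w.re ≤ 1) :
    ‖((N + 1 : ℕ) : ℂ) ^ w - (N : ℂ) ^ w‖ ≤ 4 * ‖w‖ ^ θ * (N : ℝ) ^ (w.re - θ) := by
  have hNR : (0 : ℝ) < N := by exact_mod_cast hN
  have hN1 : (1 : ℝ) ≤ N := by exact_mod_cast hN
  set D := ‖((N + 1 : ℕ) : ℂ) ^ w - (N : ℂ) ^ w‖ with hD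
  have h1 : D ≤ ‖w‖ * (N : ℝ) ^ (w.re - 1) := norm_add_one_cpow_sub_cpow_le hN hw1
  have h2 : D ≤ 4 * (N : ℝ) ^ w.re := by
    refine (norm_sub_le _ _).trans ?_
    rw [Complex.norm_natCast_cpow_of_pos hN, Complex.norm_natCast_cpow_of_pos (by omega)]
    have h3 : ((N + 1 : ℕ) : ℝ) ^ w.re ≤ 2 * (N : ℝ) ^ w.re := by
      calc ((N + 1 : ℕ) : ℝ) ^ w.re ≤ (2 * N : ℝ) ^ w.re := by
            gcongr
            push_cast
            linarith
        _ = 2 ^ w.re * (N : ℝ) ^ w.re := Real.mul_rpow (by norm_num) hNR.le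
        _ ≤ 2 ^ (1 : ℝ) * (N : ℝ) ^ w.re := by
            gcongr
            norm_num
        _ = _ := by rw [Real.rpow_one]
    have h4 : 0 ≤ (N : ℝ) ^ w.re := by positivity
    linarith
  have hD0 : 0 ≤ D := norm_nonneg _
  calc D = D ^ θ * D ^ (1 - θ) := by
        rw [← Real.rpow_add_of_nonneg hD0 hθ0 (by linarith)]; simp
    _ ≤ (‖w‖ * (N : ℝ) ^ (w.re - 1)) ^ θ * (4 * (N : ℝ) ^ w.re) ^ (1 - θ) := by
        gcongr
    _ = (4 : ℝ) ^ (1 - θ) * ‖w‖ ^ θ * (N : ℝ) ^ (w.re - θ) := by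
        rw [Real.mul_rpow (norm_nonneg _) (by positivity), Real.mul_rpow (by norm_num)
          (by positivity), ← Real.rpow_mul hNR.le, ← Real.rpow_mul hNR.le]
        have : (N : ℝ) ^ (w.re - θ) =
            (N : ℝ) ^ ((w.re - 1) * θ) * (N : ℝ) ^ (w.re * (1 - θ)) := by
          rw [← Real.rpow_add hNR]; ring_nf
        rw [this]; ring
    _ ≤ 4 ^ (1 : ℝ) * ‖w‖ ^ θ * (N : ℝ) ^ (w.re - θ) := by
        gcongr
        · norm_num
        · linarith
    _ = _ := by rw [Real.rpow_one]

theorem exists_norm_one_div_mul_le {G : ℂ → ℂ} (hG : Differentiable ℂ G)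
    (hG0 : ∀ s : ℂ, 1 / 2 < s.re → G s ≠ 0) {σ ε C : ℝ} (hσ : 1 / 2 < σ)
    (hbd : ∀ s : ℂ, σ ≤ s.re → s.re ≤ 2 → ‖(s - 1) / G s‖ ≤ C * (1 + |s.im|) ^ ε) :
    ∃ C' : ℝ, 0 ≤ C' ∧ ∀ s : ℂ, σ ≤ s.re → s.re ≤ 2 →
      ‖1 / (s * G s)‖ ≤ C' * (1 + |s.im|) ^ (ε - 2) := by
  have hcomp : IsCompact (Set.Icc σ 2 ×ℂ Set.Icc (-1 : ℝ) 1) :=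
    isCompact_Icc.reProdIm isCompact_Icc
  have hs0 : ∀ s : ℂ, 1 / 2 < s.re → s ≠ 0 := by
    rintro s hs rfl
    norm_num at hs
  obtain ⟨C₂, hC₂⟩ := hcomp.exists_bound_of_continuousOn
    (f := fun s => 1 / (s * G s) / ((1 + |s.im|) ^ (ε - 2) : ℝ)) (by
      refine ContinuousOn.div ?_ ?_ fun s hs => ?_
      · refine ContinuousOn.div (by fun_prop)
          (continuousOn_id.mul hG.continuous.continuousOn) fun s hs => ?_
        have : σ ≤ s.re := hs.1.1
        exact mul_ne_zero (hs0 s (by linarith)) (hG0 s (by linarith))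
      · refine Continuous.continuousOn (continuous_ofReal.comp ?_)
        exact Continuous.rpow_const (by fun_prop) fun s => Or.inl (by positivity)
      · rw [Ne, ofReal_eq_zero]
        positivity)
  refine ⟨max 0 (max (4 * C) C₂), le_max_left _ _, fun s hs1 hs2 => ?_⟩
  have hpos : 0 < (1 + |s.im|) ^ (ε - 2) := by positivity
  rcases le_total |s.im| 1 with h | h
  · have h1 := hC₂ s ⟨⟨hs1, hs2⟩, abs_le.mp h⟩
    rw [norm_div, div_le_iff₀ (norm_pos_iff.mpr (by rw [Ne, ofReal_eq_zero]; positivity)),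
      Complex.norm_real, Real.norm_of_nonneg hpos.le] at h1
    refine h1.trans ?_
    gcongr
    exact (le_max_right _ _).trans (le_max_right _ _)
  · have h2 : s - 1 ≠ 0 := by
      intro h0
      have := congrArg Complex.im h0
      simp at this
      rw [this] at h
      norm_num at h
    have h3 : s ≠ 0 := hs0 s (by linarith)
    have h4 : 1 / (s * G s) = (s - 1) / G s * (s⁻¹ * (s - 1)⁻¹) := by
      have := hG0 s (by linarith)
      field_simp
    have h5 : |s.im| ≤ ‖s‖ := Complex.abs_im_le_norm s
    have h6 : |s.im| ≤ ‖s - 1‖ := by simpa using Complex.abs_im_le_norm (s - 1)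
    have h7 : ‖s‖⁻¹ ≤ 2 * (1 + |s.im|)⁻¹ := by
      rw [← div_eq_mul_inv, inv_eq_one_div, div_le_div_iff₀ (by linarith) (by positivity)]
      linarith
    have h8 : ‖s - 1‖⁻¹ ≤ 2 * (1 + |s.im|)⁻¹ := by
      rw [← div_eq_mul_inv, inv_eq_one_div, div_le_div_iff₀ (by linarith) (by positivity)]
      linarith
    have h9 := hbd s hs1 hs2
    rw [h4, norm_mul, norm_mul, norm_inv, norm_inv]
    calc _ ≤ C * (1 + |s.im|) ^ ε * (2 * (1 + |s.im|)⁻¹ * (2 * (1 + |s.im|)⁻¹)) := by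
          gcongr
          exact (norm_nonneg _).trans h9
      _ = 4 * C * (1 + |s.im|) ^ (ε - 2) := by
          rw [Real.rpow_sub (by positivity), Real.rpow_two]
          field_simp
          ring
      _ ≤ _ := by
          gcongr
          exact (le_max_left _ _).trans (le_max_right _ _)

theorem isBigO_sum_div_of_inv_bound {G : ℂ → ℂ} (hG : Differentiable ℂ G)
    (hG0 : ∀ s : ℂ, 1 / 2 < s.re → G s ≠ 0) {b : ℕ → ℝ}
    (hb : ∀ s : ℂ, 1 < s.re → HasSum (fun m : ℕ => (b m : ℂ) * (m : ℂ) ^ (-s)) ((s - 1) / G s))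
    (hbd : ∀ η ε : ℝ, 0 < η → 0 < ε → ∃ C : ℝ, ∀ s : ℂ, 1 / 2 + η ≤ s.re → s.re ≤ 2 →
      ‖(s - 1) / G s‖ ≤ C * (1 + |s.im|) ^ ε) {ε : ℝ} (hε : 0 < ε) :
    (fun x : ℝ => ∑ m ∈ Finset.Icc 1 ⌊x⌋₊, b m / m)
        =O[atTop] fun x : ℝ => x ^ (-(1:ℝ)/2 + ε) := by
  wlog hε1 : ε ≤ 1 / 2 generalizing ε
  · refine (this (ε := 1 / 2) (by norm_num) le_rfl).trans (Asymptotics.IsBigO.of_bound 1 ?_)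
    filter_upwards [eventually_ge_atTop 1] with x hx
    rw [one_mul, Real.norm_of_nonneg (by positivity), Real.norm_of_nonneg (by positivity)]
    exact Real.rpow_le_rpow_of_exponent_le hx (by linarith)
  set δ := ε / 4 with hδ
  have hδ0 : 0 < δ := by positivity
  set σ := 1 / 2 + δ with hσ
  obtain ⟨C₀, hC₀⟩ := hbd δ δ hδ0 hδ0
  obtain ⟨C, hC, hCb⟩ := exists_norm_one_div_mul_le hG hG0 (σ := σ) (by linarith) hC₀
  have hs0 : ∀ s : ℂ, 1 / 2 < s.re → s ≠ 0 := by
    rintro s hs rfl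
    norm_num at hs
  set f : ℕ → ℂ → ℂ := fun N w => (N : ℂ) ^ w / (w * G w) with hf
  have hfd : ∀ N : ℕ, 0 < N → ∀ z : ℂ, 1 / 2 < z.re → DifferentiableAt ℂ (f N) z := by
    intro N hN z hz
    refine DifferentiableAt.div ?_ (differentiableAt_id.mul (hG z))
      (mul_ne_zero (hs0 z hz) (hG0 z hz))
    exact differentiableAt_id.const_cpow (Or.inl (by exact_mod_cast hN.ne'))
  have hfb : ∀ N : ℕ, 0 < N → ∀ z : ℂ, σ ≤ z.re → z.re ≤ 3 / 2 →
      ‖f N z‖ ≤ (N : ℝ) ^ (3 / 2 : ℝ) * C * (1 + |z.im|) ^ (-(2 - δ)) := by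
    intro N hN z h1 h2
    have hN1 : (1 : ℝ) ≤ N := by exact_mod_cast hN
    have h3 := hCb z h1 (by linarith)
    simp only [hf]
    rw [div_eq_mul_one_div, norm_mul, Complex.norm_natCast_cpow_of_pos hN, mul_assoc,
      show -(2 - δ) = δ - 2 by ring]
    gcongr
  have hintg : ∀ N : ℕ, 0 < N →
      MeasureTheory.Integrable fun t : ℝ => f N ((σ : ℂ) + t * I) := by
    intro N hN
    refine integrable_of_norm_le_mul_rpow ?_ (C := (N : ℝ) ^ (3 / 2 : ℝ) * C) (r := 2 - δ)
      (by linarith) fun t => ?_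
    · rw [continuous_iff_continuousAt]
      intro t
      exact (hfd N hN _ (by simp; linarith)).continuousAt.comp
        (f := fun t : ℝ => (σ : ℂ) + t * I) (by fun_prop)
    · simpa using hfb N hN ((σ : ℂ) + t * I) (by simp) (by simp; linarith)
  set R : ℕ → ℝ := fun N => ∑ m ∈ Finset.Icc 1 N, b m / m * (N - m) with hR
  have hRf : ∀ N : ℕ, 0 < N →
      (R N : ℂ) = 1 / (2 * Real.pi) * ∫ t : ℝ, f N ((σ : ℂ) + t * I) := by
    intro N hN
    simp only [hR]
    rw [sum_div_mul_sub_eq_integral hb hN]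
    congr 1
    refine (integral_vertical_line_eq (f := f N) (a := σ) (c := 3 / 2) (r := 2 - δ) (by linarith)
      (by linarith) (fun z h1 h2 => hfd N hN z (by linarith)) (hfb N hN)).symm
  have hdiff : ∀ N : ℕ, R (N + 1) - R N = ∑ m ∈ Finset.Icc 1 N, b m / m := by
    intro N
    simp only [hR]
    rw [Finset.sum_Icc_succ_top (by omega)]
    rw [sub_self, mul_zero, add_zero, ← Finset.sum_sub_distrib]
    refine Finset.sum_congr rfl fun m _ => ?_
    push_cast
    ring
  set θ := 1 - 2 * δ with hθ
  set J := ∫ t : ℝ, (1 + |t|) ^ (-(1 + δ)) with hJ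
  have hJi : MeasureTheory.Integrable fun t : ℝ => (1 + |t|) ^ (-(1 + δ)) :=
    integrable_one_add_norm (E := ℝ) (by simpa using hδ0)
  have hmain : ∀ N : ℕ, 0 < N →
      |∑ m ∈ Finset.Icc 1 N, b m / m| ≤ 8 * C * J * (N : ℝ) ^ (-(1 : ℝ) / 2 + 3 * δ) := by
    intro N hN
    have h1 : ((∑ m ∈ Finset.Icc 1 N, b m / m : ℝ) : ℂ) = 1 / (2 * Real.pi) *
        ∫ t : ℝ, (f (N + 1) ((σ : ℂ) + t * I) - f N ((σ : ℂ) + t * I)) := by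
      rw [MeasureTheory.integral_sub (hintg _ (by omega)) (hintg _ hN), mul_sub,
        ← hRf _ (by omega), ← hRf _ hN, ← hdiff]
      push_cast
      rfl
    have h2 : ∀ t : ℝ, ‖f (N + 1) ((σ : ℂ) + t * I) - f N ((σ : ℂ) + t * I)‖ ≤
        8 * C * (N : ℝ) ^ (-(1 : ℝ) / 2 + 3 * δ) * (1 + |t|) ^ (-(1 + δ)) := by
      intro t
      set w : ℂ := (σ : ℂ) + t * I with hw
      have hwre : w.re = σ := by simp [hw]
      have hwim : w.im = t := by simp [hw]
      have h3 := hCb w hwre.ge (by linarith)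
      have h4 := norm_add_one_cpow_sub_cpow_le_rpow hN (w := w) (θ := θ) (by linarith)
        (by linarith) (by linarith) (by linarith)
      have h5 : ‖w‖ ≤ 2 * (1 + |t|) := by
        refine (Complex.norm_le_abs_re_add_abs_im w).trans ?_
        rw [hwre, hwim, abs_of_nonneg (by linarith)]
        linarith [abs_nonneg t]
      have h6 : ‖w‖ ^ θ ≤ 2 * (1 + |t|) ^ θ := by
        calc ‖w‖ ^ θ ≤ (2 * (1 + |t|)) ^ θ := by
              gcongr
              linarith
          _ = 2 ^ θ * (1 + |t|) ^ θ := Real.mul_rpow (by norm_num) (by positivity)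
          _ ≤ 2 ^ (1 : ℝ) * (1 + |t|) ^ θ := by
              gcongr
              · norm_num
              · linarith
          _ = _ := by rw [Real.rpow_one]
      have h7 : f (N + 1) w - f N w =
          (((N + 1 : ℕ) : ℂ) ^ w - (N : ℂ) ^ w) * (1 / (w * G w)) := by
        simp only [hf]; ring
      rw [h7, norm_mul]
      rw [hwim] at h3
      rw [hwre] at h4
      calc _ ≤ (4 * (2 * (1 + |t|) ^ θ) * (N : ℝ) ^ (σ - θ)) * (C * (1 + |t|) ^ (δ - 2)) := by
            gcongr
            refine h4.trans ?_
            gcongr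
        _ = 8 * C * (N : ℝ) ^ (σ - θ) * ((1 + |t|) ^ θ * (1 + |t|) ^ (δ - 2)) := by ring
        _ = _ := by
            rw [← Real.rpow_add (by positivity)]
            congr 2
            · congr 1
              rw [hσ, hθ]
              ring
            · rw [hθ]
              ring
    have h3 := MeasureTheory.norm_integral_le_of_norm_le
      (hJi.const_mul (8 * C * (N : ℝ) ^ (-(1 : ℝ) / 2 + 3 * δ))) (Eventually.of_forall h2)
    rw [MeasureTheory.integral_const_mul] at h3
    rw [← Real.norm_eq_abs, ← Complex.norm_real, h1, norm_mul]
    have h4 : ‖(1 / (2 * Real.pi) : ℂ)‖ ≤ 1 := by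
      rw [norm_div, norm_one, norm_mul, Complex.norm_real, Real.norm_of_nonneg Real.pi_pos.le,
        Complex.norm_ofNat, div_le_one (by positivity)]
      have := Real.pi_gt_three
      linarith
    calc _ ≤ 1 * _ := mul_le_mul h4 h3 (norm_nonneg _) zero_le_one
      _ = _ := by rw [← hJ]; ring
  have hJ0 : 0 ≤ J := MeasureTheory.integral_nonneg fun t => by positivity
  refine Asymptotics.IsBigO.of_bound (8 * C * J * 2) ?_
  filter_upwards [eventually_ge_atTop 1] with x hx
  have hN : 0 < ⌊x⌋₊ := Nat.floor_pos.mpr hx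
  have hNR : (0 : ℝ) < ⌊x⌋₊ := by exact_mod_cast hN
  have hx2 : x / 2 ≤ ⌊x⌋₊ := by
    have h1 := Nat.lt_floor_add_one x
    have h2 : (1 : ℝ) ≤ ⌊x⌋₊ := by exact_mod_cast hN
    linarith
  rw [Real.norm_eq_abs, Real.norm_of_nonneg (by positivity)]
  refine (hmain _ hN).trans ?_
  have h1 : (⌊x⌋₊ : ℝ) ^ (-(1 : ℝ) / 2 + 3 * δ) ≤ 2 * x ^ (-(1 : ℝ) / 2 + ε) := by
    calc (⌊x⌋₊ : ℝ) ^ (-(1 : ℝ) / 2 + 3 * δ) ≤ (x / 2) ^ (-(1 : ℝ) / 2 + 3 * δ) :=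
          Real.rpow_le_rpow_of_nonpos (by linarith) hx2 (by linarith)
      _ = x ^ (-(1 : ℝ) / 2 + 3 * δ) * 2 ^ (-(-(1 : ℝ) / 2 + 3 * δ)) := by
          rw [Real.div_rpow (by linarith) (by norm_num), Real.rpow_neg (by norm_num)]
          rfl
      _ ≤ x ^ (-(1 : ℝ) / 2 + ε) * 2 ^ (1 : ℝ) := by
          gcongr
          · linarith
          · norm_num
          · linarith
      _ = _ := by rw [Real.rpow_one]; ring
  calc _ ≤ 8 * C * J * (2 * x ^ (-(1 : ℝ) / 2 + ε)) := by gcongr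
    _ = _ := by ring

/-- The entire function extending `(s - 1) * Z s`. -/
theorem exists_differentiable_eq_sub_one_mul {Z : ℂ → ℂ} {A : ℂ}
    (hZ : ∀ s : ℂ, s ≠ 1 → DifferentiableAt ℂ Z s)
    (hA : Tendsto (fun s : ℂ => (s - 1) * Z s) (𝓝[≠] (1 : ℂ)) (𝓝 A)) :
    ∃ G : ℂ → ℂ, Differentiable ℂ G ∧ G 1 = A ∧ ∀ s, s ≠ 1 → G s = (s - 1) * Z s := by
  classical
  refine ⟨Function.update (fun s => (s - 1) * Z s) 1 A, ?_, Function.update_self _ _ _,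
    fun s hs => Function.update_of_ne hs _ _⟩
  rw [← differentiableOn_univ,
    ← differentiableOn_compl_singleton_and_continuousAt_iff (c := (1 : ℂ)) univ_mem]
  refine ⟨?_, continuousAt_update_same.mpr hA⟩
  intro s hs
  have hs1 : s ≠ 1 := hs.2
  have h1 : DifferentiableAt ℂ (fun s => (s - 1) * Z s) s :=
    ((differentiableAt_id).sub_const 1).mul (hZ s hs1)
  refine (h1.congr_of_eventuallyEq ?_).differentiableWithinAt
  filter_upwards [isOpen_ne.mem_nhds hs1] with z hz
  exact Function.update_of_ne hz _ _

theorem norm_natCast_cpow_neg_le {m : ℕ} {s : ℂ} {r : ℝ} (hr : 0 < r) (h : r ≤ s.re) :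
    ‖(m : ℂ) ^ (-s)‖ ≤ ‖(m : ℂ) ^ (-(r : ℂ))‖ := by
  rcases Nat.eq_zero_or_pos m with rfl | hm
  · have h1 : -s ≠ 0 := by
      rw [Ne, neg_eq_zero]
      rintro rfl
      rw [zero_re] at h
      linarith
    rw [Nat.cast_zero, zero_cpow h1]
    simp
  · rw [Complex.norm_natCast_cpow_of_pos hm, Complex.norm_natCast_cpow_of_pos hm]
    have : (1 : ℝ) ≤ m := by exact_mod_cast hm
    apply Real.rpow_le_rpow_of_exponent_le this
    simpa using h

/-- A Dirichlet series converging for `1 < re s` is bounded on `1 + δ ≤ re s`. -/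
theorem exists_norm_le_of_hasSum_cpow {ι : Type*} {N : ι → ℕ} {a : ι → ℂ} {F : ℂ → ℂ}
    (hF : ∀ s : ℂ, 1 < s.re → HasSum (fun i => a i * (N i : ℂ) ^ (-s)) (F s)) {δ : ℝ}
    (hδ : 0 < δ) : ∃ B : ℝ, ∀ s : ℂ, 1 + δ ≤ s.re → ‖F s‖ ≤ B := by
  have h1 := (hF ((1 + δ : ℝ) : ℂ) (by rw [ofReal_re]; linarith)).summable.norm
  refine ⟨∑' i, ‖a i * (N i : ℂ) ^ (-((1 + δ : ℝ) : ℂ))‖, fun s hs => ?_⟩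
  rw [← (hF s (by linarith)).tsum_eq]
  refine tsum_of_norm_bounded h1.hasSum fun i => ?_
  rw [norm_mul, norm_mul]
  gcongr
  exact norm_natCast_cpow_neg_le (by linarith) hs

theorem exists_sub_one_mul_norm_le {b : ℕ → ℝ} {F : ℂ → ℂ}
    (hb : ∀ s : ℂ, 1 < s.re → HasSum (fun m : ℕ => (b m : ℂ) * (m : ℂ) ^ (-s)) (F s))
    (hsum : Tendsto (fun x : ℝ => ∑ m ∈ Finset.Icc 1 ⌊x⌋₊, b m / m) atTop (nhds 0))
    {ε : ℝ} (hε : 0 < ε) :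
    ∃ K : ℝ, 0 ≤ K ∧ ∀ s : ℂ, 1 < s.re →
      (s.re - 1) * ‖F s‖ ≤ ‖s - 1‖ * (ε + K * (s.re - 1)) := by
  set M : ℝ → ℝ := fun x => ∑ m ∈ Finset.Icc 1 ⌊x⌋₊, b m / m with hM
  obtain ⟨T, hT⟩ := eventually_atTop.mp (Metric.tendsto_nhds.mp hsum ε hε)
  set K := ∑ m ∈ Finset.Icc 1 ⌊T⌋₊, |b m / m| with hK
  have hK0 : 0 ≤ K := Finset.sum_nonneg fun _ _ => abs_nonneg _
  set T' := max T 1 with hT'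
  have hMb : ∀ t : ℝ, 1 ≤ t → |M t| ≤ ε + K * T' * t⁻¹ := by
    intro t ht
    rcases le_total T t with h | h
    · have h1 := hT t h
      rw [dist_zero_right, Real.norm_eq_abs] at h1
      have : 0 ≤ K * T' * t⁻¹ := by positivity
      linarith
    · have h1 : |M t| ≤ K := by
        refine (Finset.abs_sum_le_sum_abs _ _).trans ?_
        refine Finset.sum_le_sum_of_subset_of_nonneg ?_ fun _ _ _ => abs_nonneg _
        exact Finset.Icc_subset_Icc le_rfl (Nat.floor_le_floor h)
      have h2 : 1 ≤ T' * t⁻¹ := by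
        rw [← div_eq_mul_inv, le_div_iff₀ (by linarith), one_mul]
        exact h.trans (le_max_left _ _)
      nlinarith
  refine ⟨K * T', by positivity, fun s hs => ?_⟩
  set w := s - 1 with hw
  have hwre : w.re = s.re - 1 := by simp [hw]
  have hw0 : 0 < w.re := by linarith
  set c : ℕ → ℂ := fun m => ((b m / m : ℝ) : ℂ) with hc
  have hsw : -s = -w + -1 := by rw [hw]; ring
  have hterm : (fun m : ℕ => (b m : ℂ) * (m : ℂ) ^ (-s)) = LSeries.term c w := by
    funext m
    rcases Nat.eq_zero_or_pos m with rfl | hm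
    · have h1 : -s ≠ 0 := by
        rw [Ne, neg_eq_zero]
        rintro rfl
        norm_num at hs
      rw [Nat.cast_zero, zero_cpow h1, LSeries.term_zero, mul_zero]
    · have hmC : (m : ℂ) ≠ 0 := by exact_mod_cast hm.ne'
      rw [LSeries.term_of_ne_zero hm.ne', hsw, cpow_add _ _ hmC, cpow_neg, cpow_neg_one, hc]
      push_cast
      field_simp
  have hsm := hb s hs
  rw [hterm] at hsm
  have hsumC : ∀ n : ℕ, ∑ k ∈ Finset.Icc 1 n, c k = (M n : ℂ) := by
    intro n
    simp only [hM, hc, Nat.floor_natCast]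
    push_cast
    rfl
  have hintg := LSeries_eq_mul_integral c (r := 0) le_rfl (s := w) hw0 hsm.summable (by
    simp_rw [Real.rpow_zero]
    refine Asymptotics.IsBigO.of_bound (ε + K * T') ?_
    filter_upwards [eventually_ge_atTop 1] with n hn
    rw [hsumC, Complex.norm_real, norm_one, mul_one, Real.norm_eq_abs]
    have hn' : (1 : ℝ) ≤ n := by exact_mod_cast hn
    refine (hMb n hn').trans ?_
    have : (n : ℝ)⁻¹ ≤ 1 := inv_le_one_of_one_le₀ hn'
    have h2 : 0 ≤ K * T' := by positivity
    nlinarith)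
  have hF : F s = w * ∫ t in Set.Ioi (1 : ℝ), (∑ k ∈ Finset.Icc 1 ⌊t⌋₊, c k) *
      (t : ℂ) ^ (-(w + 1)) := by
    rw [← hintg, ← hsm.tsum_eq]; rfl
  have hi : ∀ a : ℝ, 0 < a → MeasureTheory.IntegrableOn (fun t : ℝ => t ^ (-(a + 1)))
      (Set.Ioi 1) ∧ ∫ t in Set.Ioi (1 : ℝ), t ^ (-(a + 1)) = 1 / a := by
    intro a ha
    refine ⟨integrableOn_Ioi_rpow_of_lt (by linarith) one_pos, ?_⟩
    rw [integral_Ioi_rpow_of_lt (by linarith) one_pos, Real.one_rpow]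
    have : -(a + 1) + 1 = -a := by ring
    rw [this, neg_div_neg_eq]
  obtain ⟨hi1, hi1'⟩ := hi w.re hw0
  obtain ⟨hi2, hi2'⟩ := hi (w.re + 1) (by linarith)
  have hle : ‖∫ t in Set.Ioi (1 : ℝ), (∑ k ∈ Finset.Icc 1 ⌊t⌋₊, c k) * (t : ℂ) ^ (-(w + 1))‖ ≤
      ∫ t in Set.Ioi (1 : ℝ), (ε * t ^ (-(w.re + 1)) + K * T' * t ^ (-(w.re + 1 + 1))) := by
    refine MeasureTheory.norm_integral_le_of_norm_le ((hi1.const_mul ε).add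
      (hi2.const_mul (K * T'))) ?_
    filter_upwards [MeasureTheory.ae_restrict_mem measurableSet_Ioi] with t ht
    have ht1 : (1 : ℝ) < t := ht
    have ht0 : 0 < t := by linarith
    have h1 : ∑ k ∈ Finset.Icc 1 ⌊t⌋₊, c k = (M t : ℂ) := by
      rw [hsumC]; simp only [hM, Nat.floor_natCast]
    rw [h1, norm_mul, Complex.norm_real, Complex.norm_cpow_eq_rpow_re_of_pos ht0,
      Real.norm_eq_abs]
    calc _ ≤ (ε + K * T' * t⁻¹) * t ^ (-(w.re + 1)) := by
          simp only [neg_re, add_re, one_re]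
          gcongr
          exact hMb t ht1.le
      _ = _ := by
          have : t ^ (-(w.re + 1 + 1)) = t⁻¹ * t ^ (-(w.re + 1)) := by
            rw [neg_add _ (1 : ℝ), Real.rpow_add ht0, Real.rpow_neg_one]
            ring
          rw [this]; ring
  rw [MeasureTheory.integral_add (hi1.const_mul ε) (hi2.const_mul (K * T')),
    MeasureTheory.integral_const_mul, MeasureTheory.integral_const_mul, hi1', hi2'] at hle
  rw [hF, norm_mul, ← hwre]
  calc _ ≤ w.re * (‖w‖ * (ε * (1 / w.re) + K * T' * (1 / (w.re + 1)))) := by gcongr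
    _ = ‖w‖ * (ε + K * T' * (w.re * (1 / (w.re + 1)))) := by field_simp
    _ ≤ ‖w‖ * (ε + K * T' * (w.re * 1)) := by
        gcongr
        rw [div_le_one (by linarith)]
        linarith
    _ = _ := by rw [mul_one]

theorem ne_zero_of_half_lt_re {Z G : ℂ → ℂ} (hG : Differentiable ℂ G) (hG1 : G 1 ≠ 0)
    (hGZ : ∀ s, s ≠ 1 → G s = (s - 1) * Z s) {b : ℕ → ℝ}
    (hb : ∀ s : ℂ, 1 < s.re →
      HasSum (fun m : ℕ => (b m : ℂ) * (m : ℂ) ^ (-s)) (Z s)⁻¹)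
    (hsum : Tendsto (fun x : ℝ => ∑ m ∈ Finset.Icc 1 ⌊x⌋₊, b m / m) atTop (nhds 0))
    (hGRH : ∀ ρ : ℂ, Z ρ = 0 → 0 < ρ.re → ρ.re < 1 → ρ.re = 1/2) :
    ∀ s : ℂ, 1 / 2 < s.re → G s ≠ 0 := by
  have hne1 : ∀ s : ℂ, 1 < s.re → s ≠ 1 := by
    rintro s hs rfl
    norm_num at hs
  have hGinv : ∀ s : ℂ, 1 < s.re → (Z s)⁻¹ = (s - 1) / G s := by
    intro s hs
    have h1 : s - 1 ≠ 0 := sub_ne_zero.mpr (hne1 s hs)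
    rw [hGZ s (hne1 s hs)]
    by_cases h : Z s = 0
    · simp [h]
    · field_simp
  -- no zeros in the half-plane of absolute convergence
  have hgt : ∀ s : ℂ, 1 < s.re → G s ≠ 0 := by
    intro s₀ hs₀ h0
    obtain ⟨B, hB⟩ := exists_norm_le_of_hasSum_cpow (N := fun m : ℕ => m)
      (a := fun m => (b m : ℂ)) hb (δ := (s₀.re - 1) / 2) (by linarith)
    have han : AnalyticOnNhd ℂ G Set.univ := fun z _ => hG.analyticAt z
    have hnz : ∀ᶠ z in 𝓝[≠] s₀, G z ≠ 0 := by
      rcases (han s₀ trivial).eventually_eq_zero_or_eventually_ne_zero with h | h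
      · exact absurd (han.eqOn_zero_of_preconnected_of_eventuallyEq_zero isPreconnected_univ
          trivial h (Set.mem_univ 1)) hG1
      · exact h
    have hre : ∀ᶠ z in 𝓝[≠] s₀, 1 + (s₀.re - 1) / 2 < z.re :=
      nhdsWithin_le_nhds (Complex.continuous_re.continuousAt.eventually_const_lt (by linarith))
    have hle : ∀ᶠ z in 𝓝[≠] s₀, ‖z - 1‖ ≤ B * ‖G z‖ := by
      filter_upwards [hnz, hre] with z h1 h2
      have h3 := hB z h2.le
      rw [hGinv z (by linarith), norm_div, div_le_iff₀ (norm_pos_iff.mpr h1)] at h3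
      exact h3
    have ht1 : Tendsto (fun z : ℂ => ‖z - 1‖) (𝓝[≠] s₀) (𝓝 ‖s₀ - 1‖) :=
      ((continuous_id.sub continuous_const).norm.tendsto s₀).mono_left nhdsWithin_le_nhds
    have ht2 : Tendsto (fun z : ℂ => B * ‖G z‖) (𝓝[≠] s₀) (𝓝 (B * ‖G s₀‖)) :=
      ((hG.continuous.norm.const_mul B).tendsto s₀).mono_left nhdsWithin_le_nhds
    have h4 := le_of_tendsto_of_tendsto ht1 ht2 hle
    rw [h0, norm_zero, mul_zero, norm_le_zero_iff, sub_eq_zero] at h4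
    exact hne1 s₀ hs₀ h4
  intro s hs
  by_cases hs1 : s = 1
  · rwa [hs1]
  rcases lt_trichotomy s.re 1 with h | h | h
  · intro h0
    rw [hGZ s hs1] at h0
    have := hGRH s ((mul_eq_zero.mp h0).resolve_left (sub_ne_zero.mpr hs1)) (by linarith) h
    linarith
  · intro h0
    -- on the line `re s = 1` a zero would force `(σ - 1) / ζ` not to tend to zero
    obtain ⟨C, hC⟩ := (hG s).isBigO_sub.bound
    rw [h0] at hC
    simp only [sub_zero] at hC
    set C' := max C 1 with hC'
    obtain ⟨K, hK, hKb⟩ := exists_sub_one_mul_norm_le hb hsum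
      (ε := 1 / (4 * C')) (by positivity)
    have hz : Tendsto (fun u : ℝ => s + u) (𝓝[>] 0) (𝓝 s) := by
      have : Tendsto (fun u : ℝ => s + u) (𝓝 0) (𝓝 (s + (0 : ℝ))) :=
        Continuous.tendsto (by fun_prop) 0
      rw [ofReal_zero, add_zero] at this
      exact this.mono_left nhdsWithin_le_nhds
    have hsmall : ∀ᶠ u : ℝ in 𝓝[>] 0, K * u < 1 / (4 * C') := by
      have : Tendsto (fun u : ℝ => K * u) (𝓝[>] 0) (𝓝 (K * 0)) :=
        (Continuous.tendsto (by fun_prop) 0).mono_left nhdsWithin_le_nhds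
      rw [mul_zero] at this
      exact this.eventually_lt_const (by positivity)
    obtain ⟨u, hu1, hu2, hu0⟩ := ((hz.eventually hC).and
      (hsmall.and self_mem_nhdsWithin)).exists
    have hu0 : 0 < u := hu0
    have hre : (s + u).re = 1 + u := by simp [h]
    have h1 := hKb (s + u) (by rw [hre]; linarith)
    rw [hre, add_sub_cancel_left, hGinv _ (by rw [hre]; linarith), norm_div] at h1
    rw [add_sub_cancel_left, Complex.norm_real, Real.norm_of_nonneg hu0.le] at hu1
    have hGp : 0 < ‖G (s + u)‖ := norm_pos_iff.mpr (hgt _ (by rw [hre]; linarith))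
    have hwp : 0 < ‖s + u - 1‖ := by
      refine norm_pos_iff.mpr fun h2 => ?_
      have := congrArg Complex.re h2
      rw [sub_re, hre, one_re, zero_re] at this
      linarith
    have h2 : u ≤ ‖G (s + u)‖ * (1 / (4 * C') + K * u) := by
      rw [mul_div_assoc', div_le_iff₀ hGp] at h1
      have : ‖s + u - 1‖ * u ≤ ‖s + u - 1‖ * (‖G (s + u)‖ * (1 / (4 * C') + K * u)) := by
        linarith
      exact le_of_mul_le_mul_left this hwp
    have h3 : u ≤ (C' * u) * (1 / (4 * C') + 1 / (4 * C')) := by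
      refine h2.trans ?_
      gcongr
      exact hu1.trans (by gcongr; exact le_max_left _ _)
    have hC0 : 0 < C' := by positivity
    have h4 : (C' * u) * (1 / (4 * C') + 1 / (4 * C')) = u / 2 := by field_simp; norm_num
    linarith
  · exact hgt s h

open scoped ContDiff

theorem contDiff_mul_of_contDiffAt_tsupport {E : Type*} [NormedAddCommGroup E] [NormedSpace ℝ E]
    {ρ g : E → ℝ} (hρ : ContDiff ℝ ∞ ρ) (hg : ∀ x ∈ tsupport ρ, ContDiffAt ℝ ∞ g x) :
    ContDiff ℝ ∞ fun x => ρ x * g x := by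
  rw [contDiff_iff_contDiffAt]
  intro x
  by_cases hx : x ∈ tsupport ρ
  · exact hρ.contDiffAt.mul (hg x hx)
  · have : (fun x => ρ x * g x) =ᶠ[𝓝 x] fun _ => 0 := by
      filter_upwards [notMem_tsupport_iff_eventuallyEq.mp hx] with y hy
      rw [hy, Pi.zero_apply, zero_mul]
    exact contDiffAt_const.congr_of_eventuallyEq this

theorem hasDerivAt_mul_exp_neg_mul {E : Type*} [NormedAddCommGroup E] [NormedSpace ℝ E]
    {ρ L : E → ℝ} (hρ : ContDiff ℝ ∞ ρ) (hL : ∀ x ∈ tsupport ρ, ContDiffAt ℝ ∞ L x)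
    (h x : E) (s : ℂ) (t : ℝ) :
    HasDerivAt (fun t : ℝ => (ρ (x + t • h) : ℂ) * cexp (-s * L (x + t • h)))
      ((fderiv ℝ ρ (x + t • h) h : ℂ) * cexp (-s * L (x + t • h)) -
        s * (((ρ (x + t • h) * fderiv ℝ L (x + t • h) h : ℝ) : ℂ) *
          cexp (-s * L (x + t • h)))) t := by
  have hline : HasDerivAt (fun t : ℝ => x + t • h) h t := by
    simpa using ((hasDerivAt_id t).smul_const h).const_add x
  set y := x + t • h with hy
  by_cases hyt : y ∈ tsupport ρ
  · have h1 : HasDerivAt (fun t : ℝ => ρ (x + t • h)) (fderiv ℝ ρ y h) t :=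
      ((hρ.differentiable (by simp)) y).hasFDerivAt.comp_hasDerivAt t hline
    have h2 : HasDerivAt (fun t : ℝ => L (x + t • h)) (fderiv ℝ L y h) t :=
      ((hL y hyt).differentiableAt (by simp)).hasFDerivAt.comp_hasDerivAt t hline
    have h3 := h1.ofReal_comp.mul ((h2.ofReal_comp.const_mul (-s)).cexp)
    refine h3.congr_deriv ?_
    simp only [← hy]
    push_cast
    ring
  · have h0 := notMem_tsupport_iff_eventuallyEq.mp hyt
    have hcont : Tendsto (fun t : ℝ => x + t • h) (𝓝 t) (𝓝 y) := hline.continuousAt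
    have h1 : (fun t : ℝ => (ρ (x + t • h) : ℂ) * cexp (-s * L (x + t • h))) =ᶠ[𝓝 t]
        fun _ => 0 := by
      filter_upwards [hcont.eventually h0] with u hu
      rw [hu, Pi.zero_apply, ofReal_zero, zero_mul]
    have h2 : ρ y = 0 := h0.self_of_nhds
    have h3 : fderiv ℝ ρ y = 0 := by
      rw [h0.fderiv_eq]
      simp
    rw [h2, h3]
    simpa using (hasDerivAt_const t (0 : ℂ)).congr_of_eventuallyEq h1

theorem exists_norm_fwdDiff_iter_le {E : Type*} [NormedAddCommGroup E] [NormedSpace ℝ E]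
    {L : E → ℝ} (h : E) (B : ℝ) (M : ℕ) {ρ : E → ℝ} (hρ : ContDiff ℝ ∞ ρ)
    (hc : HasCompactSupport ρ) (hL : ∀ x ∈ tsupport ρ, ContDiffAt ℝ ∞ L x) :
    ∃ C, 0 ≤ C ∧ ∀ s : ℂ, |s.re| ≤ B → ∀ τ : ℝ, 0 ≤ τ → ∀ x : E,
      ‖(fwdDiff (τ • h))^[M] (fun x => (ρ x : ℂ) * cexp (-s * L x)) x‖
        ≤ C * τ ^ M * (1 + ‖s‖) ^ M := by
  induction M generalizing ρ with
  | zero =>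
    have hcont : ContinuousOn (fun x => |ρ x| * Real.exp (B * |L x|)) (tsupport ρ) := by
      intro x hx
      have := (hL x hx).continuousAt
      exact ((hρ.continuous.continuousAt.abs).mul
        ((this.abs.const_mul B).rexp)).continuousWithinAt
    obtain ⟨C, hC⟩ := hc.isCompact.bddAbove_image hcont
    refine ⟨max C 0, le_max_right _ _, fun s hs τ _ x => ?_⟩
    simp only [Function.iterate_zero, id_eq, pow_zero, mul_one]
    by_cases hx : x ∈ tsupport ρ
    · refine le_trans ?_ (le_max_left _ _)
      refine le_trans ?_ (hC ⟨x, hx, rfl⟩)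
      rw [norm_mul, Complex.norm_real, Complex.norm_exp, Real.norm_eq_abs]
      change _ ≤ |ρ x| * Real.exp (B * |L x|)
      gcongr
      have : (-s * (L x : ℂ)).re = -s.re * L x := by simp
      rw [this]
      calc -s.re * L x ≤ |-s.re * L x| := le_abs_self _
        _ = |s.re| * |L x| := by rw [abs_mul, abs_neg]
        _ ≤ _ := by gcongr
    · rw [image_eq_zero_of_notMem_tsupport hx]
      simp
  | succ M ih =>
    have hsub1 : tsupport (fun x => fderiv ℝ ρ x h) ⊆ tsupport ρ :=
      tsupport_fderiv_apply_subset ℝ h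
    have hsub2 : tsupport (fun x => ρ x * fderiv ℝ L x h) ⊆ tsupport ρ :=
      tsupport_mul_subset_left
    have hL' : ∀ x ∈ tsupport ρ, ContDiffAt ℝ ∞ (fun x => fderiv ℝ L x h) x := fun x hx =>
      ((hL x hx).fderiv_right (m := ∞) (by simp)).clm_apply contDiffAt_const
    obtain ⟨C₁, hC₁, h1⟩ := ih (ρ := fun x => fderiv ℝ ρ x h)
      ((hρ.fderiv_right (m := ∞) (by simp)).clm_apply contDiff_const)
      (hc.fderiv_apply ℝ h) (fun x hx => hL x (hsub1 hx))
    obtain ⟨C₂, hC₂, h2⟩ := ih (ρ := fun x => ρ x * fderiv ℝ L x h)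
      (contDiff_mul_of_contDiffAt_tsupport hρ hL') hc.mul_right (fun x hx => hL x (hsub2 hx))
    refine ⟨C₁ + C₂, by positivity, fun s hs τ hτ x => ?_⟩
    rw [Function.iterate_succ_apply', fwdDiff]
    set F : E → ℂ := fun x => (ρ x : ℂ) * cexp (-s * L x) with hF
    set F₁ : E → ℂ := fun x => (fderiv ℝ ρ x h : ℂ) * cexp (-s * L x) with hF₁
    set F₂ : E → ℂ := fun x => ((ρ x * fderiv ℝ L x h : ℝ) : ℂ) * cexp (-s * L x) with hF₂
    have hder : ∀ t : ℝ, HasDerivAt (fun t : ℝ => (fwdDiff (τ • h))^[M] F (x + t • h))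
        ((fwdDiff (τ • h))^[M] F₁ (x + t • h) - s * (fwdDiff (τ • h))^[M] F₂ (x + t • h)) t := by
      intro t
      simp only [fwdDiff_iter_eq_sum_shift, Finset.mul_sum, ← Finset.sum_sub_distrib]
      refine HasDerivAt.fun_sum fun k _ => ?_
      have := (hasDerivAt_mul_exp_neg_mul hρ hL h (x + k • τ • h) s t).const_smul
        ((-1 : ℤ) ^ (M - k) * (M.choose k : ℤ))
      have e : ∀ t : ℝ, x + t • h + k • τ • h = x + k • τ • h + t • h := fun t => by abel
      simp only [e]
      refine this.congr_deriv ?_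
      simp only [hF₁, hF₂, zsmul_eq_mul]
      ring
    have hmv := norm_image_sub_le_of_norm_deriv_le_segment' (a := 0) (b := τ)
      (fun t _ => (hder t).hasDerivWithinAt)
      (C := (C₁ + C₂) * τ ^ M * (1 + ‖s‖) ^ (M + 1)) (fun t _ => by
        refine (norm_sub_le _ _).trans ?_
        rw [norm_mul]
        have h1' := h1 s hs τ hτ (x + t • h)
        have h2' := h2 s hs τ hτ (x + t • h)
        calc _ ≤ C₁ * τ ^ M * (1 + ‖s‖) ^ M + ‖s‖ * (C₂ * τ ^ M * (1 + ‖s‖) ^ M) := by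
              gcongr
          _ ≤ (C₁ * τ ^ M * (1 + ‖s‖) ^ M) * (1 + ‖s‖) +
              (1 + ‖s‖) * (C₂ * τ ^ M * (1 + ‖s‖) ^ M) := by
              refine add_le_add ?_ ?_
              · exact le_mul_of_one_le_right (by positivity) (by linarith [norm_nonneg s])
              · exact mul_le_mul_of_nonneg_right (by linarith) (by positivity)
          _ = _ := by ring) τ ⟨hτ, le_rfl⟩
    rw [zero_smul, add_zero, sub_zero] at hmv
    refine hmv.trans (le_of_eq ?_)
    ring

theorem summable_fwdDiff_iter {A : Type*} [AddCommGroup A] (e : A) {f : A → ℂ} (hf : Summable f)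
    (M : ℕ) : Summable ((fwdDiff e)^[M] f) := by
  induction M with
  | zero => exact hf
  | succ M ih =>
    rw [Function.iterate_succ_apply']
    exact ((Equiv.addRight e).summable_iff.mpr ih).sub ih

theorem tsum_mul_eq_tsum_mul_fwdDiff_iter {A : Type*} [AddCommGroup A] {e : A} {χ : A → ℂ}
    (hχ : ∀ a, χ (a + e) = -χ a) (hχ1 : ∀ a, ‖χ a‖ ≤ 1) {f : A → ℂ} (hf : Summable f) (M : ℕ) :
    ∑' a, χ a * f a = (-1 / 2) ^ M * ∑' a, χ a * (fwdDiff e)^[M] f a := by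
  have hs : ∀ {g : A → ℂ}, Summable g → Summable fun a => χ a * g a := fun {g} hg =>
    Summable.of_norm_bounded hg.norm fun a => by
      rw [norm_mul]
      exact mul_le_of_le_one_left (norm_nonneg _) (hχ1 a)
  induction M with
  | zero => simp
  | succ M ih =>
    rw [ih, Function.iterate_succ_apply']
    set g := (fwdDiff e)^[M] f with hg
    have hgs : Summable g := summable_fwdDiff_iter e hf M
    have h1 : ∑' a, χ a * g (a + e) = -∑' a, χ a * g a := by
      rw [← (Equiv.addRight e).tsum_eq fun a => χ a * g a, ← tsum_neg]
      refine tsum_congr fun a => ?_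
      simp [hχ]
    have h2 : ∑' a, χ a * fwdDiff e g a = ∑' a, χ a * g (a + e) - ∑' a, χ a * g a := by
      rw [← ((hs ((Equiv.addRight e).summable_iff.mpr hgs) :
        Summable fun a => χ a * g (a + e)).tsum_sub (hs hgs))]
      exact tsum_congr fun a => by rw [fwdDiff, mul_sub]
    rw [h2, h1]
    ring

theorem norm_prod_neg_one_zpow {ι : Type*} (S : Finset ι) (a : ι → ℤ) :
    ‖∏ i ∈ S, (-1 : ℂ) ^ a i‖ = 1 := by
  simp [norm_prod]

theorem prod_neg_one_zpow_add_single {ι : Type*} [DecidableEq ι] {S : Finset ι} {j : ι}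
    (hj : j ∈ S) (a : ι → ℤ) :
    ∏ i ∈ S, (-1 : ℂ) ^ (a + Pi.single j (1 : ℤ) : ι → ℤ) i = -∏ i ∈ S, (-1 : ℂ) ^ a i := by
  have : ∀ i ∈ S, (-1 : ℂ) ^ (a + Pi.single j (1 : ℤ) : ι → ℤ) i = (-1 : ℂ) ^ a i * if i = j then -1 else 1 := by
    intro i _
    rw [Pi.add_apply, zpow_add₀ (by norm_num)]
    by_cases h : i = j
    · subst h; simp
    · simp [h]
  rw [Finset.prod_congr rfl this, Finset.prod_mul_distrib, Finset.prod_ite_eq' S j, if_pos hj,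
    mul_neg_one]

theorem two_pow_mul_tsum_two_smul {ι : Type*} [Fintype ι] [DecidableEq ι] {f : (ι → ℤ) → ℂ}
    (hf : Summable f) :
    2 ^ Fintype.card ι * ∑' a, f ((2 : ℤ) • a) =
      ∑ S : Finset ι, ∑' a, (∏ i ∈ S, (-1 : ℂ) ^ a i) * f a := by
  rw [← Summable.tsum_finsetSum fun S _ => Summable.of_norm_bounded hf.norm fun a => by
    rw [norm_mul, norm_prod_neg_one_zpow, one_mul]]
  have h1 : ∀ a : ι → ℤ, ∑ S : Finset ι, ∏ i ∈ S, (-1 : ℂ) ^ a i = ∏ i, (1 + (-1 : ℂ) ^ a i) :=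
    fun a => by rw [Finset.prod_one_add, Finset.powerset_univ]
  simp_rw [← Finset.sum_mul, h1]
  have hinj : Function.Injective fun a : ι → ℤ => (2 : ℤ) • a := fun a c h =>
    funext fun i => by have := congrFun h i; simpa using this
  rw [← hinj.tsum_eq (f := fun a => (∏ i, (1 + (-1 : ℂ) ^ a i)) * f a), ← tsum_mul_left]
  · refine tsum_congr fun a => ?_
    congr 1
    simp only [Pi.smul_apply, smul_eq_mul]
    rw [Finset.prod_congr rfl fun i _ => by rw [(even_two_mul (a i)).neg_one_zpow]]
    rw [Finset.prod_const, Finset.card_univ]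
    norm_num
  · intro a ha
    rw [Function.mem_support] at ha
    have h2 : ∀ i, Even (a i) := by
      intro i
      by_contra hi
      rw [Int.not_even_iff_odd] at hi
      refine ha ?_
      rw [Finset.prod_eq_zero (Finset.mem_univ i) (by rw [hi.neg_one_zpow]; norm_num), zero_mul]
    refine ⟨fun i => a i / 2, funext fun i => ?_⟩
    simp only [Pi.smul_apply, smul_eq_mul]
    exact Int.mul_ediv_cancel' (h2 i).two_dvd

theorem one_sub_mul_tsum_eq_neg_sum_tsum {ι : Type*} [Fintype ι] [DecidableEq ι]
    {f : (ι → ℤ) → ℂ} (hf : Summable f) {c : ℂ} (hc : ∀ a, f ((2 : ℤ) • a) = c * f a) :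
    (1 - 2 ^ Fintype.card ι * c) * ∑' a, f a =
      -∑ S ∈ (Finset.univ : Finset (Finset ι)).erase ∅,
        ∑' a, (∏ i ∈ S, (-1 : ℂ) ^ a i) * f a := by
  have h := two_pow_mul_tsum_two_smul hf
  simp_rw [hc, tsum_mul_left] at h
  rw [← Finset.add_sum_erase _ _ (Finset.mem_univ ∅)] at h
  simp only [Finset.prod_empty, one_mul] at h
  linear_combination -h

theorem summable_norm_sum_smul_basis_rpow {E : Type*} [NormedAddCommGroup E] [NormedSpace ℝ E]
    {ι : Type*} [Fintype ι] (b : Module.Basis ι ℝ E) {r : ℝ} (hr : r < -Fintype.card ι) :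
    Summable fun a : ι → ℤ => ‖∑ i, (a i : ℝ) • b i‖ ^ r := by
  classical
  have : FiniteDimensional ℝ E := b.finiteDimensional_of_finite
  have h := ZLattice.summable_norm_rpow (Submodule.span ℤ (Set.range b)) r (by
    rwa [ZLattice.rank ℝ (Submodule.span ℤ (Set.range b)), Module.finrank_eq_card_basis b])
  let f : (ι → ℤ) → Submodule.span ℤ (Set.range b) := fun a =>
    ⟨∑ i, (a i : ℝ) • b i, Submodule.sum_mem _ fun i _ => by
      rw [Int.cast_smul_eq_zsmul]
      exact Submodule.smul_mem _ _ (Submodule.subset_span ⟨i, rfl⟩)⟩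
  have hf : Function.Injective f := by
    intro a c hac
    have h1 : ∑ i, (a i : ℝ) • b i = ∑ i, (c i : ℝ) • b i := congrArg Subtype.val hac
    funext i
    have h2 := congrArg (fun x => b.equivFun x i) h1
    simp only [← b.equivFun_symm_apply fun i => (a i : ℝ), ← b.equivFun_symm_apply fun i => (c i : ℝ),
      LinearEquiv.apply_symm_apply] at h2
    exact_mod_cast h2
  exact (h.comp_injective hf :)

theorem differentiableAt_tsum_of_norm_le {α : Type*} {F : α → ℂ → ℂ} {U : Set ℂ} (hU : IsOpen U)
    {u : α → ℝ} (hu : Summable u) (hu0 : ∀ a, 0 ≤ u a) {n : ℕ}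
    (hF : ∀ a, Differentiable ℂ (F a)) (hb : ∀ s ∈ U, ∀ a, ‖F a s‖ ≤ u a * (1 + ‖s‖) ^ n)
    {s : ℂ} (hs : s ∈ U) :
    DifferentiableAt ℂ (fun s => ∑' a, F a s) s ∧
      ‖∑' a, F a s‖ ≤ (∑' a, u a) * (1 + ‖s‖) ^ n := by
  constructor
  · have hV : IsOpen (U ∩ Metric.ball 0 (‖s‖ + 1)) := hU.inter Metric.isOpen_ball
    refine (differentiableOn_tsum_of_summable_norm (u := fun a => u a * (2 + ‖s‖) ^ n)
      (hu.mul_right _) (fun a => (hF a).differentiableOn) hV fun a z hz => ?_).differentiableAt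
      (hV.mem_nhds ⟨hs, by simp⟩)
    refine (hb z hz.1 a).trans ?_
    have : ‖z‖ < ‖s‖ + 1 := by simpa using hz.2
    have h0 := hu0 a
    gcongr ?_ * ?_ ^ n
    linarith
  · rw [← tsum_mul_right]
    exact tsum_of_norm_bounded (hu.mul_right _).hasSum (hb s hs)

theorem mul_exp_neg_mul_log_smul {E : Type*} [NormedAddCommGroup E] [NormedSpace ℝ E]
    {φ ν : E → ℝ} {n : ℕ} {C : ℝ}
    (hφ : ∀ t : ℝ, 0 < t → ∀ x, φ (t • x) = φ x) (hφ0 : φ 0 = 0)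
    (hν : ∀ t : ℝ, 0 < t → ∀ x, ν (t • x) = t ^ n * ν x)
    (hc : ∀ x, φ x ≠ 0 → ‖x‖ ^ n ≤ C * ν x) (s : ℂ) {t : ℝ} (ht : 0 < t) (x : E) :
    (φ (t • x) : ℂ) * cexp (-s * Real.log (ν (t • x))) =
      cexp (-s * (n * Real.log t : ℝ)) * ((φ x : ℂ) * cexp (-s * Real.log (ν x))) := by
  rw [hφ t ht]
  by_cases h : φ x = 0
  · simp [h]
  have hx : x ≠ 0 := fun hx => h (hx ▸ hφ0)
  have hνx : ν x ≠ 0 := fun h0 => by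
    have := hc x h
    rw [h0, mul_zero] at this
    have : 0 < ‖x‖ ^ n := pow_pos (norm_pos_iff.mpr hx) n
    linarith
  rw [hν t ht, Real.log_mul (pow_pos ht n).ne' hνx, Real.log_pow, mul_left_comm, ← Complex.exp_add]
  push_cast
  ring_nf

theorem exists_norm_fwdDiff_iter_homogeneous_le {E : Type*} [NormedAddCommGroup E]
    [NormedSpace ℝ E] [FiniteDimensional ℝ E]
    {φ ν : E → ℝ} {n : ℕ} {C : ℝ}
    (hφ : ∀ t : ℝ, 0 < t → ∀ x, φ (t • x) = φ x) (hφ0 : φ 0 = 0)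
    (hν : ∀ t : ℝ, 0 < t → ∀ x, ν (t • x) = t ^ n * ν x) (hνc : Continuous ν)
    (hc : ∀ x, φ x ≠ 0 → ‖x‖ ^ n ≤ C * ν x)
    (hφs : ∀ x, ν x ≠ 0 → ContDiffAt ℝ ∞ φ x) (hνs : ∀ x, ν x ≠ 0 → ContDiffAt ℝ ∞ ν x)
    (e : E) (B : ℝ) (M : ℕ) :
    ∃ C' R : ℝ, 0 ≤ C' ∧ 1 ≤ R ∧ ∀ s : ℂ, |s.re| ≤ B → ∀ x : E, R ≤ ‖x‖ →
      ‖(fwdDiff e)^[M] (fun x => (φ x : ℂ) * cexp (-s * Real.log (ν x))) x‖ ≤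
        C' * ‖x‖ ^ (-(n * s.re) - M) * (1 + ‖s‖) ^ M := by
  let f₁ : ContDiffBump (0 : E) := ⟨2, 4, by norm_num, by norm_num⟩
  let f₂ : ContDiffBump (0 : E) := ⟨1 / 4, 1 / 2, by norm_num, by norm_num⟩
  let χ : E → ℝ := fun x => f₁ x - f₂ x
  have hχs : ContDiff ℝ ∞ χ := f₁.contDiff.sub f₂.contDiff
  have hχ1 : ∀ x, 1 / 2 ≤ ‖x‖ → ‖x‖ ≤ 2 → χ x = 1 := by
    intro x h1 h2
    have e1 : f₁ x = 1 := f₁.one_of_mem_closedBall (by simpa [f₁] using h2)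
    have e2 : f₂ x = 0 := f₂.zero_of_le_dist (by simpa [f₂] using h1)
    simp [χ, e1, e2]
  have hχ0 : ∀ x ∈ tsupport χ, 1 / 4 ≤ ‖x‖ := by
    have : IsClosed {x : E | 1 / 4 ≤ ‖x‖} := isClosed_le continuous_const continuous_norm
    refine fun x hx => closure_minimal (fun y hy => ?_) this hx
    rw [Set.mem_ofPred_eq]
    by_contra! h
    refine hy ?_
    have e1 : f₁ y = 1 := f₁.one_of_mem_closedBall (by simp [f₁]; linarith)
    have e2 : f₂ y = 1 := f₂.one_of_mem_closedBall (by simp [f₂]; linarith)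
    simp [χ, e1, e2]
  have hχc : HasCompactSupport χ := f₁.hasCompactSupport.sub f₂.hasCompactSupport
  have hφat : ∀ x, x ≠ 0 → ContDiffAt ℝ ∞ φ x := by
    intro x hx
    by_cases h : ν x = 0
    · have ho : IsOpen {y : E | C * ν y < ‖y‖ ^ n} :=
        isOpen_lt (hνc.const_mul C |>.congr fun _ => rfl) (continuous_norm.pow n)
      have hm : x ∈ {y : E | C * ν y < ‖y‖ ^ n} := by
        rw [Set.mem_ofPred_eq, h, mul_zero]
        exact pow_pos (norm_pos_iff.mpr hx) n
      have : φ =ᶠ[𝓝 x] fun _ => 0 := by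
        filter_upwards [ho.mem_nhds hm] with y hy
        by_contra h0
        exact absurd (hc y h0) (not_le.mpr hy)
      exact contDiffAt_const.congr_of_eventuallyEq this
    · exact hφs x h
  have hne : ∀ x ∈ tsupport χ, x ≠ 0 := fun x hx h0 => by
    have := hχ0 x hx
    rw [h0, norm_zero] at this
    linarith
  let ρ : E → ℝ := fun x => χ x * φ x
  have hρs : ContDiff ℝ ∞ ρ := contDiff_mul_of_contDiffAt_tsupport hχs fun x hx => hφat x (hne x hx)
  have hρc : HasCompactSupport ρ := hχc.mul_right
  have hρν : ∀ x ∈ tsupport ρ, ν x ≠ 0 := by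
    intro x hx h0
    have h1 : x ≠ 0 := hne x (tsupport_mul_subset_left hx)
    have hcl : IsClosed {y : E | ‖y‖ ^ n ≤ C * ν y} :=
      isClosed_le (continuous_norm.pow n) (hνc.const_mul C |>.congr fun _ => rfl)
    have h2 : x ∈ {y : E | ‖y‖ ^ n ≤ C * ν y} :=
      closure_minimal (s := Function.support ρ) (fun y hy => hc y fun h => hy (by simp [ρ, h])) hcl hx
    rw [Set.mem_ofPred_eq, h0, mul_zero] at h2
    have : 0 < ‖x‖ ^ n := pow_pos (norm_pos_iff.mpr h1) n
    linarith
  obtain ⟨C', hC', hb⟩ := exists_norm_fwdDiff_iter_le (L := fun x => Real.log (ν x)) e B M hρs hρc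
    fun x hx => (hνs x (hρν x hx)).log (hρν x hx)
  refine ⟨C', max 1 (2 * (M * ‖e‖)), hC', le_max_left _ _, fun s hs x hx => ?_⟩
  have hx1 : 1 ≤ ‖x‖ := (le_max_left _ _).trans hx
  have hx0 : 0 < ‖x‖ := by linarith
  have hxe : 2 * (M * ‖e‖) ≤ ‖x‖ := (le_max_right _ _).trans hx
  set l := ‖x‖ with hl
  have hkey : (fwdDiff e)^[M] (fun x => (φ x : ℂ) * cexp (-s * Real.log (ν x))) x =
      cexp (-s * (n * Real.log l : ℝ)) *
        (fwdDiff (l⁻¹ • e))^[M] (fun x => (ρ x : ℂ) * cexp (-s * Real.log (ν x))) (l⁻¹ • x) := by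
    simp only [fwdDiff_iter_eq_sum_shift, Finset.mul_sum]
    refine Finset.sum_congr rfl fun k hk => ?_
    rw [mul_smul_comm]
    congr 1
    have hkM : (k : ℝ) ≤ M := by exact_mod_cast Nat.lt_succ_iff.mp (Finset.mem_range.mp hk)
    set y := l⁻¹ • x + k • l⁻¹ • e with hy
    have hy1 : x + k • e = l • y := by
      rw [hy, smul_add, smul_inv_smul₀ hx0.ne', smul_comm l k, smul_inv_smul₀ hx0.ne']
    have hn1 : ‖l⁻¹ • x‖ = 1 := by
      rw [norm_smul, norm_inv, Real.norm_of_nonneg hx0.le, inv_mul_cancel₀ hx0.ne']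
    have hn2 : ‖k • l⁻¹ • e‖ ≤ 1 / 2 := by
      rw [← Nat.cast_smul_eq_nsmul ℝ, norm_smul, norm_smul, norm_inv, Real.norm_of_nonneg hx0.le,
        Real.norm_of_nonneg (Nat.cast_nonneg k), ← mul_assoc, mul_comm (k : ℝ), mul_assoc,
        inv_mul_le_iff₀ hx0]
      have : k * ‖e‖ ≤ M * ‖e‖ := by gcongr
      linarith
    have hy2 : 1 / 2 ≤ ‖y‖ := by
      have := norm_sub_le_norm_add (l⁻¹ • x) (k • l⁻¹ • e)
      rw [hy]
      linarith
    have hy3 : ‖y‖ ≤ 2 := by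
      have := norm_add_le (l⁻¹ • x) (k • l⁻¹ • e)
      rw [hy]
      linarith
    have hy4 : ρ y = φ y := by simp [ρ, hχ1 y hy2 hy3]
    rw [hy1, mul_exp_neg_mul_log_smul hφ hφ0 hν hc s hx0, hy4]
  rw [hkey, norm_mul, Complex.norm_exp]
  have h1 : (-s * ((n * Real.log l : ℝ) : ℂ)).re = Real.log l * (-(n * s.re)) := by
    rw [re_mul_ofReal, neg_re]
    ring
  rw [h1, ← Real.rpow_def_of_pos hx0]
  calc l ^ (-(n * s.re)) * _ ≤ l ^ (-(n * s.re)) * (C' * l⁻¹ ^ M * (1 + ‖s‖) ^ M) := by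
        gcongr
        exact hb s hs l⁻¹ (by positivity) (l⁻¹ • x)
    _ = _ := by
        rw [Real.rpow_sub hx0, Real.rpow_natCast, inv_pow]
        ring

theorem exists_summable_norm_fwdDiff_iter_le {E : Type*} [NormedAddCommGroup E]
    [NormedSpace ℝ E] {ι : Type*} [Fintype ι] [Nonempty ι] (b : Module.Basis ι ℝ E)
    {φ ν : E → ℝ} {C : ℝ}
    (hφ : ∀ t : ℝ, 0 < t → ∀ x, φ (t • x) = φ x) (hφ0 : φ 0 = 0)
    (hν : ∀ t : ℝ, 0 < t → ∀ x, ν (t • x) = t ^ Fintype.card ι * ν x) (hνc : Continuous ν)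
    (hc : ∀ x, φ x ≠ 0 → ‖x‖ ^ Fintype.card ι ≤ C * ν x)
    (hφs : ∀ x, ν x ≠ 0 → ContDiffAt ℝ ∞ φ x) (hνs : ∀ x, ν x ≠ 0 → ContDiffAt ℝ ∞ ν x) (e : E) :
    ∃ u : (ι → ℤ) → ℝ, Summable u ∧ (∀ a, 0 ≤ u a) ∧ ∀ s : ℂ, 1 / 2 < s.re → s.re < 3 → ∀ a,
      ‖(fwdDiff e)^[Fintype.card ι] (fun x => (φ x : ℂ) * cexp (-s * Real.log (ν x)))
        (∑ i, (a i : ℝ) • b i)‖ ≤ u a * (1 + ‖s‖) ^ Fintype.card ι := by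
  classical
  have : FiniteDimensional ℝ E := b.finiteDimensional_of_finite
  set n := Fintype.card ι with hn
  have hn0 : 0 < n := Fintype.card_pos
  have hn0' : (0 : ℝ) < n := by exact_mod_cast hn0
  obtain ⟨C', R, hC', hR, hb⟩ :=
    exists_norm_fwdDiff_iter_homogeneous_le hφ hφ0 hν hνc hc hφs hνs e 3 n
  set X : (ι → ℤ) → E := fun a => ∑ i, (a i : ℝ) • b i with hX
  set r : ℝ := -(n / 2) - n with hr
  have hsum : Summable fun a => ‖X a‖ ^ r := summable_norm_sum_smul_basis_rpow b (by
    rw [← hn]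
    linarith)
  have hXinj : Function.Injective X := by
    intro a c hac
    funext i
    have h2 := congrArg (fun x => b.equivFun x i) hac
    simp only [hX, ← b.equivFun_symm_apply fun i => (a i : ℝ),
      ← b.equivFun_symm_apply fun i => (c i : ℝ), LinearEquiv.apply_symm_apply] at h2
    exact_mod_cast h2
  have hfin : {a | ‖X a‖ < R}.Finite := by
    have h1 : {a | R ^ r ≤ ‖X a‖ ^ r}.Finite := by
      have := hsum.tendsto_cofinite_zero.eventually_lt_const (u := R ^ r) (by positivity)
      rw [Filter.eventually_cofinite] at this
      exact this.subset fun a ha => not_lt.mpr ha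
    refine (h1.union (Set.finite_singleton (0 : ι → ℤ))).subset fun a ha => ?_
    by_cases ha0 : X a = 0
    · right
      refine hXinj ?_
      rw [ha0]
      simp [hX]
    · left
      exact Real.rpow_le_rpow_of_nonpos (norm_pos_iff.mpr ha0) (le_of_lt ha) (by linarith)
  let D : E → ℝ := fun x => ∑ k ∈ Finset.range (n + 1), |((-1 : ℤ) ^ (n - k) * (n.choose k : ℤ) : ℤ)| *
    (|φ (x + k • e)| * Real.exp (3 * |Real.log (ν (x + k • e))|))
  have hD0 : ∀ x, 0 ≤ D x := fun x => Finset.sum_nonneg fun k _ => by positivity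
  have hD : ∀ s : ℂ, |s.re| ≤ 3 → ∀ x,
      ‖(fwdDiff e)^[n] (fun x => (φ x : ℂ) * cexp (-s * Real.log (ν x))) x‖ ≤ D x := by
    intro s hs x
    rw [fwdDiff_iter_eq_sum_shift]
    refine norm_sum_le_of_le _ fun k _ => ?_
    rw [zsmul_eq_mul, norm_mul, norm_mul, Complex.norm_real, Complex.norm_exp, Complex.norm_intCast,
      Real.norm_eq_abs, Int.cast_abs]
    gcongr
    rw [re_mul_ofReal, neg_re]
    refine (le_abs_self _).trans ?_
    rw [abs_mul, abs_neg]
    gcongr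
  refine ⟨fun a => C' * ‖X a‖ ^ r + {a | ‖X a‖ < R}.indicator (fun a => D (X a)) a,
    (hsum.mul_left C').add (summable_of_hasFiniteSupport (hfin.subset Set.support_indicator_subset)),
    fun a => add_nonneg (by positivity) (Set.indicator_nonneg (fun a _ => hD0 _) a), ?_⟩
  intro s hs1 hs2 a
  have hs3 : |s.re| ≤ 3 := by rw [abs_le]; constructor <;> linarith
  beta_reduce
  by_cases ha : ‖X a‖ < R
  · rw [Set.indicator_of_mem (show a ∈ {a | ‖X a‖ < R} from ha)]
    refine (hD s hs3 (X a)).trans ?_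
    have h1 : 1 ≤ (1 + ‖s‖) ^ n := one_le_pow₀ (by linarith [norm_nonneg s])
    have h2 : 0 ≤ C' * ‖X a‖ ^ r := by positivity
    have h3 := hD0 (X a)
    nlinarith
  · rw [Set.indicator_of_notMem (show a ∉ {a | ‖X a‖ < R} from ha), add_zero]
    have ha := not_lt.mp ha
    refine (hb s hs3 (X a) ha).trans ?_
    gcongr ?_ * ?_ * ?_
    · exact Real.rpow_le_rpow_of_exponent_le (hR.trans ha) (by rw [hr]; nlinarith)

/-- Analytic continuation, with polynomial growth, of a twisted sum over a lattice of a homogeneous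
function which is smooth away from the origin. -/
theorem exists_one_sub_mul_tsum_eq {E : Type*} [NormedAddCommGroup E]
    [NormedSpace ℝ E] {ι : Type*} [Fintype ι] [Nonempty ι] (b : Module.Basis ι ℝ E)
    {φ ν : E → ℝ} {C : ℝ}
    (hφ : ∀ t : ℝ, 0 < t → ∀ x, φ (t • x) = φ x) (hφ0 : φ 0 = 0)
    (hν : ∀ t : ℝ, 0 < t → ∀ x, ν (t • x) = t ^ Fintype.card ι * ν x) (hνc : Continuous ν)
    (hc : ∀ x, φ x ≠ 0 → ‖x‖ ^ Fintype.card ι ≤ C * ν x)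
    (hφs : ∀ x, ν x ≠ 0 → ContDiffAt ℝ ∞ φ x) (hνs : ∀ x, ν x ≠ 0 → ContDiffAt ℝ ∞ ν x) :
    ∃ V : ℂ → ℂ, ∃ C' : ℝ, 0 ≤ C' ∧
      (∀ s : ℂ, 1 / 2 < s.re → s.re < 3 → DifferentiableAt ℂ V s ∧
        ‖V s‖ ≤ C' * (1 + ‖s‖) ^ Fintype.card ι) ∧
      ∀ s : ℂ, 1 / 2 < s.re → s.re < 3 →
        Summable (fun a : ι → ℤ => (φ (∑ i, (a i : ℝ) • b i) : ℂ) *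
          cexp (-s * Real.log (ν (∑ i, (a i : ℝ) • b i)))) →
        (1 - (2 ^ Fintype.card ι : ℝ) ^ (1 - s)) *
          ∑' a : ι → ℤ, (φ (∑ i, (a i : ℝ) • b i) : ℂ) *
            cexp (-s * Real.log (ν (∑ i, (a i : ℝ) • b i))) = V s := by
  classical
  set n := Fintype.card ι with hn
  set X : (ι → ℤ) → E := fun a => ∑ i, (a i : ℝ) • b i with hX
  have hXadd : ∀ a j (k : ℕ), X (a + k • Pi.single j 1) = X a + k • b j := by
    intro a j k
    simp only [hX, Pi.add_apply, Pi.smul_apply, Int.cast_add, add_smul, Finset.sum_add_distrib]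
    congr 1
    rw [Finset.sum_eq_single j]
    · simp [Nat.cast_smul_eq_nsmul]
    · intro i _ hi
      simp [hi]
    · simp
  set g : ℂ → E → ℂ := fun s x => (φ x : ℂ) * cexp (-s * Real.log (ν x)) with hg
  have hgdiff : ∀ e x, Differentiable ℂ fun s => (fwdDiff e)^[n] (g s) x := by
    intro e x
    simp only [fwdDiff_iter_eq_sum_shift, hg]
    fun_prop
  have hshift : ∀ s j a, (fwdDiff (Pi.single j 1))^[n] (fun a => g s (X a)) a =
      (fwdDiff (b j))^[n] (g s) (X a) := by
    intro s j a
    simp only [fwdDiff_iter_eq_sum_shift, hXadd]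
  have hU : IsOpen {s : ℂ | 1 / 2 < s.re ∧ s.re < 3} :=
    (isOpen_lt continuous_const continuous_re).inter (isOpen_lt continuous_re continuous_const)
  choose u hu hu0 hub using fun j =>
    exists_summable_norm_fwdDiff_iter_le b hφ hφ0 hν hνc hc hφs hνs (b j)
  let j₀ : Finset ι → ι := fun S => if h : S.Nonempty then h.choose else Classical.arbitrary ι
  have hj₀ : ∀ S : Finset ι, S ≠ ∅ → j₀ S ∈ S := fun S hS => by
    have h := Finset.nonempty_iff_ne_empty.mpr hS
    simp only [j₀, dif_pos h]
    exact h.choose_spec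
  have hW := fun S : Finset ι => fun s (hs : s ∈ {s : ℂ | 1 / 2 < s.re ∧ s.re < 3}) =>
    differentiableAt_tsum_of_norm_le (n := n)
      (F := fun a s => (∏ i ∈ S, (-1 : ℂ) ^ a i) * (fwdDiff (b (j₀ S)))^[n] (g s) (X a))
      hU (hu (j₀ S)) (hu0 (j₀ S)) (fun a => (hgdiff _ _).const_mul _)
      (fun s hs a => by
        rw [norm_mul, norm_prod_neg_one_zpow, one_mul]
        exact hub (j₀ S) s hs.1 hs.2 a) hs
  refine ⟨fun s => -∑ S ∈ (Finset.univ : Finset (Finset ι)).erase ∅, (-1 / 2) ^ n *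
      ∑' a, (∏ i ∈ S, (-1 : ℂ) ^ a i) * (fwdDiff (b (j₀ S)))^[n] (g s) (X a),
    ∑ S ∈ (Finset.univ : Finset (Finset ι)).erase ∅, ∑' a, u (j₀ S) a, ?_, ?_, ?_⟩
  · exact Finset.sum_nonneg fun S _ => tsum_nonneg (hu0 _)
  · intro s hs1 hs2
    refine ⟨(DifferentiableAt.fun_sum fun S _ => ((hW S s ⟨hs1, hs2⟩).1.const_mul _)).fun_neg, ?_⟩
    rw [norm_neg, Finset.sum_mul]
    refine norm_sum_le_of_le _ fun S _ => ?_
    rw [norm_mul]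
    refine (mul_le_of_le_one_left (norm_nonneg _) ?_).trans (hW S s ⟨hs1, hs2⟩).2
    rw [norm_pow]
    exact pow_le_one₀ (norm_nonneg _) (by norm_num)
  · intro s hs1 hs2 hsm
    have h2 : (((2 ^ n : ℝ) : ℂ)) ^ (1 - s) = 2 ^ n * cexp (-s * (n * Real.log 2 : ℝ)) := by
      rw [cpow_def_of_ne_zero (by norm_num), ← Complex.ofReal_log (by positivity), Real.log_pow,
        show ((n * Real.log 2 : ℝ) : ℂ) * (1 - s) =
          ((n * Real.log 2 : ℝ) : ℂ) + -s * (n * Real.log 2 : ℝ) by ring, Complex.exp_add,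
        ← Real.log_pow, ← Complex.ofReal_exp, Real.exp_log (by positivity)]
      norm_num
    have h3 := one_sub_mul_tsum_eq_neg_sum_tsum hsm (c := cexp (-s * (n * Real.log 2 : ℝ)))
      fun a => by
        have : X ((2 : ℤ) • a) = (2 : ℝ) • X a := by
          simp only [hX, Finset.smul_sum, Pi.smul_apply, smul_eq_mul, Int.cast_mul, mul_smul]
          norm_num
        change g s (X _) = _ * g s (X a)
        rw [this]
        exact mul_exp_neg_mul_log_smul hφ hφ0 hν hc s two_pos (X a)
    rw [h2]
    refine h3.trans ?_
    rw [neg_inj]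
    refine Finset.sum_congr rfl fun S hS => ?_
    have hj := hj₀ S (Finset.ne_of_mem_erase hS)
    rw [tsum_mul_eq_tsum_mul_fwdDiff_iter (e := Pi.single (j₀ S) 1)
      (χ := fun a => ∏ i ∈ S, (-1 : ℂ) ^ a i) (prod_neg_one_zpow_add_single hj)
      (fun a => (norm_prod_neg_one_zpow S a).le) hsm n]
    congr 1
    exact tsum_congr fun a => by rw [← hshift]

/-- A smooth nonnegative function supported on `[-1, 1]` whose integer translates sum to `1`. -/
noncomputable def unitBump (y : ℝ) : ℝ := Real.smoothTransition (y + 1) - Real.smoothTransition y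

theorem unitBump_nonneg (y : ℝ) : 0 ≤ unitBump y :=
  sub_nonneg.mpr (Real.smoothTransition.monotone (by linarith))

theorem contDiff_unitBump : ContDiff ℝ ∞ unitBump :=
  (Real.smoothTransition.contDiff.comp (contDiff_id.add contDiff_const)).sub
    Real.smoothTransition.contDiff

theorem unitBump_eq_zero {y : ℝ} (hy : 1 ≤ |y|) : unitBump y = 0 := by
  rw [unitBump]
  rcases le_abs.mp hy with h | h
  · rw [Real.smoothTransition.one_of_one_le h, Real.smoothTransition.one_of_one_le (by linarith),
      sub_self]
  · rw [Real.smoothTransition.zero_of_nonpos (by linarith),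
      Real.smoothTransition.zero_of_nonpos (by linarith), sub_self]

theorem unitBump_fract_add (y : ℝ) : unitBump (y + (-⌊y⌋ - 1 : ℤ)) + unitBump (y + (-⌊y⌋ : ℤ)) = 1 := by
  have h0 := Int.fract_nonneg y
  have h1 := (Int.fract_lt_one y).le
  have e1 : y + ((-⌊y⌋ - 1 : ℤ) : ℝ) = Int.fract y - 1 := by
    push_cast
    rw [Int.fract]
    ring
  have e2 : y + ((-⌊y⌋ : ℤ) : ℝ) = Int.fract y := by
    push_cast
    rw [Int.fract]
    ring
  rw [e1, e2, unitBump, unitBump, sub_add_cancel,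
    Real.smoothTransition.zero_of_nonpos (x := Int.fract y - 1) (by linarith),
    Real.smoothTransition.one_of_one_le (x := Int.fract y + 1) (by linarith)]
  ring

theorem hasSum_prod_unitBump {ι : Type*} [Fintype ι] (y : ι → ℝ) :
    HasSum (fun k : ι → ℤ => ∏ i, unitBump (k i + y i)) 1 := by
  classical
  have h1 : ∑ k ∈ Fintype.piFinset fun i => ({-⌊y i⌋ - 1, -⌊y i⌋} : Finset ℤ),
      ∏ i, unitBump (k i + y i) = 1 := by
    rw [← Finset.prod_univ_sum (fun i => ({-⌊y i⌋ - 1, -⌊y i⌋} : Finset ℤ))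
      (fun i (k : ℤ) => unitBump (k + y i))]
    refine Finset.prod_eq_one fun i _ => ?_
    rw [Finset.sum_pair (by lia)]
    rw [← unitBump_fract_add (y i), add_comm (y i), add_comm (y i)]
  have h2 : HasSum _ _ := hasSum_sum_of_ne_finset_zero (L := .unconditional _) (f := fun k : ι → ℤ => ∏ i, unitBump (k i + y i))
    (s := Fintype.piFinset fun i => ({-⌊y i⌋ - 1, -⌊y i⌋} : Finset ℤ)) (fun k hk => by
      rw [Fintype.mem_piFinset] at hk
      push Not at hk
      obtain ⟨i, hi⟩ := hk
      refine Finset.prod_eq_zero (Finset.mem_univ i) (unitBump_eq_zero ?_)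
      rw [Finset.mem_insert, Finset.mem_singleton] at hi
      push Not at hi
      have hf0 := Int.floor_le (y i)
      have hf1 := Int.lt_floor_add_one (y i)
      rw [le_abs]
      rcases lt_or_ge (k i) (-⌊y i⌋ - 1) with h | h
      · right
        have h : k i ≤ -⌊y i⌋ - 1 - 1 := by lia
        have h : (k i : ℝ) ≤ -⌊y i⌋ - 1 - 1 := by exact_mod_cast h
        linarith
      · left
        have h : -⌊y i⌋ + 1 ≤ k i := by lia
        have h : -(⌊y i⌋ : ℝ) + 1 ≤ k i := by exact_mod_cast h
        linarith)
  rwa [h1] at h2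

theorem hasSum_prod_snd {T A : Type*} [Finite T] {g : A → ℝ} {c : ℝ} (hg : HasSum g c)
    (hg0 : ∀ a, 0 ≤ g a) : HasSum (fun p : T × A => g p.2) (Nat.card T * c) := by
  have := Fintype.ofFinite T
  have h1 : HasSum (fun _ : T => (1 : ℝ)) (Nat.card T) := by
    simpa using hasSum_fintype fun _ : T => (1 : ℝ)
  have h2 := h1.mul hg (h1.summable.mul_of_nonneg hg.summable (fun _ => zero_le_one) hg0)
  simpa using h2

section LogCutoff

open NumberField.InfinitePlace NumberField.Units NumberField.Units.dirichletUnitTheorem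
  NumberField.mixedEmbedding Module
open scoped Classical

variable (K : Type*) [Field K] [NumberField K]

/-- A smooth cutoff on the mixed space whose translates by the units sum to a constant. -/
noncomputable def logCutoff (x : mixedSpace K) : ℝ :=
  if mixedEmbedding.norm x = 0 then 0 else
    ∏ i, unitBump (((basisUnitLattice K).ofZLatticeBasis ℝ (unitLattice K)).repr (logMap x) i)

theorem logCutoff_zero : logCutoff K 0 = 0 := by simp [logCutoff]

theorem logCutoff_nonneg (x : mixedSpace K) : 0 ≤ logCutoff K x := by
  rw [logCutoff]
  split_ifs
  · exact le_rfl
  · exact Finset.prod_nonneg fun i _ => unitBump_nonneg _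

theorem logCutoff_smul {t : ℝ} (ht : 0 < t) (x : mixedSpace K) :
    logCutoff K (t • x) = logCutoff K x := by
  by_cases hx : mixedEmbedding.norm x = 0
  · simp [logCutoff, mixedEmbedding.norm_smul, hx]
  · rw [logCutoff, logCutoff, if_neg hx, if_neg, logMap_real_smul hx ht.ne']
    rw [mixedEmbedding.norm_smul]
    exact mul_ne_zero (pow_ne_zero _ (abs_ne_zero.mpr ht.ne')) hx

theorem hasSum_logCutoff_unit_smul {x : mixedSpace K} (hx : mixedEmbedding.norm x ≠ 0) :
    HasSum (fun u : (𝓞 K)ˣ => logCutoff K (u • x)) (torsionOrder K) := by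
  set B := (basisUnitLattice K).ofZLatticeBasis ℝ (unitLattice K) with hB
  let e : torsion K × (Fin (rank K) → ℤ) ≃ (𝓞 K)ˣ :=
    Equiv.ofBijective (fun p => p.1 * ∏ i, fundSystem K i ^ p.2 i) <| by
      rw [Function.bijective_iff_existsUnique]
      intro u
      simpa only [eq_comm] using exist_unique_eq_mul_prod K u
  have hval : ∀ p, logCutoff K (e p • x) =
      ∏ i, unitBump (p.2 i + B.repr (logMap x) i) := by
    intro p
    rw [logCutoff, if_neg (by rwa [norm_unit_smul]), ← hB]
    refine Finset.prod_congr rfl fun i _ => ?_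
    rw [logMap_unit_smul _ hx, map_add, Finsupp.add_apply]
    congr 2
    have h1 : logEmbedding K (Additive.ofMul (e p)) = ∑ j, (p.2 j : ℝ) • B j := by
      change logEmbedding K (Additive.ofMul ((p.1 : (𝓞 K)ˣ) * ∏ i, fundSystem K i ^ p.2 i)) = _
      rw [ofMul_mul, map_add, logEmbedding_eq_zero_iff.mpr p.1.2, zero_add, ofMul_prod, map_sum]
      refine Finset.sum_congr rfl fun j _ => ?_
      rw [ofMul_zpow, map_zsmul, logEmbedding_fundSystem, hB, Basis.ofZLatticeBasis_apply,
        Int.cast_smul_eq_zsmul]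
    rw [h1, B.repr_sum_self]
  rw [← e.hasSum_iff]
  have h2 := hasSum_prod_snd (T := torsion K)
    (hasSum_prod_unitBump fun i => B.repr (logMap x) i)
    fun _ => Finset.prod_nonneg fun i _ => unitBump_nonneg _
  rw [mul_one] at h2
  exact h2.congr_fun hval

theorem contDiffAt_normAtPlace {w : InfinitePlace K} {x : mixedSpace K}
    (hx : normAtPlace w x ≠ 0) : ContDiffAt ℝ ∞ (normAtPlace w) x := by
  by_cases hw : IsReal w
  · have h1 : (normAtPlace w : mixedSpace K → ℝ) = fun x => ‖x.1 ⟨w, hw⟩‖ :=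
      funext fun x => normAtPlace_apply_of_isReal hw x
    rw [normAtPlace_apply_of_isReal hw, norm_ne_zero_iff] at hx
    rw [h1]
    refine ContDiffAt.norm ℝ ?_ hx
    fun_prop
  · have hw := not_isReal_iff_isComplex.mp hw
    have h1 : (normAtPlace w : mixedSpace K → ℝ) = fun x => ‖x.2 ⟨w, hw⟩‖ :=
      funext fun x => normAtPlace_apply_of_isComplex hw x
    rw [normAtPlace_apply_of_isComplex hw, norm_ne_zero_iff] at hx
    rw [h1]
    refine ContDiffAt.norm ℝ ?_ hx
    fun_prop

theorem contDiffAt_mixedEmbedding_norm {x : mixedSpace K} (hx : mixedEmbedding.norm x ≠ 0) :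
    ContDiffAt ℝ ∞ (mixedEmbedding.norm : mixedSpace K → ℝ) x := by
  have h : (mixedEmbedding.norm : mixedSpace K → ℝ) = fun x => ∏ w, normAtPlace w x ^ mult w :=
    funext fun x => mixedEmbedding.norm_apply x
  rw [h]
  exact contDiffAt_prod fun w _ =>
    (contDiffAt_normAtPlace K (mixedEmbedding.norm_ne_zero_iff.mp hx w)).pow _

theorem contDiffAt_logCutoff {x : mixedSpace K} (hx : mixedEmbedding.norm x ≠ 0) :
    ContDiffAt ℝ ∞ (logCutoff K) x := by
  set B := (basisUnitLattice K).ofZLatticeBasis ℝ (unitLattice K) with hB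
  have h1 : logCutoff K =ᶠ[𝓝 x] fun x => ∏ i, unitBump (B.repr (logMap x) i) := by
    filter_upwards [(mixedEmbedding.continuous_norm K).continuousAt.eventually_ne hx] with y hy
    rw [logCutoff, if_neg hy]
  refine ContDiffAt.congr_of_eventuallyEq ?_ h1
  have hlog : ContDiffAt ℝ ∞ (logMap : mixedSpace K → logSpace K) x := by
    rw [contDiffAt_pi]
    intro w
    have hw := mixedEmbedding.norm_ne_zero_iff.mp hx w.1
    exact contDiffAt_const.mul (((contDiffAt_normAtPlace K hw).log hw).sub
      (((contDiffAt_mixedEmbedding_norm K hx).log hx).mul contDiffAt_const))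
  refine contDiffAt_prod fun i _ => ?_
  have hcoord : ContDiff ℝ ∞ fun y : logSpace K => B.repr y i :=
    (LinearMap.toContinuousLinearMap (B.coord i)).contDiff
  exact contDiff_unitBump.contDiffAt.comp x (hcoord.contDiffAt.comp x hlog)

theorem exists_norm_pow_le_of_logCutoff_ne_zero :
    ∃ C : ℝ, ∀ x : mixedSpace K, logCutoff K x ≠ 0 →
      ‖x‖ ^ finrank ℚ K ≤ C * mixedEmbedding.norm x := by
  set B := (basisUnitLattice K).ofZLatticeBasis ℝ (unitLattice K) with hB
  set n := finrank ℚ K with hn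
  have hn0 : (0 : ℝ) < n := by exact_mod_cast finrank_pos
  obtain ⟨R, hR⟩ : ∃ R : ℝ, ∀ y : logSpace K, (∀ i, |B.repr y i| ≤ 1) → ‖y‖ ≤ R := by
    refine ⟨∑ i, ‖B i‖, fun y hy => ?_⟩
    rw [← B.sum_repr y]
    refine norm_sum_le_of_le _ fun i _ => ?_
    rw [_root_.norm_smul]
    exact mul_le_of_le_one_left (norm_nonneg _) (hy i)
  have hR0 : 0 ≤ R := by simpa using hR 0 (by simp)
  set m : ℝ := (Fintype.card {w : InfinitePlace K // w ≠ w₀} : ℝ) with hm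
  have hm0 : 0 ≤ m := Nat.cast_nonneg _
  set R' : ℝ := (m + 1) * R with hR'
  refine ⟨Real.exp (n * R'), fun x hx => ?_⟩
  have hN : mixedEmbedding.norm x ≠ 0 := fun h => hx (by rw [logCutoff, if_pos h])
  have hN0 : 0 < mixedEmbedding.norm x := lt_of_le_of_ne (mixedEmbedding.norm_nonneg x) hN.symm
  rw [logCutoff, if_neg hN, Finset.prod_ne_zero_iff] at hx
  have hlog : ‖logMap x‖ ≤ R := hR _ fun i => by
    by_contra! h
    exact hx i (Finset.mem_univ i) (unitBump_eq_zero h.le)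
  set l := Real.log (mixedEmbedding.norm x) with hl
  have hnp : ∀ w, 0 < normAtPlace w x := fun w =>
    lt_of_le_of_ne (normAtPlace_nonneg w x) (mixedEmbedding.norm_ne_zero_iff.mp hN w).symm
  have hbd : ∀ w : {w : InfinitePlace K // w ≠ w₀},
      |mult w.1 * (Real.log (normAtPlace w.1 x) - l * (n : ℝ)⁻¹)| ≤ R := fun w =>
    (norm_le_pi_norm (logMap x) w).trans hlog
  have hsum : ∑ w : InfinitePlace K, (mult w : ℝ) * (Real.log (normAtPlace w x) - l * (n : ℝ)⁻¹) =
      0 := by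
    simp_rw [mul_sub, Finset.sum_sub_distrib, ← Finset.sum_mul]
    rw [← Nat.cast_sum, sum_mult_eq, ← hn, hl, mixedEmbedding.norm_apply,
      Real.log_prod fun w _ => (pow_pos (hnp w) _).ne']
    simp_rw [Real.log_pow]
    field_simp
    ring
  have hw : ∀ w : InfinitePlace K, Real.log (normAtPlace w x) - l * (n : ℝ)⁻¹ ≤ R' := by
    intro w
    have hle : (mult w : ℝ) * (Real.log (normAtPlace w x) - l * (n : ℝ)⁻¹) ≤ R' := by
      by_cases hw : w = w₀
      · have h1 := Fintype.sum_eq_add_sum_subtype_ne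
          (fun w : InfinitePlace K => (mult w : ℝ) * (Real.log (normAtPlace w x) - l * (n : ℝ)⁻¹)) w₀
        rw [hsum] at h1
        have h2 : |∑ w : {w : InfinitePlace K // w ≠ w₀},
            (mult w.1 : ℝ) * (Real.log (normAtPlace w.1 x) - l * (n : ℝ)⁻¹)| ≤ m * R := by
          refine (Finset.abs_sum_le_sum_abs _ _).trans ((Finset.sum_le_card_nsmul _ _ R
            fun w _ => hbd w).trans ?_)
          rw [nsmul_eq_mul, Finset.card_univ]
        have h3 := neg_le_of_abs_le h2
        rw [hw, hR']
        linarith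
      · have h1 := (le_abs_self _).trans (hbd ⟨w, hw⟩)
        rw [hR']
        nlinarith
    have h1 : (1 : ℝ) ≤ mult w := by exact_mod_cast mult_pos
    by_contra! h
    have hR'0 : 0 ≤ R' := by positivity
    nlinarith
  have hnorm : ‖x‖ ≤ Real.exp (R' + l * (n : ℝ)⁻¹) := by
    rw [norm_eq_sup'_normAtPlace, Finset.sup'_le_iff]
    intro w _
    rw [← Real.log_le_iff_le_exp (hnp w)]
    linarith [hw w]
  calc ‖x‖ ^ n ≤ Real.exp (R' + l * (n : ℝ)⁻¹) ^ n := by gcongr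
    _ = Real.exp (n * R') * mixedEmbedding.norm x := by
      rw [← Real.exp_nat_mul, mul_add, Real.exp_add, mul_comm l, mul_inv_cancel_left₀ hn0.ne', hl,
        Real.exp_log hN0]

end LogCutoff

theorem hasSum_mul_of_nonneg_left {A U : Type*} {p : A → U → ℝ} (hp : ∀ a u, 0 ≤ p a u) {w : ℝ}
    (hw : ∀ a, HasSum (p a) w) {d : A → ℂ} {D : ℂ} (hd : HasSum d D) :
    HasSum (fun x : A × U => (p x.1 x.2 : ℂ) * d x.1) (w * D) := by
  have hnorm : ∀ a u, ‖(p a u : ℂ) * d a‖ = p a u * ‖d a‖ := fun a u => by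
    rw [norm_mul, Complex.norm_real, Real.norm_of_nonneg (hp a u)]
  have hs : Summable fun x : A × U => (p x.1 x.2 : ℂ) * d x.1 := by
    refine Summable.of_norm ?_
    rw [summable_prod_of_nonneg fun x => norm_nonneg _]
    simp only [hnorm]
    refine ⟨fun a => (hw a).summable.mul_right _, ?_⟩
    simp only [tsum_mul_right, (hw _).tsum_eq]
    exact hd.summable.norm.mul_left w
  have h1 := hs.hasSum.prod_fiberwise fun a =>
    ((hasSum_ofReal.mpr (hw a)).mul_right (d a) : HasSum (fun u => (p a u : ℂ) * d a) _)
  rw [← h1.unique (hd.mul_left (w : ℂ))]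
  exact hs.hasSum

section LatticeSum

open NumberField.InfinitePlace NumberField.Units NumberField.mixedEmbedding Module
open scoped Classical nonZeroDivisors

variable (K : Type*) [Field K] [NumberField K]

theorem hasSum_lattice_of_hasSum_ideal (J : (Ideal (𝓞 K))⁰) {F : mixedSpace K → ℂ} (hF : F 0 = 0)
    {c : ℂ} (h : HasSum (fun α : {α : 𝓞 K // α ∈ J.1 ∧ α ≠ 0} =>
      F (mixedEmbedding K (α.1 : K))) c) :
    HasSum (fun a : Free.ChooseBasisIndex ℤ (FractionalIdeal.mk0 K J) → ℤ =>
      F (∑ i, (a i : ℝ) • fractionalIdealLatticeBasis K (FractionalIdeal.mk0 K J) i)) c := by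
  set b := fractionalIdealLatticeBasis K (FractionalIdeal.mk0 K J) with hb
  have hmem : ∀ x : mixedSpace K, x ∈ Submodule.span ℤ (Set.range b) ↔
      ∃ α : 𝓞 K, α ∈ J.1 ∧ mixedEmbedding K (α : K) = x := by
    intro x
    rw [mem_span_fractionalIdealLatticeBasis]
    constructor
    · rintro ⟨y, hy, rfl⟩
      rw [FractionalIdeal.coe_mk0, SetLike.mem_coe, FractionalIdeal.mem_coeIdeal] at hy
      obtain ⟨α, hα, rfl⟩ := hy
      exact ⟨α, hα, rfl⟩
    · rintro ⟨α, hα, rfl⟩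
      refine ⟨_, ?_, rfl⟩
      rw [FractionalIdeal.coe_mk0, SetLike.mem_coe, FractionalIdeal.mem_coeIdeal]
      exact ⟨α, hα, rfl⟩
  have hexists : ∀ α : {α : 𝓞 K // α ∈ J.1 ∧ α ≠ 0}, ∃ a : _ → ℤ,
      ∑ i, (a i : ℝ) • b i = mixedEmbedding K (α.1 : K) := by
    intro α
    have := (hmem (mixedEmbedding K (α.1 : K))).mpr ⟨α.1, α.2.1, rfl⟩
    rw [Submodule.mem_span_range_iff_exists_fun] at this
    simpa only [Int.cast_smul_eq_zsmul] using this
  choose T hT using hexists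
  have hinj : ∀ a c : _ → ℤ, ∑ i, (a i : ℝ) • b i = ∑ i, (c i : ℝ) • b i → a = c := by
    intro a c hac
    funext i
    have h2 := congrArg (fun x => b.equivFun x i) hac
    simp only [← b.equivFun_symm_apply fun i => (a i : ℝ),
      ← b.equivFun_symm_apply fun i => (c i : ℝ), LinearEquiv.apply_symm_apply] at h2
    exact_mod_cast h2
  have hTinj : Function.Injective T := by
    intro α α' hαα'
    have h1 := hT α
    rw [hαα', hT α'] at h1
    exact Subtype.ext (RingOfIntegers.ext (mixedEmbedding_injective K h1)).symm
  rw [← hTinj.hasSum_iff]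
  · simpa only [Function.comp_def, hT] using h
  · intro a ha
    obtain ⟨α, hα, hαa⟩ := (hmem (∑ i, (a i : ℝ) • b i)).mp
      (Submodule.sum_mem _ fun i _ => by
        rw [Int.cast_smul_eq_zsmul]
        exact Submodule.smul_mem _ _ (Submodule.subset_span ⟨i, rfl⟩))
    by_cases h0 : α = 0
    · rw [← hαa, h0]
      simpa using hF
    · exact absurd ⟨⟨α, hα, h0⟩, hinj _ _ ((hT _).trans hαa)⟩ ha

theorem norm_mixedEmbedding_eq_absNorm_span (α : 𝓞 K) :
    mixedEmbedding.norm (mixedEmbedding K (α : K)) = (Ideal.absNorm (Ideal.span {α}) : ℝ) := by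
  rw [norm_eq_norm, Ideal.absNorm_span_singleton, ← Algebra.coe_norm_int, Nat.cast_natAbs]
  push_cast
  rfl

theorem exp_neg_mul_log_natCast (s : ℂ) {N : ℕ} (hN : N ≠ 0) :
    cexp (-s * Real.log N) = (N : ℂ) ^ (-s) := by
  rw [cpow_def_of_ne_zero (by exact_mod_cast hN), ← Complex.natCast_log, mul_comm]

theorem hasSum_logCutoff_lattice (J : (Ideal (𝓞 K))⁰) {s D : ℂ}
    (hD : HasSum (fun I : {I : {I : Ideal (𝓞 K) // I ≠ ⊥} // (I.1 * J.1).IsPrincipal} =>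
      ((Ideal.absNorm I.1.1 : ℕ) : ℂ) ^ (-s)) D) :
    HasSum (fun a : Free.ChooseBasisIndex ℤ (FractionalIdeal.mk0 K J) → ℤ =>
      (logCutoff K (∑ i, (a i : ℝ) •
        fractionalIdealLatticeBasis K (FractionalIdeal.mk0 K J) i) : ℂ) *
      cexp (-s * Real.log (mixedEmbedding.norm (∑ i, (a i : ℝ) •
        fractionalIdealLatticeBasis K (FractionalIdeal.mk0 K J) i))))
      (torsionOrder K * (D * ((Ideal.absNorm J.1 : ℕ) : ℂ) ^ (-s))) := by
  refine hasSum_lattice_of_hasSum_ideal K J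
    (F := fun x => (logCutoff K x : ℂ) * cexp (-s * Real.log (mixedEmbedding.norm x)))
    (by simp [logCutoff_zero]) ?_
  have hJ : J.1 ≠ ⊥ := nonZeroDivisors.ne_zero J.2
  choose g hg using fun I : {I : {I : Ideal (𝓞 K) // I ≠ ⊥} // (I.1 * J.1).IsPrincipal} => I.2.principal
  have hg : ∀ I, I.1.1 * J.1 = Ideal.span {g I} := hg
  have hg0 : ∀ I, g I ≠ 0 := fun I h => by
    have h1 := hg I
    rw [h, Ideal.span_singleton_eq_bot.mpr rfl, Ideal.mul_eq_bot] at h1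
    exact h1.elim I.1.2 hJ
  let f : {I : {I : Ideal (𝓞 K) // I ≠ ⊥} // (I.1 * J.1).IsPrincipal} × (𝓞 K)ˣ →
      {α : 𝓞 K // α ∈ J.1 ∧ α ≠ 0} := fun p => ⟨p.2 * g p.1,
    Ideal.mul_mem_left _ _ (Ideal.mul_le_right (I := p.1.1.1) (by
      rw [hg]
      exact Ideal.mem_span_singleton_self _)), mul_ne_zero (Units.ne_zero _) (hg0 _)⟩
  have hspan : ∀ p, Ideal.span {(f p).1} = p.1.1.1 * J.1 := fun p => by
    rw [hg]
    exact Ideal.span_singleton_mul_left_unit p.2.isUnit _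
  have hf : Function.Bijective f := by
    constructor
    · rintro ⟨I, u⟩ ⟨I', u'⟩ h
      have h1 : I.1.1 * J.1 = I'.1.1 * J.1 := by rw [← hspan (I, u), ← hspan (I', u'), h]
      have h2 : I = I' := Subtype.ext (Subtype.ext (mul_right_cancel₀ hJ h1))
      subst h2
      have h3 : (u : 𝓞 K) * g I = u' * g I := congrArg Subtype.val h
      rw [Units.ext (mul_right_cancel₀ (hg0 I) h3)]
    · rintro ⟨α, hα, hα0⟩
      have h1 : Ideal.span {α} ≤ J.1 := (Ideal.span_singleton_le_iff_mem _).mpr hα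
      obtain ⟨I, hI⟩ := Ideal.dvd_iff_le.mpr h1
      rw [mul_comm] at hI
      have hI0 : I ≠ ⊥ := fun h => by
        rw [h, Ideal.bot_mul, Ideal.span_singleton_eq_bot] at hI
        exact hα0 hI
      let I' : {I : {I : Ideal (𝓞 K) // I ≠ ⊥} // (I.1 * J.1).IsPrincipal} :=
        ⟨⟨I, hI0⟩, ⟨⟨α, hI.symm⟩⟩⟩
      have h2 : Ideal.span {g I'} = Ideal.span {α} := by rw [← hg, hI]
      obtain ⟨u, hu⟩ := Ideal.span_singleton_eq_span_singleton.mp h2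
      exact ⟨(I', u), Subtype.ext ((mul_comm _ _).trans hu)⟩
  rw [← (Equiv.ofBijective f hf).hasSum_iff]
  have hne : ∀ I, mixedEmbedding.norm (mixedEmbedding K (g I : K)) ≠ 0 := fun I => by
    rw [norm_mixedEmbedding_eq_absNorm_span, Nat.cast_ne_zero, Ne, Ideal.absNorm_eq_zero_iff,
      Ideal.span_singleton_eq_bot]
    exact hg0 I
  have key := hasSum_mul_of_nonneg_left
    (p := fun I (u : (𝓞 K)ˣ) => logCutoff K (u • mixedEmbedding K (g I : K)))
    (fun I u => logCutoff_nonneg K _) (fun I => hasSum_logCutoff_unit_smul K (hne I))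
    (hD.mul_right (((Ideal.absNorm J.1 : ℕ) : ℂ) ^ (-s)))
  rw [ofReal_natCast] at key
  refine key.congr_fun fun p => ?_
  simp only [Function.comp_apply, Equiv.ofBijective_apply]
  congr 1
  · simp [f, unitSMul_smul]
  · rw [norm_mixedEmbedding_eq_absNorm_span, hspan, exp_neg_mul_log_natCast, map_mul,
      Nat.cast_mul, natCast_mul_natCast_cpow]
    rw [Ne, Ideal.absNorm_eq_zero_iff, Ideal.mul_eq_bot]
    exact fun h => h.elim p.1.1.2 hJ

end LatticeSum

section ZetaGrowth

open NumberField.InfinitePlace NumberField.Units NumberField.mixedEmbedding Module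
open scoped Classical nonZeroDivisors

variable (K : Type*) [Field K] [NumberField K]

theorem exists_one_sub_mul_partialZeta_eq (J : (Ideal (𝓞 K))⁰) :
    ∃ V : ℂ → ℂ, ∃ C : ℝ, 0 ≤ C ∧
      (∀ s : ℂ, 1 / 2 < s.re → s.re < 3 → DifferentiableAt ℂ V s ∧
        ‖V s‖ ≤ C * (1 + ‖s‖) ^ finrank ℚ K) ∧
      ∀ s D : ℂ, 1 / 2 < s.re → s.re < 3 →
        HasSum (fun I : {I : {I : Ideal (𝓞 K) // I ≠ ⊥} // (I.1 * J.1).IsPrincipal} =>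
          ((Ideal.absNorm I.1.1 : ℕ) : ℂ) ^ (-s)) D →
        (1 - (2 ^ finrank ℚ K : ℝ) ^ (1 - s)) * (torsionOrder K * D) = V s := by
  have hcard : Fintype.card (Free.ChooseBasisIndex ℤ (FractionalIdeal.mk0 K J)) = finrank ℚ K := by
    rw [← finrank_eq_card_chooseBasisIndex, fractionalIdeal_rank, RingOfIntegers.rank]
  have : Nonempty (Free.ChooseBasisIndex ℤ (FractionalIdeal.mk0 K J)) := by
    rw [← Fintype.card_pos_iff, hcard]
    exact finrank_pos
  obtain ⟨C₀, hC₀⟩ := exists_norm_pow_le_of_logCutoff_ne_zero K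
  obtain ⟨V, C, hC, hV, hVs⟩ := exists_one_sub_mul_tsum_eq
    (fractionalIdealLatticeBasis K (FractionalIdeal.mk0 K J)) (φ := logCutoff K)
    (ν := mixedEmbedding.norm) (C := C₀) (fun t ht x => logCutoff_smul K ht x) (logCutoff_zero K)
    (fun t ht x => by rw [mixedEmbedding.norm_smul, abs_of_pos ht, hcard])
    (mixedEmbedding.continuous_norm K) (by rw [hcard]; exact hC₀)
    (fun x hx => contDiffAt_logCutoff K hx) (fun x hx => contDiffAt_mixedEmbedding_norm K hx)
  rw [hcard] at hV hVs
  have hJ : Ideal.absNorm J.1 ≠ 0 := by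
    rw [Ne, Ideal.absNorm_eq_zero_iff]
    exact nonZeroDivisors.ne_zero J.2
  have hJ0 : ((Ideal.absNorm J.1 : ℕ) : ℂ) ≠ 0 := Nat.cast_ne_zero.mpr hJ
  have hJ1 : (1 : ℝ) ≤ (Ideal.absNorm J.1 : ℕ) := by exact_mod_cast Nat.one_le_iff_ne_zero.mpr hJ
  refine ⟨fun s => ((Ideal.absNorm J.1 : ℕ) : ℂ) ^ s * V s,
    ((Ideal.absNorm J.1 : ℕ) : ℝ) ^ (3 : ℝ) * C, by positivity, fun s h1 h3 => ⟨?_, ?_⟩,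
    fun s D h1 h3 hD => ?_⟩
  · exact (differentiableAt_id.const_cpow (Or.inl hJ0)).mul (hV s h1 h3).1
  · rw [norm_mul, norm_natCast_cpow_of_pos (Nat.pos_of_ne_zero hJ), mul_assoc]
    have := (hV s h1 h3).2
    gcongr
  · have h := hasSum_logCutoff_lattice K J hD
    have h4 := hVs s h1 h3 h.summable
    rw [h.tsum_eq] at h4
    change _ = _ ^ s * V s
    rw [← h4, cpow_neg]
    have : ((Ideal.absNorm J.1 : ℕ) : ℂ) ^ s ≠ 0 := by simp [cpow_eq_zero_iff, hJ0]
    field_simp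

theorem hasSum_classGroup_of_hasSum_ideal {J : ClassGroup (𝓞 K) → (Ideal (𝓞 K))⁰}
    (hJ : ∀ c, ClassGroup.mk0 (J c) = c⁻¹) {f : {I : Ideal (𝓞 K) // I ≠ ⊥} → ℂ} {Z : ℂ}
    (hf : HasSum f Z) :
    ∃ D : ClassGroup (𝓞 K) → ℂ, (∀ c, HasSum (fun I : {I : {I : Ideal (𝓞 K) // I ≠ ⊥} //
      (I.1 * (J c).1).IsPrincipal} => f I.1) (D c)) ∧ ∑ c, D c = Z := by
  let cls : {I : Ideal (𝓞 K) // I ≠ ⊥} → ClassGroup (𝓞 K) := fun I =>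
    ClassGroup.mk0 ⟨I.1, mem_nonZeroDivisors_of_ne_zero I.2⟩
  have hcls : ∀ c, {I : {I : Ideal (𝓞 K) // I ≠ ⊥} | (I.1 * (J c).1).IsPrincipal} =
      cls ⁻¹' {c} := by
    intro c
    ext I
    have h := ClassGroup.mk0_eq_one_iff
      ((⟨I.1, mem_nonZeroDivisors_of_ne_zero I.2⟩ * J c : (Ideal (𝓞 K))⁰)).2
    rw [Subtype.coe_eta, map_mul, hJ, mul_inv_eq_one] at h
    exact h.symm
  refine ⟨fun c => ∑' I : {I : {I : Ideal (𝓞 K) // I ≠ ⊥} //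
      (I.1 * (J c).1).IsPrincipal}, f I.1,
    fun c => (hf.summable.subtype {I | (I.1 * (J c).1).IsPrincipal}).hasSum, ?_⟩
  have h := hf.tsum_fiberwise cls
  refine (hasSum_fintype _).unique (h.congr_fun fun c => ?_)
  exact (tsum_congr_set_coe f (hcls c))

theorem exists_norm_one_sub_mul_le {ζK G : ℂ → ℂ}
    (hζ_ser : ∀ s : ℂ, 1 < s.re → HasSum (fun I : {I : Ideal (𝓞 K) // I ≠ ⊥} =>
      ((Ideal.absNorm I.1 : ℕ) : ℂ) ^ (-s)) (ζK s))
    (hG : Differentiable ℂ G) (hGζ : ∀ s, s ≠ 1 → G s = (s - 1) * ζK s) :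
    ∃ C : ℝ, 0 ≤ C ∧ ∀ s : ℂ, 1 / 2 < s.re → s.re < 3 →
      ‖1 - ((2 ^ finrank ℚ K : ℝ) : ℂ) ^ (1 - s)‖ * ‖G s‖ ≤
        C * (1 + ‖s‖) ^ (finrank ℚ K + 1) := by
  set q : ℝ := 2 ^ finrank ℚ K with hq
  have hq0 : (q : ℂ) ≠ 0 := by
    rw [hq]
    exact_mod_cast (pow_pos two_pos _).ne'
  choose J hJ using fun c : ClassGroup (𝓞 K) => ClassGroup.mk0_surjective c⁻¹
  choose V C hC hV hVs using fun c => exists_one_sub_mul_partialZeta_eq K (J c)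
  set w : ℂ := (torsionOrder K : ℂ) with hw
  have hw1 : 1 ≤ ‖w‖ := by
    rw [hw, norm_natCast]
    exact_mod_cast Nat.one_le_iff_ne_zero.mpr (torsionOrder_ne_zero K)
  set L : ℂ → ℂ := fun s => w * ((1 - (q : ℂ) ^ (1 - s)) * G s) with hL
  set R : ℂ → ℂ := fun s => (s - 1) * ∑ c, V c s with hR
  set S : Set ℂ := {s | 1 / 2 < s.re ∧ s.re < 3} with hS
  have hSo : IsOpen S := (isOpen_lt continuous_const continuous_re).inter
    (isOpen_lt continuous_re continuous_const)
  have hSc : IsPreconnected S :=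
    ((convex_halfSpace_re_gt _).inter (convex_halfSpace_re_lt _)).isPreconnected
  have hLd : DifferentiableOn ℂ L S := fun s hs => by
    have h : DifferentiableAt ℂ (fun s : ℂ => (q : ℂ) ^ (1 - s)) s :=
      (differentiableAt_id.const_sub 1).const_cpow (Or.inl hq0)
    exact (((h.const_sub 1).mul (hG s)).const_mul w).differentiableWithinAt
  have hRd : DifferentiableOn ℂ R S := fun s hs => by
    have h : DifferentiableAt ℂ (fun s : ℂ => ∑ c, V c s) s :=
      DifferentiableAt.fun_sum fun c _ => (hV c s hs.1 hs.2).1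
    exact ((differentiableAt_id.sub_const 1).mul h).differentiableWithinAt
  have hLR : ∀ s : ℂ, 1 < s.re → s.re < 3 → L s = R s := by
    intro s h1 h3
    have hs1 : s ≠ 1 := by
      rintro rfl
      norm_num at h1
    obtain ⟨D, hD, hDs⟩ := hasSum_classGroup_of_hasSum_ideal K hJ (hζ_ser s h1)
    simp only [hL, hR]
    rw [hGζ s hs1, ← hDs, Finset.sum_congr rfl fun c _ =>
      (hVs c s (D c) (by linarith) h3 (hD c)).symm, ← Finset.mul_sum, ← Finset.mul_sum]
    ring
  have h2 : (2 : ℂ) ∈ S := by constructor <;> norm_num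
  have heq : Set.EqOn L R S :=
    (hLd.analyticOnNhd hSo).eqOn_of_preconnected_of_eventuallyEq (hRd.analyticOnNhd hSo) hSc h2 <| by
      filter_upwards [((isOpen_lt continuous_const continuous_re).inter
        (isOpen_lt continuous_re continuous_const)).mem_nhds
          (show (2 : ℂ) ∈ {s : ℂ | (1 : ℝ) < s.re} ∩ {s : ℂ | s.re < (3 : ℝ)} by
            constructor <;> norm_num)] with s hs
      exact hLR s hs.1 hs.2
  refine ⟨∑ c, C c, Finset.sum_nonneg fun c _ => hC c, fun s h1 h3 => ?_⟩
  calc ‖1 - (q : ℂ) ^ (1 - s)‖ * ‖G s‖ ≤ ‖w‖ * (‖1 - (q : ℂ) ^ (1 - s)‖ * ‖G s‖) :=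
        le_mul_of_one_le_left (by positivity) hw1
    _ = ‖L s‖ := by simp only [hL, norm_mul]
    _ = ‖s - 1‖ * ‖∑ c, V c s‖ := by rw [heq ⟨h1, h3⟩, hR, norm_mul]
    _ ≤ (1 + ‖s‖) * ((∑ c, C c) * (1 + ‖s‖) ^ finrank ℚ K) := by
        gcongr
        · rw [add_comm]
          simpa using norm_sub_le s 1
        · rw [Finset.sum_mul]
          exact norm_sum_le_of_le _ fun c _ => (hV c s h1 h3).2
    _ = (∑ c, C c) * (1 + ‖s‖) ^ (finrank ℚ K + 1) := by ring

end ZetaGrowth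

/-- Under GRH for the Dedekind zeta function `ζK` of the number field `K`, the
function `m_K(x) = ∑_{m ≤ x} b_m/m` satisfies `m_K(x) = O_ε(x^{-1/2+ε})` for every
`ε > 0`.  (The fact that `∑_{m ≥ 1} b_m/m` converges to `0`, which holds for the
Dirichlet coefficients of `1/ζK`, is part of the setting and is recorded as `hsum`.) -/
theorem GRH_implies_mK_bound
    (K : Type*) [Field K] [NumberField K] (ζK : ℂ → ℂ)
    (hζ_an : ∀ s : ℂ, s ≠ 1 → DifferentiableAt ℂ ζK s)
    (hζ_ser : ∀ s : ℂ, 1 < s.re →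
      HasSum (fun I : {I : Ideal (𝓞 K) // I ≠ ⊥} =>
        ((Ideal.absNorm I.1 : ℕ) : ℂ) ^ (-s)) (ζK s))
    (hζ_pole : ∃ A : ℂ, A ≠ 0 ∧
      Tendsto (fun s : ℂ => (s - 1) * ζK s) (𝓝[≠] (1 : ℂ)) (𝓝 A))
    (b : ℕ → ℝ)
    (hb : ∀ s : ℂ, 1 < s.re →
      HasSum (fun m : ℕ => (b m : ℂ) * (m : ℂ) ^ (-s)) (ζK s)⁻¹)
    (hsum : Tendsto (fun x : ℝ => ∑ m ∈ Finset.Icc 1 ⌊x⌋₊, b m / m) atTop (nhds 0))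
    (hGRH : ∀ ρ : ℂ, ζK ρ = 0 → 0 < ρ.re → ρ.re < 1 → ρ.re = 1/2) :
    ∀ ε : ℝ, 0 < ε →
      (fun x : ℝ => ∑ m ∈ Finset.Icc 1 ⌊x⌋₊, b m / m)
        =O[atTop] fun x : ℝ => x ^ (-(1:ℝ)/2 + ε) := by
  obtain ⟨A, hA0, hA⟩ := hζ_pole
  obtain ⟨G, hG, hG1, hGζ⟩ := exists_differentiable_eq_sub_one_mul hζ_an hA
  have hG0 := ne_zero_of_half_lt_re hG (by rwa [hG1]) hGζ hb hsum hGRH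
  have hdiv : ∀ s : ℂ, 1 < s.re → G s / (s - 1) = ζK s ∧ (s - 1) / G s = (ζK s)⁻¹ := by
    intro s hs
    have hs1 : s ≠ 1 := by
      rintro rfl
      norm_num at hs
    have h : G s / (s - 1) = ζK s := by
      rw [hGζ s hs1, mul_div_cancel_left₀ _ (sub_ne_zero.mpr hs1)]
    exact ⟨h, by rw [← h, inv_div]⟩
  have hbd : ∀ δ : ℝ, 0 < δ → ∃ B : ℝ, ∀ s : ℂ, 1 + δ ≤ s.re →
      ‖G s / (s - 1)‖ ≤ B ∧ ‖(s - 1) / G s‖ ≤ B := by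
    intro δ hδ
    obtain ⟨B₁, hB₁⟩ := exists_norm_le_of_hasSum_cpow (F := ζK) (a := fun _ => 1)
      (N := fun I : {I : Ideal (𝓞 K) // I ≠ ⊥} => Ideal.absNorm I.1)
      (fun s hs => by simpa only [one_mul] using hζ_ser s hs) hδ
    obtain ⟨B₂, hB₂⟩ := exists_norm_le_of_hasSum_cpow (F := fun s => (ζK s)⁻¹) hb hδ
    refine ⟨max B₁ B₂, fun s hs => ?_⟩
    obtain ⟨h1, h2⟩ := hdiv s (by linarith)
    rw [h1, h2]
    exact ⟨(hB₁ s hs).trans (le_max_left _ _), (hB₂ s hs).trans (le_max_right _ _)⟩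
  obtain ⟨C, hC, hgrowth⟩ := exists_norm_one_sub_mul_le K hζ_ser hG hGζ
  have hq : (1 : ℝ) < 2 ^ Module.finrank ℚ K :=
    one_lt_pow₀ one_lt_two Module.finrank_pos.ne'
  intro ε hε
  exact isBigO_sum_div_of_inv_bound hG hG0 (fun s hs => (hdiv s hs).2 ▸ hb s hs)
    (fun η ε' hη hε' => exists_norm_sub_one_div_le hG hG0 hq hC hgrowth hbd hη hε') hε
end

section
/- Let r₁, r₂ be non-negative integers, n = r₁ + 2r₂ ≥ 1, r = r₁ + r₂ − 1, and let Z̃_{r₁,r₂}(x) = (1/(2πi)) ∫_{Re s = d} Γ^{r₁}(s/2) Γ^{r₂}(s) x^{−s} ds for some (any) d > 0. Then as x → ∞, |Z̃_{r₁,r₂}(x)| = O_{r₁,r₂}( x^{−r/n} exp(−n (x/2^{r₂})^{2/n}) ). -/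
open Complex Filter

open MeasureTheory Topology

/-- The modulus of `Γ` on a vertical line is at most its value on the real axis. -/
lemma norm_Gamma_le_Gamma_re {σ : ℝ} (hσ : 0 < σ) (t : ℝ) :
    ‖Complex.Gamma (σ + t * I)‖ ≤ Real.Gamma σ := by
  have hre : 0 < ((σ : ℂ) + t * I).re := by simpa using hσ
  rw [Complex.Gamma_eq_integral hre, Complex.GammaIntegral, Real.Gamma_eq_integral hσ]
  refine (norm_integral_le_integral_norm _).trans_eq ?_
  refine setIntegral_congr_fun measurableSet_Ioi fun x hx => ?_
  have hx' : 0 < x := hx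
  simp only [norm_mul, Complex.norm_real, Real.norm_eq_abs, Real.abs_exp]
  rw [Complex.norm_cpow_eq_rpow_re_of_pos hx']
  simp

lemma norm_Gamma_sq_mul_le (k : ℕ) {σ A : ℝ} (hσ : 0 < σ) (hA : σ + k ≤ A) (t : ℝ) :
    ‖Complex.Gamma (σ + t * I)‖ ^ 2 * (1 + (t / A) ^ 2) ^ k ≤ Real.Gamma σ ^ 2 := by
  induction k generalizing σ with
  | zero =>
    have := norm_Gamma_le_Gamma_re hσ t
    simpa using pow_le_pow_left₀ (norm_nonneg _) this 2
  | succ k ih =>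
    push_cast at hA
    have h := ih (σ := σ + 1) (by linarith) (by linarith)
    have hs : (σ : ℂ) + t * I ≠ 0 := fun h0 => by
      have := congrArg Complex.re h0
      simp at this
      exact hσ.ne' this
    have e : ((σ + 1 : ℝ) : ℂ) + t * I = (σ + t * I) + 1 := by push_cast; ring
    have hn : ‖(σ : ℂ) + t * I‖ ^ 2 = σ ^ 2 + t ^ 2 := by
      rw [← Complex.normSq_eq_norm_sq, Complex.normSq_add_mul_I]
    rw [e, Complex.Gamma_add_one _ hs, norm_mul, mul_pow, hn, Real.Gamma_add_one hσ.ne',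
      mul_pow] at h
    have hk : (0 : ℝ) ≤ k := k.cast_nonneg
    have hA0 : 0 < A := by linarith
    have h1 : σ ^ 2 * (1 + (t / A) ^ 2) ≤ σ ^ 2 + t ^ 2 := by
      have : σ * (|t| / A) ≤ |t| := by
        rw [← mul_div_assoc, div_le_iff₀ hA0, mul_comm]
        exact mul_le_mul_of_nonneg_left (by linarith) (abs_nonneg t)
      have := pow_le_pow_left₀ (by positivity) this 2
      rw [mul_pow, div_pow, sq_abs, ← div_pow] at this
      linarith
    refine le_of_mul_le_mul_left ?_ (pow_pos hσ 2)
    refine le_trans ?_ h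
    have h2 : 0 ≤ ‖Complex.Gamma (σ + t * I)‖ ^ 2 * (1 + (t / A) ^ 2) ^ k := by positivity
    have h3 := mul_le_mul_of_nonneg_right h1 h2
    rw [pow_succ _ k]
    linarith

lemma norm_Gamma_mul_le (M : ℕ) {σ A : ℝ} (hσ : 0 < σ) (hA : σ + 2 * M ≤ A) (t : ℝ) :
    ‖Complex.Gamma (σ + t * I)‖ * (1 + M * (t / A) ^ 2) ≤ Real.Gamma σ := by
  have h := norm_Gamma_sq_mul_le (2 * M) hσ (A := A) (by push_cast; linarith) t
  rw [mul_comm 2 M, pow_mul, ← mul_pow] at h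
  have h2 := (pow_le_pow_iff_left₀ (by positivity) (Real.Gamma_pos_of_pos hσ).le two_ne_zero).1 h
  refine le_trans ?_ h2
  gcongr
  exact one_add_mul_le_pow (by nlinarith [sq_nonneg (t / A)]) M

lemma norm_Gamma_prod_mul_le {r₁ r₂ : ℕ} (h : 1 ≤ r₁ + r₂) (M : ℕ) {σ A : ℝ} (hσ : 0 < σ)
    (hA : σ + 4 * M ≤ A) (t : ℝ) :
    ‖Complex.Gamma ((σ + t * I) / 2) ^ r₁ * Complex.Gamma (σ + t * I) ^ r₂‖ *
      (1 + M * (t / A) ^ 2) ≤ Real.Gamma (σ / 2) ^ r₁ * Real.Gamma σ ^ r₂ := by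
  have e : ((σ : ℂ) + t * I) / 2 = ((σ / 2 : ℝ) : ℂ) + ((t / 2 : ℝ) : ℂ) * I := by
    push_cast; ring
  have hM : (0 : ℝ) ≤ M := M.cast_nonneg
  have hA0 : 0 < A := by linarith
  have a0 := norm_Gamma_le_Gamma_re (half_pos hσ) (t / 2)
  have b0 := norm_Gamma_le_Gamma_re hσ t
  have a1 := norm_Gamma_mul_le M (half_pos hσ) (A := A / 2) (by linarith) (t / 2)
  have b1 := norm_Gamma_mul_le M hσ (A := A) (by linarith) t
  rw [div_div_div_cancel_right₀ two_ne_zero] at a1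
  have key : ∀ (k : ℕ) (u v q : ℝ), 0 ≤ u → u ≤ v → u * q ≤ v →
      u ^ (k + 1) * q ≤ v ^ (k + 1) := fun k u v q hu huv h => by
    rw [pow_succ, pow_succ, mul_assoc]
    exact mul_le_mul_of_nonneg (pow_le_pow_left₀ hu huv k) h (pow_nonneg hu k) (hu.trans huv)
  rw [e, norm_mul, norm_pow, norm_pow]
  rcases r₁ with _ | r₁
  · obtain ⟨r₂, rfl⟩ : ∃ k, r₂ = k + 1 := ⟨r₂ - 1, by omega⟩
    simpa only [pow_zero, one_mul] using key r₂ _ _ _ (norm_nonneg _) b0 b1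
  · rw [mul_right_comm]
    have hG := (Real.Gamma_pos_of_pos (half_pos hσ)).le
    exact mul_le_mul (key r₁ _ _ _ (norm_nonneg _) a0 a1)
      (pow_le_pow_left₀ (norm_nonneg _) b0 r₂) (by positivity) (pow_nonneg hG _)

lemma integrable_inv_one_add_div_sq {c : ℝ} (hc : 0 < c) :
    Integrable fun t : ℝ => (1 + (t / c) ^ 2)⁻¹ :=
  integrable_inv_one_add_sq.comp_div hc.ne'

/-- Shifting the line of integration to the right for a function of quadratic decay. -/
lemma integral_vertical_eq_of_decay {f : ℂ → ℂ} {a b c C : ℝ} (hab : a ≤ b)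
    (hc : 0 < c) (hf : DifferentiableOn ℂ f {s | a ≤ s.re})
    (hb : ∀ σ ∈ Set.Icc a b, ∀ t : ℝ, ‖f (σ + t * I)‖ ≤ C * (1 + (t / c) ^ 2)⁻¹) :
    ∫ t : ℝ, f (a + t * I) = ∫ t : ℝ, f (b + t * I) := by
  have hint : ∀ σ ∈ Set.Icc a b, Integrable fun t : ℝ => f (σ + t * I) := fun σ hσ => by
    refine ((integrable_inv_one_add_div_sq hc).const_mul C).mono' ?_ (ae_of_all _ (hb σ hσ))
    have : Continuous fun t : ℝ => f (σ + t * I) :=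
      hf.continuousOn.comp_continuous (by fun_prop) (fun t => by simpa using hσ.1)
    exact this.aestronglyMeasurable
  have hlim : ∀ σ ∈ Set.Icc a b, Tendsto (fun T : ℝ => ∫ t in (-T)..T, f (σ + t * I)) atTop
      (𝓝 (∫ t : ℝ, f (σ + t * I))) := fun σ hσ =>
    intervalIntegral_tendsto_integral (hint σ hσ) tendsto_neg_atTop_atBot tendsto_id
  have hdecay : Tendsto (fun T : ℝ => C * (1 + (T / c) ^ 2)⁻¹ * |b - a|) atTop (𝓝 0) := by
    have h1 : Tendsto (fun T : ℝ => 1 + (T / c) ^ 2) atTop atTop :=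
      tendsto_atTop_add_const_left _ _
        ((tendsto_pow_atTop two_ne_zero).comp (tendsto_id.atTop_div_const hc))
    simpa using (h1.inv_tendsto_atTop.const_mul C).mul_const |b - a|
  have hhor : ∀ T : ℝ, ‖∫ x in a..b, f (x + T * I)‖ ≤ C * (1 + (T / c) ^ 2)⁻¹ * |b - a| := by
    intro T
    refine intervalIntegral.norm_integral_le_of_norm_le_const fun x hx => hb x ?_ T
    rw [Set.uIoc_of_le hab] at hx
    exact ⟨hx.1.le, hx.2⟩
  have hup : Tendsto (fun T : ℝ => ∫ x in a..b, f (x + T * I)) atTop (𝓝 0) :=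
    squeeze_zero_norm hhor hdecay
  have hdown : Tendsto (fun T : ℝ => ∫ x in a..b, f (x + (-T : ℝ) * I)) atTop (𝓝 0) :=
    squeeze_zero_norm (fun T => by simpa [neg_div] using hhor (-T)) hdecay
  have hrect : ∀ T : ℝ, (∫ x in a..b, f (x + (-T : ℝ) * I)) - (∫ x in a..b, f (x + T * I)) +
      I • (∫ t in (-T)..T, f (b + t * I)) - I • (∫ t in (-T)..T, f (a + t * I)) = 0 := by
    intro T
    have := integral_boundary_rect_eq_zero_of_differentiableOn f ⟨a, -T⟩ ⟨b, T⟩ (hf.mono ?_)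
    · simpa using this
    · intro s hs
      have := hs.1
      simp only [Set.mem_preimage, Set.uIcc_of_le hab] at this
      exact this.1
  have hl := ((hdown.sub hup).add ((hlim b ⟨hab, le_rfl⟩).const_smul I)).sub
    ((hlim a ⟨le_rfl, hab⟩).const_smul I)
  have h0 := tendsto_nhds_unique hl (by simpa only [hrect] using tendsto_const_nhds)
  have h1 : I * ((∫ t : ℝ, f (b + t * I)) - ∫ t : ℝ, f (a + t * I)) = 0 := by
    simpa [mul_sub] using h0
  exact (sub_eq_zero.1 ((mul_eq_zero.1 h1).resolve_left I_ne_zero)).symm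

/-- An upper bound of Stirling type for the real Gamma function. -/
lemma exists_Gamma_le_stirling :
    ∃ C : ℝ, 0 < C ∧ ∀ x : ℝ, 1 ≤ x →
      Real.Gamma x ≤ C * (x ^ (x - 1 / 2) * Real.exp (-x)) := by
  set g : ℝ → ℝ := fun x => x ^ (x - 1 / 2) * Real.exp (-x) with hg
  have hgpos : ∀ x : ℝ, 0 < x → 0 < g x := fun x hx => by positivity
  have hcont : ContinuousOn (fun x => Real.Gamma x / g x) (Set.Icc 1 2) := by
    intro x hx
    have hx0 : 0 < x := by linarith [hx.1]
    have h1 : ContinuousAt Real.Gamma x :=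
      (Real.differentiableAt_Gamma fun m => by
        have : (0 : ℝ) ≤ m := m.cast_nonneg
        linarith).continuousAt
    have h2 : ContinuousAt g x := by
      refine ContinuousAt.mul (ContinuousAt.rpow continuousAt_id (by fun_prop) (Or.inl hx0.ne'))
        (by fun_prop)
    exact (h1.div h2 (hgpos x hx0).ne').continuousWithinAt
  obtain ⟨C, hC⟩ := isCompact_Icc.bddAbove_image hcont
  have hbase : ∀ x ∈ Set.Icc (1 : ℝ) 2, Real.Gamma x ≤ max C 1 * g x := fun x hx => by
    have h := hC (Set.mem_image_of_mem _ hx)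
    have hx0 : 0 < x := by linarith [hx.1]
    exact (div_le_iff₀ (hgpos x hx0)).1 (h.trans (le_max_left _ _))
  have hstep : ∀ x : ℝ, 0 < x → x * g x ≤ g (x + 1) := fun x hx => by
    have hx1 : 0 < x + 1 := by linarith
    have hl := Real.le_log_one_add_of_nonneg (x := 1 / x) (by positivity)
    have e1 : 2 * (1 / x) / (1 / x + 2) = 1 / (x + 1 / 2) := by field_simp; ring
    have e2 : Real.log (1 + 1 / x) = Real.log (x + 1) - Real.log x := by
      rw [← Real.log_div hx1.ne' hx.ne']; congr 1; field_simp
    rw [e1, e2, div_le_iff₀ (by linarith)] at hl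
    simp only [hg, Real.rpow_def_of_pos hx, Real.rpow_def_of_pos hx1]
    nth_rewrite 1 [← Real.exp_log hx]
    rw [← Real.exp_add, ← Real.exp_add, ← Real.exp_add]
    apply Real.exp_le_exp.2
    nlinarith
  have hall : ∀ k : ℕ, ∀ x : ℝ, 1 ≤ x → x ≤ k + 2 → Real.Gamma x ≤ max C 1 * g x := by
    intro k
    induction k with
    | zero => exact fun x h1 h2 => hbase x ⟨h1, by simpa using h2⟩
    | succ k ih =>
      intro x h1 h2
      push_cast at h2
      rcases le_total x 2 with h | h
      · exact hbase x ⟨h1, h⟩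
      · have hx1 : 0 < x - 1 := by linarith
        have e := Real.Gamma_add_one hx1.ne'
        have s := hstep (x - 1) hx1
        rw [sub_add_cancel] at e s
        rw [e]
        calc (x - 1) * Real.Gamma (x - 1) ≤ (x - 1) * (max C 1 * g (x - 1)) :=
              mul_le_mul_of_nonneg_left (ih (x - 1) (by linarith) (by linarith)) hx1.le
          _ = max C 1 * ((x - 1) * g (x - 1)) := by ring
          _ ≤ max C 1 * g x := by gcongr
  refine ⟨max C 1, by positivity, fun x hx => hall ⌈x⌉₊ x hx ?_⟩
  linarith [Nat.le_ceil x]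

/-- Evaluation of the saddle-point bound at `σ = 2y`, where `x = 2 ^ r₂ * y ^ (n / 2)`. -/
lemma exists_saddle_bound (r₁ r₂ : ℕ) :
    ∃ K : ℝ, ∀ y : ℝ, 1 ≤ y →
      (2 ^ r₂ * y ^ (((r₁ + 2 * r₂ : ℕ) : ℝ) / 2)) ^ (-(2 * y)) *
        (Real.Gamma y ^ r₁ * Real.Gamma (2 * y) ^ r₂) * √(2 * y) ≤
      K * (y ^ (-((r₁ : ℝ) + r₂ - 1) / 2) * Real.exp (-((r₁ + 2 * r₂ : ℕ) : ℝ) * y)) := by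
  obtain ⟨C, hC0, hC⟩ := exists_Gamma_le_stirling
  refine ⟨C ^ r₁ * C ^ r₂ * Real.exp (Real.log 2 * (1 / 2 - r₂ / 2)), fun y hy => ?_⟩
  have hy0 : 0 < y := by linarith
  have h1 := hC y hy
  have h2 := hC (2 * y) (by linarith)
  have hG1 := (Real.Gamma_pos_of_pos hy0).le
  have hG2 := (Real.Gamma_pos_of_pos (show 0 < 2 * y by linarith)).le
  calc _ ≤ (2 ^ r₂ * y ^ (((r₁ + 2 * r₂ : ℕ) : ℝ) / 2)) ^ (-(2 * y)) *
        ((C * (y ^ (y - 1 / 2) * Real.exp (-y))) ^ r₁ *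
          (C * ((2 * y) ^ (2 * y - 1 / 2) * Real.exp (-(2 * y)))) ^ r₂) * √(2 * y) := by
        gcongr
    _ = _ := by
        have hb : (2 : ℝ) ^ r₂ * y ^ (((r₁ + 2 * r₂ : ℕ) : ℝ) / 2) =
            Real.exp (r₂ * Real.log 2 + Real.log y * (((r₁ + 2 * r₂ : ℕ) : ℝ) / 2)) := by
          rw [Real.exp_add, ← Real.rpow_def_of_pos hy0, mul_comm (r₂ : ℝ),
            ← Real.rpow_def_of_pos two_pos, Real.rpow_natCast]
        rw [hb, Real.sqrt_eq_rpow, Real.rpow_def_of_pos (Real.exp_pos _), Real.log_exp,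
          Real.rpow_def_of_pos hy0, Real.rpow_def_of_pos hy0,
          Real.rpow_def_of_pos (by linarith : 0 < 2 * y),
          Real.rpow_def_of_pos (by linarith : 0 < 2 * y), Real.log_mul two_ne_zero hy0.ne']
        simp only [mul_pow, ← Real.exp_nat_mul]
        have : ∀ a b c d e f h i j k l : ℝ, a + (b + c + (d + e)) + f = h + (i + j) →
          Real.exp a * (k * (Real.exp b * Real.exp c) * (l * (Real.exp d * Real.exp e))) *
            Real.exp f = k * l * Real.exp h * (Real.exp i * Real.exp j) := by
          intro a b c d e f h i j k l H
          have H' := congrArg Real.exp H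
          simp only [Real.exp_add] at H'
          linear_combination k * l * H'
        apply this
        push_cast
        ring

lemma continuousOn_Gamma_prod (r₁ r₂ : ℕ) :
    ContinuousOn (fun σ : ℝ => Real.Gamma (σ / 2) ^ r₁ * Real.Gamma σ ^ r₂) (Set.Ioi 0) := by
  have h : ∀ σ : ℝ, 0 < σ → ContinuousAt Real.Gamma σ := fun σ hσ =>
    (Real.differentiableAt_Gamma fun m => by
      have : (0 : ℝ) ≤ m := m.cast_nonneg
      linarith).continuousAt
  intro σ hσ
  have hσ' : 0 < σ := hσ
  have h2 : ContinuousAt (fun σ : ℝ => Real.Gamma (σ / 2)) σ :=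
    ContinuousAt.comp (f := fun σ : ℝ => σ / 2) (h (σ / 2) (half_pos hσ')) (by fun_prop)
  exact ((h2.pow r₁).mul ((h σ hσ').pow r₂)).continuousWithinAt

/-- The line of integration in the inverse Mellin transform of a product of Gamma functions
can be moved to the right. -/
lemma mellinInv_Gamma_prod_eq {r₁ r₂ : ℕ} (h : 1 ≤ r₁ + r₂) {a b x : ℝ} (ha : 0 < a)
    (hab : a ≤ b) (hx : 0 < x) :
    mellinInv a (fun s => Complex.Gamma (s / 2) ^ r₁ * Complex.Gamma s ^ r₂) x =
      mellinInv b (fun s => Complex.Gamma (s / 2) ^ r₁ * Complex.Gamma s ^ r₂) x := by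
  have hx0 : (x : ℂ) ≠ 0 := ofReal_ne_zero.2 hx.ne'
  have hcont : ContinuousOn
      (fun σ : ℝ => x ^ (-σ) * (Real.Gamma (σ / 2) ^ r₁ * Real.Gamma σ ^ r₂)) (Set.Icc a b) := by
    refine ContinuousOn.mul ?_ ((continuousOn_Gamma_prod r₁ r₂).mono fun σ hσ => ha.trans_le hσ.1)
    exact (continuous_const.rpow continuous_neg fun _ => Or.inl hx.ne').continuousOn
  obtain ⟨C, hC⟩ := isCompact_Icc.bddAbove_image hcont
  have hG : ∀ s : ℂ, 0 < s.re → DifferentiableAt ℂ Complex.Gamma s := fun s hs =>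
    Complex.differentiableAt_Gamma s fun m h => by
      have : (0 : ℝ) ≤ m := m.cast_nonneg
      rw [h] at hs
      simp at hs
      linarith
  rw [mellinInv, mellinInv]
  congr 1
  refine integral_vertical_eq_of_decay (c := b + 4) (C := C)
    (f := fun s => (x : ℂ) ^ (-s) • (Complex.Gamma (s / 2) ^ r₁ * Complex.Gamma s ^ r₂))
    hab (by linarith) ?_ ?_
  · intro s hs
    have hs' : 0 < s.re := ha.trans_le hs
    have h2 : DifferentiableAt ℂ (fun s : ℂ => Complex.Gamma (s / 2)) s :=
      DifferentiableAt.comp (f := fun s : ℂ => s / 2) s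
        (hG (s / 2) (by simpa using hs')) (by fun_prop)
    refine DifferentiableAt.differentiableWithinAt ?_
    exact (differentiableAt_id.neg.const_cpow (Or.inl hx0)).smul
      ((h2.pow r₁).mul ((hG s hs').pow r₂))
  · intro σ hσ t
    have hσ0 : 0 < σ := ha.trans_le hσ.1
    have h1 := norm_Gamma_prod_mul_le h 1 hσ0 (A := b + 4) (by push_cast; linarith [hσ.2]) t
    have h2 := hC (Set.mem_image_of_mem _ hσ)
    simp only [Nat.cast_one, one_mul] at h1 h2
    rw [norm_smul, Complex.norm_cpow_eq_rpow_re_of_pos hx, ← div_eq_mul_inv,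
      le_div_iff₀ (by positivity), mul_assoc]
    refine le_trans ?_ h2
    simp only [neg_re, add_re, ofReal_re, mul_re, I_re, mul_zero, ofReal_im, I_im, zero_mul,
      sub_zero, add_zero]
    gcongr

/-- The trivial bound on the vertical line of real part `σ`. -/
lemma norm_mellinInv_Gamma_prod_le {r₁ r₂ : ℕ} (h : 1 ≤ r₁ + r₂) {σ x : ℝ} (hσ : 1 ≤ σ)
    (hx : 0 < x) :
    ‖mellinInv σ (fun s => Complex.Gamma (s / 2) ^ r₁ * Complex.Gamma s ^ r₂) x‖ ≤
      13 / 2 * (x ^ (-σ) * (Real.Gamma (σ / 2) ^ r₁ * Real.Gamma σ ^ r₂) * √σ) := by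
  have hσ0 : 0 < σ := by linarith
  set G := Real.Gamma (σ / 2) ^ r₁ * Real.Gamma σ ^ r₂ with hGdef
  have hc : 0 < 13 * √σ := by positivity
  have hb : ∀ t : ℝ, ‖(x : ℂ) ^ (-(σ + t * I)) •
      (Complex.Gamma ((σ + t * I) / 2) ^ r₁ * Complex.Gamma (σ + t * I) ^ r₂)‖ ≤
      x ^ (-σ) * G * (1 + (t / (13 * √σ)) ^ 2)⁻¹ := by
    intro t
    have hM := Nat.le_ceil σ
    have hM' := Nat.ceil_lt_add_one hσ0.le
    have h1 := norm_Gamma_prod_mul_le h ⌈σ⌉₊ hσ0 (A := 13 * σ) (by linarith) t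
    have h2 : (t / (13 * √σ)) ^ 2 ≤ ⌈σ⌉₊ * (t / (13 * σ)) ^ 2 := by
      have : (t / (13 * √σ)) ^ 2 = σ * (t / (13 * σ)) ^ 2 := by
        rw [div_pow, mul_pow, Real.sq_sqrt hσ0.le]
        field_simp
      rw [this]
      gcongr
    rw [norm_smul, Complex.norm_cpow_eq_rpow_re_of_pos hx, ← div_eq_mul_inv,
      le_div_iff₀ (by positivity), mul_assoc]
    simp only [neg_re, add_re, ofReal_re, mul_re, I_re, mul_zero, ofReal_im, I_im, zero_mul,
      sub_zero, add_zero]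
    gcongr
    refine le_trans ?_ h1
    gcongr
  have hI : ∫ t : ℝ, (1 + (t / (13 * √σ)) ^ 2)⁻¹ = 13 * √σ * Real.pi := by
    rw [Measure.integral_comp_div (fun t : ℝ => (1 + t ^ 2)⁻¹), integral_univ_inv_one_add_sq,
      abs_of_pos hc, smul_eq_mul]
  have hle := norm_integral_le_of_norm_le
    ((integrable_inv_one_add_div_sq hc).const_mul (x ^ (-σ) * G)) (ae_of_all _ hb)
  rw [integral_const_mul, hI] at hle
  rw [mellinInv, norm_smul, Real.norm_of_nonneg (by positivity)]
  calc _ ≤ 1 / (2 * Real.pi) * (x ^ (-σ) * G * (13 * √σ * Real.pi)) := by gcongr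
    _ = _ := by field_simp

/-- The asymptotic estimate (2.3) of Dixit–Gupta–Vatwani: with `n = r₁ + 2r₂ ≥ 1` and
`r = r₁ + r₂ - 1`, the function
`Z̃_{r₁,r₂}(x) = (1/(2πi)) ∫_{Re s = d} Γ^{r₁}(s/2) Γ^{r₂}(s) x^{-s} ds` (any `d > 0`)
satisfies `Z̃_{r₁,r₂}(x) = O(x^{-r/n} exp(-n (x/2^{r₂})^{2/n}))` as `x → ∞`. -/
theorem Ztilde_asymptotic (r₁ r₂ n r : ℕ)
    (hn : n = r₁ + 2 * r₂) (hn1 : 1 ≤ n) (hr : r = r₁ + r₂ - 1)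
    (d : ℝ) (hd : 0 < d) :
    (fun x : ℝ =>
        mellinInv d (fun s => (Complex.Gamma (s / 2)) ^ r₁ * (Complex.Gamma s) ^ r₂) x)
      =O[atTop] fun x : ℝ =>
        x ^ (-(r : ℝ) / n) * Real.exp (-(n : ℝ) * (x / 2 ^ r₂) ^ (2 / (n : ℝ))) := by
  obtain ⟨K, hK⟩ := exists_saddle_bound r₁ r₂
  have h12 : 1 ≤ r₁ + r₂ := by omega
  have hn0 : (0 : ℝ) < n := by exact_mod_cast hn1
  have hrR : (r : ℝ) = r₁ + r₂ - 1 := by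
    rw [hr, Nat.cast_sub h12]
    push_cast
    ring
  have hylim : Tendsto (fun x : ℝ => (x / 2 ^ r₂) ^ (2 / (n : ℝ))) atTop atTop :=
    (tendsto_rpow_atTop (by positivity)).comp (tendsto_id.atTop_div_const (by positivity))
  refine Asymptotics.IsBigO.of_bound (13 / 2 * K * (2 ^ r₂) ^ ((r : ℝ) / n)) ?_
  filter_upwards [eventually_gt_atTop 0, hylim.eventually_ge_atTop 1,
    hylim.eventually_ge_atTop d] with x hx hy1 hyd
  set y := (x / 2 ^ r₂) ^ (2 / (n : ℝ)) with hy
  have hxy : x = 2 ^ r₂ * y ^ ((n : ℝ) / 2) := by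
    rw [hy, ← Real.rpow_mul (by positivity), div_mul_div_cancel₀ hn0.ne', div_self two_ne_zero,
      Real.rpow_one]
    field_simp
  have hyr : y ^ (-(r : ℝ) / 2) = (2 ^ r₂) ^ ((r : ℝ) / n) * x ^ (-(r : ℝ) / n) := by
    rw [hy, ← Real.rpow_mul (by positivity),
      show 2 / (n : ℝ) * (-(r : ℝ) / 2) = -(r : ℝ) / n by field_simp,
      Real.div_rpow hx.le (by positivity), neg_div,
      Real.rpow_neg (by positivity : (0 : ℝ) ≤ 2 ^ r₂),
      div_inv_eq_mul, mul_comm]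
  rw [mellinInv_Gamma_prod_eq h12 hd (show d ≤ 2 * y by linarith) hx]
  refine (norm_mellinInv_Gamma_prod_le h12 (show 1 ≤ 2 * y by linarith) hx).trans ?_
  have hk := hK y hy1
  rw [← hn, ← hxy, ← hrR, hyr] at hk
  rw [mul_div_cancel_left₀ y two_ne_zero, Real.norm_of_nonneg (by positivity)]
  linarith
end
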